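/- Let 0<α<1/2 and β>2α. Suppose γ_i : 𝕋×[0,T] → ℝ² (i = 1,2) are C^{1,β} flows of two C^{1,β} patch solutions (Ω_{i,t}) of α-SQG. Let T_i and g_i be the unit tangent and arc-length metric of γ_i, and set δ(t) := |γ_1(·,t)−γ_2(·,t)|²_{L²} + |g_1(·,t)−g_2(·,t)|²_{L²} + |T_1(·,t)−T_2(·,t)|²_{L²}. Then t ↦ δ(t) is continuous on [0,T] and there exists a constant C > 0 such that δ(t) ≤ δ(0) + C ∫_0^t δ(τ) dτ for all t ∈ [0,T]. -/

import Mathlib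

open MeasureTheory Real Set Function Filter Bornology
open scoped RealInnerProductSpace Topology

noncomputable section

/-- The plane `ℝ²`. -/
abbrev R2 := EuclideanSpace ℝ (Fin 2)

/-- The counterclockwise rotation by 90°: `(a,b)^⊥ = (-b,a)`. -/
def perp (v : R2) : R2 := (WithLp.equiv 2 (Fin 2 → ℝ)).symm ![-(v 1), v 0]

/-- The α-SQG velocity generated by a bounded set `U`:
`v_U(x) = ∫_U (x-y)^⊥ / ‖x-y‖^{2+2α} dy`. -/
def sqgVelocity (α : ℝ) (U : Set R2) (x : R2) : R2 :=
  ∫ y in U, (‖x - y‖ ^ (2 + 2 * α))⁻¹ • perp (x - y)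

/-- Eulerian (weak) patch solution of the α-SQG equation on `[0,T]`: a time-dependent
bounded domain such that `χ_{Ω_t}` is a weak solution of the transport equation by the
α-SQG velocity of `Ω_t`, tested against smooth compactly supported functions on
`ℝ² × [0,T)`. -/
def IsPatchSol (α T : ℝ) (Ω : ℝ → Set R2) : Prop :=
  (∀ t ∈ Icc (0:ℝ) T, IsOpen (Ω t) ∧ IsBounded (Ω t) ∧ IsConnected (Ω t)) ∧
  ∀ φ : R2 × ℝ → ℝ, ContDiff ℝ (⊤ : ℕ∞) φ → HasCompactSupport φ →
    (∀ p : R2 × ℝ, T ≤ p.2 → φ p = 0) →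
    ∫ x in Ω 0, φ (x, 0) =
      - ∫ t in Ioc (0:ℝ) T, ∫ x in Ω t,
          (deriv (fun s => φ (x, s)) t +
            ⟪sqgVelocity α (Ω t) x, gradient (fun y => φ (y, t)) x⟫)

/-- `γ` is an `L`-periodic arc-length (unit-speed) parametrization of the set `S`:
`L`-periodic, injective on `[0,L)`, `C¹` with `‖γ'‖ ≡ 1`, and with image `S`. -/
def IsArcLengthParam (L : ℝ) (γ : ℝ → R2) (S : Set R2) : Prop :=
  0 < L ∧ Periodic γ L ∧ InjOn γ (Ico 0 L) ∧ ContDiff ℝ 1 γ ∧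
    (∀ s, ‖deriv γ s‖ = 1) ∧ range γ = S

/-- `C^{1,β}` patch solution: a patch solution whose boundaries admit arc-length
parametrizations with a `β`-Hölder bound on the derivative, uniform in time. -/
def IsC1BetaPatchSol (α T β : ℝ) (Ω : ℝ → Set R2) : Prop :=
  IsPatchSol α T Ω ∧ ∃ M : ℝ, ∀ t ∈ Icc (0:ℝ) T, ∃ L γ,
    IsArcLengthParam L γ (frontier (Ω t)) ∧
    ∀ s s' : ℝ, ‖deriv γ s - deriv γ s'‖ ≤ M * |s - s'| ^ β

/-- Spatial derivative `∂ₓγ` of a time-dependent parametrization. -/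
def pderiv (γ : ℝ → ℝ → R2) (x t : ℝ) : R2 := deriv (fun x' => γ x' t) x

/-- Arc-length metric `g = ‖∂ₓγ‖` of a time-dependent parametrization. -/
def metricOf (γ : ℝ → ℝ → R2) (x t : ℝ) : ℝ := ‖pderiv γ x t‖

/-- Unit tangent `T = ∂ₓγ / ‖∂ₓγ‖` of a time-dependent parametrization. -/
def tangentOf (γ : ℝ → ℝ → R2) (x t : ℝ) : R2 := (metricOf γ x t)⁻¹ • pderiv γ x t

/-- Squared `L²`-norm over one period `[0,2π]` of the torus `𝕋 = ℝ/2πℤ`. -/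
def L2sq {E : Type*} [NormedAddCommGroup E] (f : ℝ → E) : ℝ :=
  ∫ x in Ioc (0:ℝ) (2 * π), ‖f x‖ ^ 2

/-- `γ` is a (Lagrangian) flow of the patch solution `Ω` on `[0,T]`: for each `t` it is
a `2π`-periodic `C¹` parametrization of `∂Ω_t` with nonvanishing derivative, and the
trajectories solve `∂ₜγ(x,t) = v(γ(x,t),t)` with `v(·,t)` the α-SQG velocity of `Ω_t`. -/
def IsFlowOf (α T : ℝ) (Ω : ℝ → Set R2) (γ : ℝ → ℝ → R2) : Prop :=
  (∀ t ∈ Icc (0:ℝ) T,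
     Periodic (fun x => γ x t) (2 * π) ∧
     ContDiff ℝ 1 (fun x => γ x t) ∧
     InjOn (fun x => γ x t) (Ico 0 (2 * π)) ∧
     (∀ x, pderiv γ x t ≠ 0) ∧
     range (fun x => γ x t) = frontier (Ω t)) ∧
  (∀ x : ℝ, ∀ t ∈ Icc (0:ℝ) T,
     HasDerivWithinAt (fun s => γ x s) (sqgVelocity α (Ω t) (γ x t)) (Icc (0:ℝ) T) t)

/-- A `C^{1,β}` flow: a flow bounded in `C^{1,β}(𝕋)` uniformly in time. -/
def IsC1BetaFlow (α β T : ℝ) (Ω : ℝ → Set R2) (γ : ℝ → ℝ → R2) : Prop :=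
  IsFlowOf α T Ω γ ∧ ∃ M : ℝ, ∀ t ∈ Icc (0:ℝ) T, ∀ x y : ℝ,
    ‖γ x t‖ ≤ M ∧ ‖pderiv γ x t‖ ≤ M ∧
    ‖pderiv γ x t - pderiv γ y t‖ ≤ M * |x - y| ^ β

/-- The stability quantity
`δ(t) = |γ₁-γ₂|²_{L²} + |g₁-g₂|²_{L²} + |T₁-T₂|²_{L²}` at time `t`. -/
def patchDelta (γ₁ γ₂ : ℝ → ℝ → R2) (t : ℝ) : ℝ :=
  L2sq (fun x => γ₁ x t - γ₂ x t) +
    L2sq (fun x => metricOf γ₁ x t - metricOf γ₂ x t) +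
    L2sq (fun x => tangentOf γ₁ x t - tangentOf γ₂ x t)

/-- `γ` is a `2π`-periodic `C¹` simple closed curve with nonvanishing derivative `p`. -/
structure IsC1Loop (γ p : ℝ → R2) : Prop where
  hasDeriv : ∀ θ, HasDerivAt γ (p θ) θ
  cont_deriv : Continuous p
  ne_zero : ∀ θ, p θ ≠ 0
  per : Periodic γ (2 * π)
  inj : InjOn γ (Ico 0 (2 * π))

@[simp] lemma perp_apply_zero (v : R2) : perp v 0 = -(v 1) := rfl

@[simp] lemma perp_apply_one (v : R2) : perp v 1 = v 0 := rfl

lemma inner_R2 (v w : R2) : ⟪v, w⟫ = v 0 * w 0 + v 1 * w 1 := by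
  simp [PiLp.inner_apply, Fin.sum_univ_two, mul_comm]

lemma ext_R2 {v w : R2} (h0 : v 0 = w 0) (h1 : v 1 = w 1) : v = w := by
  ext i; fin_cases i
  · exact h0
  · exact h1

lemma perp_ne_zero {v : R2} (hv : v ≠ 0) : perp v ≠ 0 := by
  intro h
  apply hv
  have h0 := congrArg (fun u : R2 => u 0) h
  have h1 := congrArg (fun u : R2 => u 1) h
  simp at h0 h1
  exact ext_R2 (by simpa using h1) (by simpa using h0)

lemma inner_smul_perp (p p₀ w : R2) :
    ⟪p, p₀⟫ • perp w = (w 0 * p₀ 1 - w 1 * p₀ 0) • p + ⟪p, w⟫ • perp p₀ := by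
  apply ext_R2 <;> simp [inner_R2] <;> ring

namespace IsC1Loop

variable {γ p : ℝ → R2}

lemma cont (h : IsC1Loop γ p) : Continuous γ :=
  continuous_iff_continuousAt.2 fun θ => (h.hasDeriv θ).continuousAt

lemma per_deriv (h : IsC1Loop γ p) : Periodic p (2 * π) := by
  intro θ
  have h1 : HasDerivAt (fun x => γ (x + 2 * π)) (p (θ + 2 * π)) θ :=
    (h.hasDeriv (θ + 2 * π)).comp_add_const θ (2 * π)
  have h2 : (fun x => γ (x + 2 * π)) = γ := funext h.per
  rw [h2] at h1
  exact h1.unique (h.hasDeriv θ)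

lemma eq_add_of_eq (h : IsC1Loop γ p) {x y : ℝ} (hxy : γ x = γ y) :
    ∃ k : ℤ, x = y + k * (2 * π) := by
  have hp : (0 : ℝ) < 2 * π := by positivity
  have hx := toIcoMod_mem_Ico' hp x
  have hy := toIcoMod_mem_Ico' hp y
  have e : ∀ z, γ (toIcoMod hp 0 z) = γ z := by
    intro z
    rw [toIcoMod]
    exact h.per.sub_zsmul_eq _
  have := h.inj hx hy (by rw [e, e, hxy])
  rw [toIcoMod, toIcoMod] at this
  refine ⟨toIcoDiv hp 0 x - toIcoDiv hp 0 y, ?_⟩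
  simp only [zsmul_eq_mul] at this
  push_cast
  linarith

lemma eq_of_abs_sub_lt (h : IsC1Loop γ p) {x y : ℝ} (hxy : γ x = γ y)
    (hlt : |x - y| < 2 * π) : x = y := by
  obtain ⟨k, hk⟩ := h.eq_add_of_eq hxy
  have hp : (0 : ℝ) < 2 * π := by positivity
  have : x - y = k * (2 * π) := by linarith
  rw [this, abs_mul, abs_of_pos hp] at hlt
  have h1 : |(k : ℝ)| < 1 := by nlinarith
  have h2 : |k| < 1 := by exact_mod_cast h1
  have : k = 0 := by simpa using h2
  rw [hk, this]; simp

lemma exists_near (h : IsC1Loop γ p) (θ₀ : ℝ) {r : ℝ} (hr : 0 < r) :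
    ∃ ρ > 0, ∀ θ, dist (γ θ) (γ θ₀) < ρ → ∃ k : ℤ, |θ + k * (2 * π) - θ₀| < r := by
  have hp : (0 : ℝ) < 2 * π := by positivity
  set K := γ '' (Icc (θ₀ + r / 2) (θ₀ - r / 2 + 2 * π)) with hK
  have hKc : IsCompact K := isCompact_Icc.image h.cont
  have hmem : γ θ₀ ∈ Kᶜ := by
    rintro ⟨θ, hθ, he⟩
    have := h.eq_of_abs_sub_lt he (by rw [abs_lt]; constructor <;> linarith [hθ.1, hθ.2])
    linarith [hθ.1]
  obtain ⟨ρ, hρ, hb⟩ := Metric.isOpen_iff.1 hKc.isClosed.isOpen_compl _ hmem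
  refine ⟨ρ, hρ, fun θ hθ => ?_⟩
  have hm := toIcoMod_mem_Ico hp (θ₀ - r / 2) θ
  refine ⟨-toIcoDiv hp (θ₀ - r / 2) θ, ?_⟩
  have e : θ + ((-toIcoDiv hp (θ₀ - r / 2) θ : ℤ) : ℝ) * (2 * π)
      = toIcoMod hp (θ₀ - r / 2) θ := by
    rw [toIcoMod, zsmul_eq_mul]; push_cast; ring
  rw [e]
  have hg : γ (toIcoMod hp (θ₀ - r / 2) θ) = γ θ := by
    rw [toIcoMod]
    exact h.per.sub_zsmul_eq _
  have hn : γ θ ∉ K := hb hθ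
  rw [← hg] at hn
  have h1 : toIcoMod hp (θ₀ - r / 2) θ < θ₀ + r / 2 := by
    by_contra hc
    exact hn ⟨_, ⟨not_lt.1 hc, hm.2.le⟩, rfl⟩
  rw [abs_lt]
  constructor <;> linarith [hm.1]

end IsC1Loop

/-- Coordinates `(θ, τ) ↦ γ θ + τ e` near a curve `γ`. -/
def collarMap (γ : ℝ → R2) (e : R2) (q : R2) : R2 := γ (q 0) + q 1 • e

/-- The linear map with columns `v` and `e`. -/
def columnsCLM (v e : R2) : R2 →L[ℝ] R2 :=
  (EuclideanSpace.proj (0 : Fin 2) : R2 →L[ℝ] ℝ).smulRight v +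
    (EuclideanSpace.proj (1 : Fin 2) : R2 →L[ℝ] ℝ).smulRight e

lemma det_columnsCLM (v e : R2) : (columnsCLM v e).det = v 0 * e 1 - v 1 * e 0 := by
  rw [ContinuousLinearMap.det,
    ← LinearMap.det_toMatrix (EuclideanSpace.basisFun (Fin 2) ℝ).toBasis, Matrix.det_fin_two]
  simp [LinearMap.toMatrix_apply, columnsCLM]
  ring

lemma det_columnsCLM_perp (v w : R2) : (columnsCLM v (perp w)).det = ⟪v, w⟫ := by
  rw [det_columnsCLM, inner_R2]; simp

namespace IsC1Loop

variable {γ p : ℝ → R2}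

lemma hasStrictFDerivAt_collarMap (h : IsC1Loop γ p) (e q : R2) :
    HasStrictFDerivAt (collarMap γ e) (columnsCLM (p (q 0)) e) q := by
  have h1 : HasStrictDerivAt γ (p (q 0)) (q 0) :=
    hasStrictDerivAt_of_hasDerivAt_of_continuousAt (Eventually.of_forall h.hasDeriv)
      h.cont_deriv.continuousAt
  have h2 : HasStrictFDerivAt (fun q : R2 => q 0)
      (EuclideanSpace.proj (0 : Fin 2) : R2 →L[ℝ] ℝ) q :=
    (EuclideanSpace.proj (0 : Fin 2) : R2 →L[ℝ] ℝ).hasStrictFDerivAt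
  have h3 : HasStrictFDerivAt (fun q : R2 => q 1)
      (EuclideanSpace.proj (1 : Fin 2) : R2 →L[ℝ] ℝ) q :=
    (EuclideanSpace.proj (1 : Fin 2) : R2 →L[ℝ] ℝ).hasStrictFDerivAt
  have h4 := (h1.hasStrictFDerivAt.comp q h2).add (h3.smul_const e)
  refine h4.congr_fderiv ?_
  ext1 x
  simp [columnsCLM]

lemma exists_chart (h : IsC1Loop γ p) (θ₀ : ℝ) : ∃ r τ : ℝ, 0 < r ∧ r ≤ π / 2 ∧ 0 < τ ∧
    (∀ θ, |θ - θ₀| ≤ r → 0 < ⟪p θ, p θ₀⟫) ∧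
    (∀ q q' : R2, |q 0 - θ₀| ≤ r → |q' 0 - θ₀| ≤ r →
      collarMap γ (perp (p θ₀)) q = collarMap γ (perp (p θ₀)) q' → q = q') ∧
    collarMap γ (perp (p θ₀)) '' {q | |q 0 - θ₀| < r ∧ |q 1| < τ} ∈ 𝓝 (γ θ₀) ∧
    (∀ q : R2, |q 0 - θ₀| ≤ r → |q 1| ≤ τ →
      collarMap γ (perp (p θ₀)) q ∈ range γ → q 1 = 0) := by
  set e := perp (p θ₀) with he
  have he0 : e ≠ 0 := perp_ne_zero (h.ne_zero θ₀)
  have hp0 : 0 < ⟪p θ₀, p θ₀⟫ := real_inner_self_pos.2 (h.ne_zero θ₀)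
  have hpe : ⟪p θ₀, e⟫ = 0 := by simp [he, inner_R2]; ring
  obtain ⟨r₁, hr₁, hpos⟩ : ∃ r > 0, ∀ θ, |θ - θ₀| < r → 0 < ⟪p θ, p θ₀⟫ := by
    have : ∀ᶠ θ in 𝓝 θ₀, 0 < ⟪p θ, p θ₀⟫ :=
      (h.cont_deriv.inner continuous_const).continuousAt.eventually_const_lt hp0
    obtain ⟨r, hr, H⟩ := Metric.eventually_nhds_iff.1 this
    exact ⟨r, hr, fun θ hθ => H (by rwa [Real.dist_eq])⟩
  set r₀ := min (r₁ / 2) (π / 2) with hr₀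
  have hr₀pos : 0 < r₀ := by positivity
  have hr₀1 : r₀ < r₁ := (min_le_left _ _).trans_lt (by linarith)
  have hmono : StrictMonoOn (fun θ => ⟪γ θ, p θ₀⟫) (Icc (θ₀ - r₀) (θ₀ + r₀)) := by
    refine strictMonoOn_of_deriv_pos (convex_Icc _ _) (h.cont.inner continuous_const).continuousOn
      fun x hx => ?_
    rw [interior_Icc] at hx
    have := (h.hasDeriv x).inner ℝ (hasDerivAt_const x (p θ₀))
    rw [this.deriv]
    simp only [inner_zero_right, zero_add]
    exact hpos x (by rw [abs_lt]; constructor <;> linarith [hx.1, hx.2])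
  have hinj : ∀ q q' : R2, |q 0 - θ₀| ≤ r₀ → |q' 0 - θ₀| ≤ r₀ →
      collarMap γ e q = collarMap γ e q' → q = q' := by
    intro q q' hq hq' hqq
    have hin : ∀ q : R2, ⟪collarMap γ e q, p θ₀⟫ = ⟪γ (q 0), p θ₀⟫ := by
      intro q
      rw [collarMap, inner_add_left, inner_smul_left, real_inner_comm (p θ₀) e, hpe]; simp
    have h0 : q 0 = q' 0 := by
      rw [abs_le] at hq hq'
      refine hmono.injOn ⟨by linarith, by linarith⟩ ⟨by linarith, by linarith⟩ ?_
      simp only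
      rw [← hin, ← hin, hqq]
    refine ext_R2 h0 ?_
    simp only [collarMap, h0, add_right_inj] at hqq
    exact smul_left_injective ℝ he0 hqq
  obtain ⟨ρ, hρ, hnear⟩ := h.exists_near θ₀ hr₀pos
  have hcont : Continuous fun z : ℝ × ℝ => γ z.1 + z.2 • e :=
    (h.cont.comp continuous_fst).add (continuous_snd.smul continuous_const)
  have hev : ∀ᶠ z : ℝ × ℝ in 𝓝 (θ₀, 0), dist (γ z.1 + z.2 • e) (γ θ₀) < ρ := by
    have := hcont.continuousAt (x := (θ₀, 0))
    have h2 := Metric.tendsto_nhds.1 this ρ hρ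
    simpa using h2
  obtain ⟨s, hs, hsb⟩ := Metric.eventually_nhds_iff.1 hev
  have hr : 0 < min (s / 2) r₀ := by positivity
  refine ⟨min (s / 2) r₀, s / 2, hr, (min_le_right _ _).trans (min_le_right _ _), by positivity,
    fun θ hθ => hpos θ ((hθ.trans (min_le_right _ _)).trans_lt hr₀1),
    fun q q' hq hq' => hinj q q' (hq.trans (min_le_right _ _)) (hq'.trans (min_le_right _ _)),
    ?_, ?_⟩
  · set q₀ : R2 := !₂[θ₀, 0] with hq₀
    have hdet : (columnsCLM (p (q₀ 0)) e).det ≠ 0 := by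
      rw [he, det_columnsCLM_perp]; simpa [hq₀] using hp0.ne'
    have hst := h.hasStrictFDerivAt_collarMap e q₀
    have hmap := HasStrictFDerivAt.map_nhds_eq_of_equiv
      (f' := (columnsCLM (p (q₀ 0)) e).toContinuousLinearEquivOfDetNeZero hdet) (by simpa using hst)
    have hval : collarMap γ e q₀ = γ θ₀ := by simp [collarMap, hq₀]
    rw [hval] at hmap
    rw [← hmap]
    apply image_mem_map
    have hc0 : Continuous fun q : R2 => |q 0 - θ₀| := by fun_prop
    have hc1 : Continuous fun q : R2 => |q 1| := by fun_prop
    refine ((isOpen_lt hc0 continuous_const).inter (isOpen_lt hc1 continuous_const)).mem_nhds ?_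
    constructor
    · simpa [hq₀] using ⟨hs, hr₀pos⟩
    · simpa [hq₀] using hs
  · rintro q hq hq1 ⟨θ, hθ⟩
    have hd : dist (γ θ) (γ θ₀) < ρ := by
      rw [hθ]
      have : dist ((q 0, q 1) : ℝ × ℝ) (θ₀, 0) < s := by
        rw [Prod.dist_eq, Real.dist_eq, Real.dist_eq, max_lt_iff]
        constructor
        · exact (hq.trans (min_le_left _ _)).trans_lt (by linarith)
        · simp only [sub_zero]; linarith
      have h2 := hsb this
      exact h2
    obtain ⟨k, hk⟩ := hnear θ hd
    have := hinj q !₂[θ + k * (2 * π), 0] (hq.trans (min_le_right _ _)) (by simpa using hk.le)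
      (by
        rw [← hθ, ← h.per.int_mul k θ]
        simp [collarMap])
    simpa using congrArg (fun v : R2 => v 1) this

end IsC1Loop

lemma intervalIntegral_swap_of_continuous {E : Type*} [NormedAddCommGroup E] [NormedSpace ℝ E]
    {F : ℝ → ℝ → E} (hF : Continuous (uncurry F)) (a b c d : ℝ) :
    ∫ x in a..b, ∫ y in c..d, F x y = ∫ y in c..d, ∫ x in a..b, F x y := by
  apply intervalIntegral_intervalIntegral_swap
  exact (hF.continuousOn.integrableOn_compact (isCompact_uIcc.prod isCompact_uIcc)).mono_set
    (prod_mono uIoc_subset_uIcc uIoc_subset_uIcc)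

lemma setIntegral_R2_prod (s t : Set ℝ) (H : R2 → ℝ)
    (hH : IntegrableOn H {q | q 0 ∈ s ∧ q 1 ∈ t}) :
    ∫ q in {q : R2 | q 0 ∈ s ∧ q 1 ∈ t}, H q = ∫ x in s, ∫ y in t, H !₂[x, y] := by
  set e : R2 ≃ᵐ ℝ × ℝ := (MeasurableEquiv.toLp 2 (Fin 2 → ℝ)).symm.trans MeasurableEquiv.finTwoArrow
    with he
  have hmp : MeasurePreserving e volume volume :=
    (EuclideanSpace.volume_preserving_symm_measurableEquiv_toLp (Fin 2)).trans
      (volume_preserving_finTwoArrow ℝ)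
  have happ : ∀ q : R2, e q = (q 0, q 1) := fun q => rfl
  have hsymm : ∀ z : ℝ × ℝ, e.symm z = !₂[z.1, z.2] := by
    intro z
    rw [MeasurableEquiv.symm_apply_eq, happ]; simp
  have hpre : {q : R2 | q 0 ∈ s ∧ q 1 ∈ t} = e ⁻¹' (s ×ˢ t) := by
    ext q; simp [happ]
  have hHe : H = (fun z => H (e.symm z)) ∘ e := by ext q; simp
  have hi : IntegrableOn (fun z => H (e.symm z)) (s ×ˢ t) := by
    rw [hpre, hHe] at hH
    exact (hmp.integrableOn_comp_preimage e.measurableEmbedding).1 hH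
  calc ∫ q in {q : R2 | q 0 ∈ s ∧ q 1 ∈ t}, H q
      = ∫ q in e ⁻¹' (s ×ˢ t), (fun z => H (e.symm z)) (e q) := by rw [hpre]; simp
    _ = ∫ z in s ×ˢ t, H (e.symm z) := by
        rw [← hmp.setIntegral_preimage_emb e.measurableEmbedding (fun z => H (e.symm z)) (s ×ˢ t)]
    _ = _ := by
        rw [Measure.volume_eq_prod, setIntegral_prod _ (by rwa [← Measure.volume_eq_prod])]
        simp [hsymm]

lemma IsPreconnected.subset_or_subset_compl_closure {X : Type*} [TopologicalSpace X] {s u : Set X}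
    (hs : IsPreconnected s) (hu : IsOpen u) (h : Disjoint s (frontier u)) :
    s ⊆ u ∨ s ⊆ (closure u)ᶜ := by
  refine hs.subset_or_subset hu isClosed_closure.isOpen_compl
    (disjoint_compl_right_iff_subset.2 subset_closure) fun x hx => ?_
  by_cases hxu : x ∈ closure u
  · refine Or.inl (by_contra fun hn => ?_)
    exact h.ne_of_mem hx (by rw [hu.frontier_eq]; exact ⟨hxu, hn⟩) rfl
  · exact Or.inr hxu

/-- The divergence theorem holds for `Ω` with boundary orientation `s`,
for test functions supported near `z`. -/
def GreenNear (γ p : ℝ → R2) (Ω : Set R2) (s : ℝ) (z : R2) : Prop :=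
  ∃ N ∈ 𝓝 z, ∀ F : R2 → ℝ, ContDiff ℝ 1 F → HasCompactSupport F → tsupport F ⊆ N →
    ∀ w, ∫ y in Ω, fderiv ℝ F y (perp w) = -s * ∫ θ in (0)..(2 * π), ⟪p θ, w⟫ * F (γ θ)

lemma integrable_fderiv_apply {F : R2 → ℝ} (hF : ContDiff ℝ 1 F) (hc : HasCompactSupport F)
    (v : R2) : Integrable (fun y => fderiv ℝ F y v) :=
  ((hF.continuous_fderiv one_ne_zero).clm_apply continuous_const).integrable_of_hasCompactSupport
    (hc.fderiv_apply ℝ v)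

namespace IsC1Loop

variable {γ p : ℝ → R2}

lemma exists_greenNear (h : IsC1Loop γ p) {Ω : Set R2} (hΩ : IsOpen Ω)
    (hfr : frontier Ω = range γ) (θ₀ : ℝ) :
    ∃ s : ℝ, (s = 1 ∨ s = -1 ∨ s = 0) ∧ GreenNear γ p Ω s (γ θ₀) := by
  obtain ⟨r, τ, hr, hrπ, hτ, hpos, hinj, hnhds, hrange⟩ := h.exists_chart θ₀
  set e := perp (p θ₀) with he
  set Φ := collarMap γ e with hΦ
  set B : Set R2 := {q | |q 0 - θ₀| < r ∧ |q 1| < τ} with hB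
  have hΦd : ∀ q, HasFDerivAt Φ (columnsCLM (p (q 0)) e) q := fun q =>
    (h.hasStrictFDerivAt_collarMap e q).hasFDerivAt
  have hΦc : Continuous Φ := continuous_iff_continuousAt.2 fun q => (hΦd q).continuousAt
  -- each open side of the collar lies inside or outside `Ω`
  have side : ∀ I : Set ℝ, Convex ℝ I → (∀ x ∈ I, |x| < τ ∧ x ≠ 0) → ∃ c : ℝ, (c = 1 ∨ c = 0) ∧
      ∀ q : R2, |q 0 - θ₀| < r → q 1 ∈ I → ∀ f : R2 → ℝ,
        indicator Ω f (Φ q) = c * f (Φ q) := by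
    intro I hI hI0
    have hconv : Convex ℝ {q : R2 | q 0 ∈ Ioo (θ₀ - r) (θ₀ + r) ∧ q 1 ∈ I} := by
      intro a ha b hb s t hs ht hst
      exact ⟨by simpa using convex_Ioo _ _ ha.1 hb.1 hs ht hst,
        by simpa using hI ha.2 hb.2 hs ht hst⟩
    have hpc := hconv.isPreconnected.image Φ hΦc.continuousOn
    have hmem : ∀ q : R2, |q 0 - θ₀| < r → q 1 ∈ I →
        Φ q ∈ Φ '' {q : R2 | q 0 ∈ Ioo (θ₀ - r) (θ₀ + r) ∧ q 1 ∈ I} := by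
      intro q hq hq1
      rw [abs_lt] at hq
      exact ⟨q, ⟨⟨by linarith, by linarith⟩, hq1⟩, rfl⟩
    have hdisj : Disjoint (Φ '' {q : R2 | q 0 ∈ Ioo (θ₀ - r) (θ₀ + r) ∧ q 1 ∈ I})
        (frontier Ω) := by
      rw [Set.disjoint_left]
      rintro _ ⟨q, ⟨hq0, hq1⟩, rfl⟩ hf
      rw [hfr] at hf
      exact (hI0 _ hq1).2 (hrange q (by rw [abs_le]; constructor <;> linarith [hq0.1, hq0.2])
        (hI0 _ hq1).1.le hf)
    rcases hpc.subset_or_subset_compl_closure hΩ hdisj with hs | hs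
    · refine ⟨1, Or.inl rfl, fun q hq hq1 f => ?_⟩
      rw [indicator_of_mem (hs (hmem q hq hq1)), one_mul]
    · refine ⟨0, Or.inr rfl, fun q hq hq1 f => ?_⟩
      rw [indicator_of_notMem fun hc => hs (hmem q hq hq1) (subset_closure hc), zero_mul]
  obtain ⟨s₁, hs₁, hside₁⟩ := side (Ioo 0 τ) (convex_Ioo _ _) fun x hx =>
    ⟨by rw [abs_of_pos hx.1]; exact hx.2, hx.1.ne'⟩
  obtain ⟨s₂, hs₂, hside₂⟩ := side (Ioo (-τ) 0) (convex_Ioo _ _) fun x hx =>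
    ⟨by rw [abs_of_neg hx.2]; linarith [hx.1], hx.2.ne⟩
  refine ⟨s₁ - s₂, ?_, Φ '' B, hnhds, fun F hF hFc hsupp w => ?_⟩
  · rcases hs₁ with rfl | rfl <;> rcases hs₂ with rfl | rfl <;> norm_num
  have hFd : ∀ y, HasFDerivAt F (fderiv ℝ F y) y := fun y =>
    (hF.differentiable one_ne_zero y).hasFDerivAt
  have hF0 : ∀ y, y ∉ Φ '' B → F y = 0 := fun y hy =>
    image_eq_zero_of_notMem_tsupport fun hc => hy (hsupp hc)
  have hDF0 : ∀ y, y ∉ Φ '' B → fderiv ℝ F y = 0 := fun y hy =>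
    image_eq_zero_of_notMem_tsupport fun hc => hy (hsupp (tsupport_fderiv_subset ℝ hc))
  set f : R2 → ℝ := fun y => fderiv ℝ F y (perp w) with hf
  have hfint : Integrable f := integrable_fderiv_apply hF hFc _
  set P : ℝ → ℝ → R2 := fun x y => γ x + y • e with hP
  have hPc : Continuous (uncurry P) :=
    (h.cont.comp continuous_fst).add (continuous_snd.smul continuous_const)
  have hDFc := hF.continuous_fderiv one_ne_zero
  set c₁ : ℝ := w 0 * p θ₀ 1 - w 1 * p θ₀ 0 with hc₁
  have hGτ : ∀ x y, HasDerivAt (fun y => F (P x y)) (fderiv ℝ F (P x y) e) y := by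
    intro x y
    have h1 : HasDerivAt (fun y => P x y) e y := by
      have := ((hasDerivAt_id y).smul_const e).const_add (γ x)
      rw [one_smul] at this
      exact this
    exact (hFd (P x y)).comp_hasDerivAt y h1
  have hGθ : ∀ x y, HasDerivAt (fun x => F (P x y)) (fderiv ℝ F (P x y) (p x)) x := by
    intro x y
    have h1 : HasDerivAt (fun x => P x y) (p x) x := (h.hasDeriv x).add_const _
    exact (hFd (P x y)).comp_hasDerivAt x h1
  have hcθ : Continuous (uncurry fun x y => fderiv ℝ F (P x y) (p x)) :=
    (hDFc.comp hPc).clm_apply (h.cont_deriv.comp continuous_fst)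
  have hcτ : Continuous (uncurry fun x y => fderiv ℝ F (P x y) e) :=
    (hDFc.comp hPc).clm_apply continuous_const
  have hnotB : ∀ x y, |x - θ₀| ≤ r → ¬ (|x - θ₀| < r ∧ |y| < τ) → P x y ∉ Φ '' B := by
    rintro x y hx hxy ⟨q, hq, hqe⟩
    have := hinj q !₂[x, y] hq.1.le (by simpa using hx) (by rw [hqe]; simp [hP, hΦ, collarMap])
    rw [this] at hq
    exact hxy (by simpa [hB] using hq)
  -- reduction to an integral over the collar
  have hBset : B = {q : R2 | q 0 ∈ Ioo (θ₀ - r) (θ₀ + r) ∧ q 1 ∈ Ioo (-τ) τ} := by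
    ext q
    simp only [hB, mem_ofPred_eq, abs_lt, mem_Ioo]
    constructor <;> rintro ⟨⟨h1, h2⟩, h3⟩ <;> exact ⟨⟨by linarith, by linarith⟩, h3⟩
  have hBm : MeasurableSet B := by
    have hc0 : Continuous fun q : R2 => |q 0 - θ₀| := by fun_prop
    have hc1 : Continuous fun q : R2 => |q 1| := by fun_prop
    exact ((isOpen_lt hc0 continuous_const).inter (isOpen_lt hc1 continuous_const)).measurableSet
  have hBinj : InjOn Φ B := fun q hq q' hq' hqq => hinj q q' hq.1.le hq'.1.le hqq
  have hΦw : ∀ q ∈ B, HasFDerivWithinAt Φ (columnsCLM (p (q 0)) e) B q := fun q _ =>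
    (hΦd q).hasFDerivWithinAt
  have key : ∀ q ∈ B, |(columnsCLM (p (q 0)) e).det| • indicator Ω f (Φ q)
      = indicator Ω (fun _ => (1 : ℝ)) (Φ q) * (c₁ * fderiv ℝ F (P (q 0) (q 1)) (p (q 0))
        + ⟪p (q 0), w⟫ * fderiv ℝ F (P (q 0) (q 1)) e) := by
    intro q hq
    rw [he, det_columnsCLM_perp, abs_of_pos (hpos _ hq.1.le)]
    by_cases hm : Φ q ∈ Ω
    · rw [indicator_of_mem hm, indicator_of_mem hm, one_mul, hf]
      simp only
      rw [smul_eq_mul, ← smul_eq_mul, ← map_smul, inner_smul_perp, map_add, map_smul, map_smul]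
      simp [hΦ, collarMap, hP, hc₁, he]
    · rw [indicator_of_notMem hm, indicator_of_notMem hm]; simp
  set K : R2 → ℝ := fun q => |(columnsCLM (p (q 0)) e).det| • indicator Ω f (Φ q) with hK
  have hKint : IntegrableOn K B :=
    (integrableOn_image_iff_integrableOn_abs_det_fderiv_smul volume hBm hΦw hBinj _).1
      (hfint.indicator hΩ.measurableSet).integrableOn
  have step1 : ∫ y in Ω, f y = ∫ x in Ioo (θ₀ - r) (θ₀ + r), ∫ y in Ioo (-τ) τ, K !₂[x, y] := by
    rw [← integral_indicator hΩ.measurableSet,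
      ← setIntegral_eq_integral_of_forall_compl_eq_zero (s := Φ '' B),
      integral_image_eq_integral_abs_det_fderiv_smul volume hBm hΦw hBinj]
    · change ∫ q in B, K q = _
      rw [hBset] at hKint ⊢
      exact setIntegral_R2_prod _ _ _ hKint
    · intro y hy
      by_cases hm : y ∈ Ω
      · rw [indicator_of_mem hm, hf]; simp [hDF0 y hy]
      · rw [indicator_of_notMem hm]
  -- the inner integral
  have hK₁ : ∀ x y, |x - θ₀| < r → y ∈ Ioo 0 τ → K !₂[x, y] =
      s₁ * (c₁ * fderiv ℝ F (P x y) (p x) + ⟪p x, w⟫ * fderiv ℝ F (P x y) e) := by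
    intro x y hx hy
    have hq : !₂[x, y] ∈ B := ⟨by simpa using hx, by simpa [abs_of_pos hy.1] using hy.2⟩
    have := key _ hq
    rw [hside₁ !₂[x, y] (by simpa using hx) (by simpa using hy) fun _ => (1 : ℝ)] at this
    simpa [hK] using this
  have hK₂ : ∀ x y, |x - θ₀| < r → y ∈ Ioo (-τ) 0 → K !₂[x, y] =
      s₂ * (c₁ * fderiv ℝ F (P x y) (p x) + ⟪p x, w⟫ * fderiv ℝ F (P x y) e) := by
    intro x y hx hy
    have hq : !₂[x, y] ∈ B :=
      ⟨by simpa using hx, by simpa [abs_of_neg hy.2] using neg_lt.1 hy.1⟩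
    have := key _ hq
    rw [hside₂ !₂[x, y] (by simpa using hx) (by simpa using hy) fun _ => (1 : ℝ)] at this
    simpa [hK] using this
  have hcx : ∀ x, Continuous fun y => fderiv ℝ F (P x y) (p x) := fun x =>
    hcθ.comp (Continuous.prodMk_right x)
  have hcy : ∀ x, Continuous fun y => fderiv ℝ F (P x y) e := fun x =>
    hcτ.comp (Continuous.prodMk_right x)
  have half : ∀ (x a b c : ℝ), a ≤ b → |x - θ₀| < r →
      (∀ y ∈ Ioo a b, K !₂[x, y] =
        c * (c₁ * fderiv ℝ F (P x y) (p x) + ⟪p x, w⟫ * fderiv ℝ F (P x y) e)) →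
      IntervalIntegrable (fun y => K !₂[x, y]) volume a b ∧
      ∫ y in a..b, K !₂[x, y] = c * (c₁ * ∫ y in a..b, fderiv ℝ F (P x y) (p x)) +
        c * ⟪p x, w⟫ * (F (P x b) - F (P x a)) := by
    intro x a b c hab hx hKe
    have hco : Continuous fun y =>
        c * (c₁ * fderiv ℝ F (P x y) (p x) + ⟪p x, w⟫ * fderiv ℝ F (P x y) e) := by
      have := hcx x; have := hcy x; fun_prop
    have hae : (fun y => c * (c₁ * fderiv ℝ F (P x y) (p x) + ⟪p x, w⟫ * fderiv ℝ F (P x y) e))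
        =ᵐ[volume.restrict (uIoc a b)] fun y => K !₂[x, y] := by
      rw [uIoc_of_le hab, ← restrict_Ioo_eq_restrict_Ioc]
      exact (ae_restrict_iff' measurableSet_Ioo).2
        (Eventually.of_forall fun y hy => (hKe y hy).symm)
    refine ⟨(hco.intervalIntegrable a b).congr_ae hae, ?_⟩
    rw [← intervalIntegral.integral_congr_ae_restrict hae, intervalIntegral.integral_const_mul,
      intervalIntegral.integral_add (((hcx x).intervalIntegrable a b).const_mul _)
        (((hcy x).intervalIntegrable a b).const_mul _),
      intervalIntegral.integral_const_mul, intervalIntegral.integral_const_mul,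
      intervalIntegral.integral_eq_sub_of_hasDerivAt (fun y _ => hGτ x y)
        ((hcy x).intervalIntegrable a b)]
    ring
  have inner_eq : ∀ x ∈ Ioo (θ₀ - r) (θ₀ + r), ∫ y in Ioo (-τ) τ, K !₂[x, y] =
      s₂ * c₁ * (∫ y in (-τ)..0, fderiv ℝ F (P x y) (p x)) +
      s₁ * c₁ * (∫ y in (0)..τ, fderiv ℝ F (P x y) (p x)) - (s₁ - s₂) * (⟪p x, w⟫ * F (γ x)) := by
    intro x hx
    have hx' : |x - θ₀| < r := by rw [abs_lt]; constructor <;> linarith [hx.1, hx.2]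
    obtain ⟨i1, e1⟩ := half x 0 τ s₁ hτ.le hx' fun y hy => hK₁ x y hx' hy
    obtain ⟨i2, e2⟩ := half x (-τ) 0 s₂ (by linarith) hx' fun y hy => hK₂ x y hx' hy
    rw [← integral_Ioc_eq_integral_Ioo, ← intervalIntegral.integral_of_le (by linarith),
      ← intervalIntegral.integral_add_adjacent_intervals i2 i1, e1, e2,
      hF0 (P x τ) (hnotB x τ hx'.le (by simp [abs_of_pos hτ])),
      hF0 (P x (-τ)) (hnotB x (-τ) hx'.le (by simp [abs_of_pos hτ]))]
    have : P x 0 = γ x := by simp [hP]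
    rw [this]; ring
  -- integration along the curve
  have hzero : ∀ a b : ℝ, ∫ x in (θ₀ - r)..(θ₀ + r), ∫ y in a..b, fderiv ℝ F (P x y) (p x) = 0 := by
    intro a b
    rw [intervalIntegral_swap_of_continuous hcθ]
    have : ∀ y, ∫ x in (θ₀ - r)..(θ₀ + r), fderiv ℝ F (P x y) (p x) = 0 := by
      intro y
      rw [intervalIntegral.integral_eq_sub_of_hasDerivAt (fun x _ => hGθ x y)
        ((hcθ.comp (Continuous.prodMk_left y)).intervalIntegrable _ _),
        hF0 _ (hnotB _ y (by simp [abs_of_pos hr]) (by simp [abs_of_pos hr])),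
        hF0 _ (hnotB _ y (by simp [abs_of_pos hr]) (by simp [abs_of_pos hr])), sub_zero]
    simp [this]
  have hbc : Continuous fun x => ⟪p x, w⟫ * F (γ x) :=
    (h.cont_deriv.inner continuous_const).mul (hF.continuous.comp h.cont)
  have hic : ∀ a b : ℝ, Continuous fun x => ∫ y in a..b, fderiv ℝ F (P x y) (p x) := fun a b =>
    intervalIntegral.continuous_parametric_intervalIntegral_of_continuous' hcθ a b
  rw [step1, setIntegral_congr_fun measurableSet_Ioo inner_eq, ← integral_Ioc_eq_integral_Ioo,
    ← intervalIntegral.integral_of_le (by linarith), intervalIntegral.integral_sub,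
    intervalIntegral.integral_add, intervalIntegral.integral_const_mul,
    intervalIntegral.integral_const_mul, hzero, hzero, intervalIntegral.integral_const_mul]
  rotate_left
  · exact ((hic _ _).const_mul _ |>.intervalIntegrable _ _)
  · exact ((hic _ _).const_mul _ |>.intervalIntegrable _ _)
  · exact (((hic _ _).const_mul _).add ((hic _ _).const_mul _)).intervalIntegrable _ _
  · exact (hbc.const_mul _).intervalIntegrable _ _
  -- identification of the boundary integral
  have hper : Periodic (fun x => ⟪p x, w⟫ * F (γ x)) (2 * π) := fun x => by
    simp only [h.per x, h.per_deriv x]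
  have hb0 : ∀ x, x ∈ Ioo (θ₀ - π) (θ₀ + π) → x ∉ Ioo (θ₀ - r) (θ₀ + r) → F (γ x) = 0 := by
    intro x hx hxr
    apply hF0
    rintro ⟨q, hq, hqe⟩
    have hq1 := hrange q hq.1.le hq.2.le ⟨x, hqe.symm⟩
    have : γ (q 0) = γ x := by rw [← hqe]; simp [hΦ, collarMap, hq1]
    have hqa := abs_lt.1 hq.1
    have hqx := h.eq_of_abs_sub_lt this (by
      rw [abs_lt]; constructor <;> linarith [hx.1, hx.2, hqa.1, hqa.2, Real.pi_pos])
    exact hxr ⟨by linarith, by linarith⟩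
  have hsplit : ∫ x in (0)..(2 * π), ⟪p x, w⟫ * F (γ x) =
      ∫ x in (θ₀ - r)..(θ₀ + r), ⟪p x, w⟫ * F (γ x) := by
    have := hper.intervalIntegral_add_eq 0 (θ₀ - π)
    rw [zero_add, show θ₀ - π + 2 * π = θ₀ + π by ring] at this
    rw [this, intervalIntegral.integral_of_le (by linarith [Real.pi_pos]),
      intervalIntegral.integral_of_le (by linarith), integral_Ioc_eq_integral_Ioo,
      integral_Ioc_eq_integral_Ioo]
    refine setIntegral_eq_of_subset_of_forall_sdiff_eq_zero measurableSet_Ioo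
      (Ioo_subset_Ioo (by linarith [Real.pi_pos]) (by linarith [Real.pi_pos])) fun x hx => ?_
    rw [hb0 x hx.1 hx.2, mul_zero]
  rw [hsplit]
  ring

end IsC1Loop

/-- The divergence theorem on `Ω` with boundary `γ` of orientation `s`. -/
def GreenFormula (γ p : ℝ → R2) (Ω : Set R2) (s : ℝ) : Prop :=
  ∀ F : R2 → ℝ, ContDiff ℝ 1 F →
    ∀ w, ∫ y in Ω, fderiv ℝ F y (perp w) = -s * ∫ θ in (0)..(2 * π), ⟪p θ, w⟫ * F (γ θ)

lemma integral_fderiv_apply_eq_zero {F : R2 → ℝ} (hF : ContDiff ℝ 1 F) (hc : HasCompactSupport F)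
    (v : R2) : ∫ y, fderiv ℝ F y v = 0 := by
  have h := integral_mul_fderiv_eq_neg_fderiv_mul_of_integrable (μ := (volume : Measure R2))
    (f := fun _ : R2 => (1 : ℝ)) (g := F) (v := v) (by simp)
    (by simpa using integrable_fderiv_apply hF hc v)
    (by simpa using hF.continuous.integrable_of_hasCompactSupport hc)
    (fun y _ => differentiableAt_const _) (fun y _ => hF.differentiable one_ne_zero y)
  simpa using h

/-- The signed area enclosed by a loop. -/
def signedArea (γ p : ℝ → R2) : ℝ := -∫ θ in (0)..(2 * π), p θ 0 * γ θ 1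

lemma GreenFormula.signedArea_pos {γ p : ℝ → R2} {Ω : Set R2} {s : ℝ} (hΩ : IsOpen Ω)
    (hb : IsBounded Ω) (hne : Ω.Nonempty) (hG : GreenFormula γ p Ω s) : 0 < s * signedArea γ p := by
  have := hG (fun y => y 1) (by fun_prop) (EuclideanSpace.single 0 1)
  have hfd : ∀ y : R2, fderiv ℝ (fun y : R2 => y 1) y =
      (EuclideanSpace.proj (1 : Fin 2) : R2 →L[ℝ] ℝ) := fun y =>
    (EuclideanSpace.proj (1 : Fin 2) : R2 →L[ℝ] ℝ).fderiv
  simp only [hfd] at this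
  simp [inner_R2] at this
  have hvol : 0 < volume.real Ω :=
    ENNReal.toReal_pos (hΩ.measure_pos volume hne).ne' hb.measure_lt_top.ne
  rw [this] at hvol
  rw [signedArea]
  linarith

namespace IsC1Loop

variable {γ p : ℝ → R2}

lemma greenNear_unique (h : IsC1Loop γ p) {Ω : Set R2} {s s' θ₀ : ℝ}
    (hs : GreenNear γ p Ω s (γ θ₀)) (hs' : GreenNear γ p Ω s' (γ θ₀)) : s = s' := by
  obtain ⟨N, hN, H⟩ := hs
  obtain ⟨N', hN', H'⟩ := hs'
  have hpos : ∀ᶠ θ in 𝓝 θ₀, 0 < ⟪p θ, p θ₀⟫ :=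
    (h.cont_deriv.inner continuous_const).continuousAt.eventually
      (lt_mem_nhds (real_inner_self_pos.2 (h.ne_zero θ₀)))
  obtain ⟨r, hr, hrpos⟩ := Metric.eventually_nhds_iff.1 hpos
  obtain ⟨ρ, hρ, hnear⟩ := h.exists_near θ₀ hr
  obtain ⟨ε, hε, hεN⟩ := Metric.mem_nhds_iff.1
    (inter_mem (inter_mem hN hN') (Metric.ball_mem_nhds (γ θ₀) hρ))
  let f : ContDiffBump (γ θ₀) := ⟨ε / 4, ε / 2, by positivity, by linarith⟩
  have hft : tsupport f ⊆ (N ∩ N') ∩ Metric.ball (γ θ₀) ρ := by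
    rw [f.tsupport_eq]
    exact (Metric.closedBall_subset_ball (by simp only [f]; linarith)).trans hεN
  have h1 := H f f.contDiff f.hasCompactSupport (fun x hx => (hft hx).1.1) (p θ₀)
  have h2 := H' f f.contDiff f.hasCompactSupport (fun x hx => (hft hx).1.2) (p θ₀)
  have hper : Periodic (fun x => ⟪p x, p θ₀⟫ * f (γ x)) (2 * π) := fun x => by
    simp only [h.per x, h.per_deriv x]
  have hI : 0 < ∫ θ in (0)..(2 * π), ⟪p θ, p θ₀⟫ * f (γ θ) := by
    have he := hper.intervalIntegral_add_eq 0 θ₀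
    rw [zero_add] at he
    rw [he]
    refine intervalIntegral.integral_pos (by linarith [Real.pi_pos])
      ((h.cont_deriv.inner continuous_const).mul (f.continuous.comp h.cont)).continuousOn
      (fun x _ => ?_) ⟨θ₀, ⟨le_rfl, by linarith [Real.pi_pos]⟩, ?_⟩
    · by_cases hx : f (γ x) = 0
      · simp [hx]
      · have hm := (hft (subset_tsupport _ hx)).2
        obtain ⟨k, hk⟩ := hnear x hm
        have hq := hrpos (y := x + k * (2 * π)) (by rwa [Real.dist_eq])
        rw [h.per_deriv.int_mul k x] at hq
        exact mul_nonneg hq.le f.nonneg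
    · refine mul_pos (real_inner_self_pos.2 (h.ne_zero θ₀)) ?_
      exact f.pos_of_mem_ball (Metric.mem_ball_self f.rOut_pos)
  have := mul_right_cancel₀ hI.ne' (h1.symm.trans h2)
  linarith

lemma exists_greenNear_forall (h : IsC1Loop γ p) {Ω : Set R2} (hΩ : IsOpen Ω)
    (hfr : frontier Ω = range γ) :
    ∃ s : ℝ, (s = 1 ∨ s = -1 ∨ s = 0) ∧ ∀ z, GreenNear γ p Ω s z := by
  choose s hs hG using h.exists_greenNear hΩ hfr
  have hconst : IsLocallyConstant s := by
    refine (IsLocallyConstant.iff_exists_open s).2 fun θ => ?_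
    obtain ⟨N, hN, H⟩ := hG θ
    refine ⟨γ ⁻¹' interior N, isOpen_interior.preimage h.cont,
      mem_interior_iff_mem_nhds.2 hN, fun θ' hθ' => ?_⟩
    exact h.greenNear_unique (hG θ') ⟨N, mem_interior_iff_mem_nhds.1 hθ', H⟩
  have hcon : ∀ θ, s θ = s 0 := fun θ =>
    hconst.apply_eq_of_isPreconnected isPreconnected_univ (mem_univ _) (mem_univ _)
  refine ⟨s 0, hs 0, fun z => ?_⟩
  by_cases hz : z ∈ Ω
  · refine ⟨Ω, hΩ.mem_nhds hz, fun F hF hFc hsupp w => ?_⟩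
    have h0 : ∀ θ, F (γ θ) = 0 := fun θ => image_eq_zero_of_notMem_tsupport fun hc => by
      have : γ θ ∈ frontier Ω := hfr ▸ mem_range_self θ
      rw [hΩ.frontier_eq] at this
      exact this.2 (hsupp hc)
    simp only [h0, mul_zero, intervalIntegral.integral_zero]
    rw [setIntegral_eq_integral_of_forall_compl_eq_zero]
    · exact integral_fderiv_apply_eq_zero hF hFc _
    · intro y hy
      rw [image_eq_zero_of_notMem_tsupport fun hc => hy (hsupp (tsupport_fderiv_subset ℝ hc))]
      rfl
  by_cases hz' : z ∈ closure Ω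
  · have : z ∈ frontier Ω := by rw [hΩ.frontier_eq]; exact ⟨hz', hz⟩
    rw [hfr] at this
    obtain ⟨θ, rfl⟩ := this
    exact hcon θ ▸ hG θ
  · refine ⟨(closure Ω)ᶜ, isClosed_closure.isOpen_compl.mem_nhds hz', fun F hF hFc hsupp w => ?_⟩
    have h0 : ∀ θ, F (γ θ) = 0 := fun θ => image_eq_zero_of_notMem_tsupport fun hc => by
      have : γ θ ∈ frontier Ω := hfr ▸ mem_range_self θ
      exact hsupp hc (frontier_subset_closure this)
    simp only [h0, mul_zero, intervalIntegral.integral_zero]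
    refine setIntegral_eq_zero_of_forall_eq_zero fun y hy => ?_
    rw [image_eq_zero_of_notMem_tsupport fun hc =>
      hsupp (tsupport_fderiv_subset ℝ hc) (subset_closure hy)]
    rfl

lemma green_of_greenNear (h : IsC1Loop γ p) {Ω : Set R2} {s : ℝ}
    (hG : ∀ z, GreenNear γ p Ω s z) {F : R2 → ℝ} (hF : ContDiff ℝ 1 F)
    (hFc : HasCompactSupport F) (w : R2) :
    ∫ y in Ω, fderiv ℝ F y (perp w) = -s * ∫ θ in (0)..(2 * π), ⟪p θ, w⟫ * F (γ θ) := by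
  choose N hN H using hG
  obtain ⟨t, ht⟩ := hFc.elim_nhds_subcover' (fun z _ => interior (N z))
    fun z _ => interior_mem_nhds.2 (hN z)
  obtain ⟨f, hf⟩ := SmoothPartitionOfUnity.exists_isSubordinate (modelWithCornersSelf ℝ R2)
    (isClosed_tsupport F) (fun i : t => interior (N i.1)) (fun i => isOpen_interior) (by
      intro x hx
      obtain ⟨i, hi, hxi⟩ := mem_iUnion₂.1 (ht hx)
      exact mem_iUnion.2 ⟨⟨i, hi⟩, hxi⟩)
  have hfc : ∀ i, ContDiff ℝ 1 (f i) := fun i =>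
    (contMDiff_iff_contDiff.1 (f i).contMDiff).of_le (by simp)
  have hsum : F = fun y => ∑ i, f i y * F y := by
    ext y
    by_cases hy : y ∈ tsupport F
    · have := f.sum_eq_one hy
      rw [finsum_eq_sum_of_fintype] at this
      rw [← Finset.sum_mul, this, one_mul]
    · simp [image_eq_zero_of_notMem_tsupport hy]
  have hgc : ∀ i, ContDiff ℝ 1 fun y => f i y * F y := fun i => (hfc i).mul hF
  have hgs : ∀ i, HasCompactSupport fun y => f i y * F y := fun i => hFc.mul_left
  have hgt : ∀ i, tsupport (fun y => f i y * F y) ⊆ N i.1 := fun i =>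
    (tsupport_mul_subset_left).trans ((hf i).trans interior_subset)
  have hd : ∀ y, fderiv ℝ F y (perp w) = ∑ i, fderiv ℝ (fun y => f i y * F y) y (perp w) := by
    intro y
    conv_lhs => rw [hsum]
    rw [fderiv_fun_sum fun i _ => (hgc i).differentiable one_ne_zero y]
    simp
  simp_rw [hd]
  rw [integral_finsetSum _ fun i _ => (integrable_fderiv_apply (hgc i) (hgs i) _).integrableOn]
  simp_rw [fun i => H i.1 _ (hgc i) (hgs i) (hgt i) w]
  rw [← Finset.mul_sum, ← intervalIntegral.integral_finsetSum]
  · congr 2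
    ext θ
    conv_rhs => rw [hsum]
    rw [Finset.mul_sum]
  · intro i _
    exact ((h.cont_deriv.inner continuous_const).mul
      ((hgc i).continuous.comp h.cont)).intervalIntegrable _ _

/-- Green's formula for a bounded open set bounded by a `C¹` loop. -/
theorem exists_greenFormula (h : IsC1Loop γ p) {Ω : Set R2} (hΩ : IsOpen Ω) (hb : IsBounded Ω)
    (hne : Ω.Nonempty) (hfr : frontier Ω = range γ) :
    ∃ s : ℝ, (s = 1 ∨ s = -1) ∧ GreenFormula γ p Ω s := by
  obtain ⟨s, hs, hG⟩ := h.exists_greenNear_forall hΩ hfr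
  have key : GreenFormula γ p Ω s := by
    intro F hF w
    obtain ⟨R, hR⟩ := hb.closure.subset_ball_lt 0 (0 : R2)
    obtain ⟨hR0, hR⟩ := hR
    let χ : ContDiffBump (0 : R2) := ⟨R, R + 1, hR0, by linarith⟩
    have hχ : ∀ y ∈ closure Ω, (fun y => χ y * F y) =ᶠ[𝓝 y] F := by
      intro y hy
      filter_upwards [Metric.isOpen_ball.mem_nhds (hR hy)] with z hz
      rw [χ.one_of_mem_closedBall (Metric.ball_subset_closedBall hz), one_mul]
    have hg := h.green_of_greenNear hG (F := fun y => χ y * F y) (χ.contDiff.mul hF)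
      χ.hasCompactSupport.mul_right w
    have hcl : ∀ θ, γ θ ∈ closure Ω := fun θ =>
      frontier_subset_closure (hfr ▸ mem_range_self θ)
    rw [setIntegral_congr_fun (g := fun y => fderiv ℝ F y (perp w)) hΩ.measurableSet
      fun y hy => by simp only [(hχ y (subset_closure hy)).fderiv_eq]] at hg
    rw [hg]
    congr 2
    ext θ
    rw [(hχ _ (hcl θ)).eq_of_nhds]
  refine ⟨s, ?_, key⟩
  rcases hs with hs | hs | hs
  · exact Or.inl hs
  · exact Or.inr hs
  exfalso
  have := key.signedArea_pos hΩ hb hne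
  simp [hs] at this

end IsC1Loop

/-- The regularized power `(‖z‖² + ε²)^(-s)`. -/
def regPow (s ε : ℝ) (z : R2) : ℝ := (‖z‖ ^ 2 + ε ^ 2) ^ (-s)

lemma regPow_nonneg (s ε : ℝ) (z : R2) : 0 ≤ regPow s ε z := by unfold regPow; positivity

lemma regPow_neg (s ε : ℝ) (z : R2) : regPow s ε (-z) = regPow s ε z := by simp [regPow]

lemma regPow_zero_eq (s : ℝ) (z : R2) : regPow s 0 z = (‖z‖ ^ (2 * s))⁻¹ := by
  rw [regPow, Real.rpow_neg (by positivity), ← Real.rpow_natCast, Real.rpow_mul (norm_nonneg z)]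
  simp

lemma regPow_le {s ε : ℝ} (hs : 0 ≤ s) {z : R2} {r : ℝ} (hr : 0 < r) (hz : r ≤ ‖z‖) :
    regPow s ε z ≤ r ^ (-(2 * s)) := by
  have h1 : r ^ (-(2 * s)) = (r ^ 2) ^ (-s) := by
    rw [← Real.rpow_natCast, ← Real.rpow_mul hr.le]; congr 1; push_cast; ring
  rw [h1, regPow]
  exact Real.rpow_le_rpow_of_nonpos (by positivity) (by nlinarith [sq_nonneg ε]) (by linarith)

lemma hasFDerivAt_regPow (s : ℝ) {ε : ℝ} {z : R2} (h : ε ≠ 0 ∨ z ≠ 0) :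
    HasFDerivAt (regPow s ε) ((-(2 * s) * regPow (s + 1) ε z) • innerSL ℝ z) z := by
  have h1 : HasFDerivAt (fun z : R2 => ‖z‖ ^ 2 + ε ^ 2) (2 • (innerSL ℝ z)) z :=
    (hasStrictFDerivAt_norm_sq z).hasFDerivAt.add_const _
  have hne : ‖z‖ ^ 2 + ε ^ 2 ≠ 0 := by
    rcases h with h | h
    · positivity
    · have := norm_pos_iff.2 h; positivity
  have h2 := h1.rpow_const (p := -s) (Or.inl hne)
  have h3 : (-(2 * s) * regPow (s + 1) ε z) • innerSL ℝ z =
      (-s * (‖z‖ ^ 2 + ε ^ 2) ^ (-s - 1)) • 2 • innerSL ℝ z := by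
    rw [show regPow (s + 1) ε z = (‖z‖ ^ 2 + ε ^ 2) ^ (-s - 1) by unfold regPow; congr 1; ring]
    ext v
    simp
    ring
  rw [h3]
  exact h2

lemma continuousAt_regPow (s : ℝ) {ε : ℝ} {z : R2} (h : ε ≠ 0 ∨ z ≠ 0) :
    ContinuousAt (regPow s ε) z := (hasFDerivAt_regPow s h).continuousAt

lemma continuous_regPow (s : ℝ) {ε : ℝ} (h : ε ≠ 0) : Continuous (regPow s ε) :=
  continuous_iff_continuousAt.2 fun _ => continuousAt_regPow s (Or.inl h)

lemma contDiff_regPow (s : ℝ) {ε : ℝ} (h : ε ≠ 0) : ContDiff ℝ 1 (regPow s ε) := by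
  unfold regPow
  refine ContDiff.rpow_const_of_ne ?_ fun z => by positivity
  exact (contDiff_norm_sq ℝ).add contDiff_const

lemma tendsto_regPow_zero (s : ℝ) {z : R2} (hz : z ≠ 0) :
    Tendsto (fun ε => regPow s ε z) (𝓝[>] 0) (𝓝 (regPow s 0 z)) := by
  have hc : ContinuousAt (fun ε : ℝ => regPow s ε z) 0 := by
    unfold regPow
    have := norm_pos_iff.2 hz
    exact ContinuousAt.rpow_const (by fun_prop) (Or.inl (by positivity))
  exact hc.tendsto.mono_left nhdsWithin_le_nhds

@[simp] lemma norm_perp (v : R2) : ‖perp v‖ = ‖v‖ := by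
  simp [EuclideanSpace.norm_eq, Fin.sum_univ_two, add_comm]

lemma continuous_perp : Continuous perp := by
  unfold perp
  simp only [WithLp.equiv_symm_apply]
  refine (PiLp.continuous_toLp 2 _).comp (continuous_pi fun i => ?_)
  fin_cases i
  · simp only [Fin.zero_eta, Matrix.cons_val_zero]; fun_prop
  · simp only [Fin.mk_one, Matrix.cons_val_one]; fun_prop

lemma integrableOn_norm_sub_rpow {Ω : Set R2} (hb : IsBounded Ω) (x : R2) {s : ℝ} (hs : -2 < s) :
    IntegrableOn (fun y => ‖x - y‖ ^ s) Ω := by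
  obtain ⟨R, hR⟩ := hb.subset_ball_lt 0 x
  obtain ⟨hR0, hR⟩ := hR
  refine IntegrableOn.mono_set ?_ hR
  have h1 : IntegrableOn (fun y : R2 => ‖y‖ ^ s) (Metric.ball 0 R) := by
    rw [integrableOn_fun_norm_addHaar volume (f := fun r => r ^ s)]
    have : IntegrableOn (fun y : ℝ => y ^ (s + 1)) (Ioo 0 R) := by
      rw [intervalIntegral.integrableOn_Ioo_rpow_iff hR0]; linarith
    refine this.congr_fun (fun y hy => ?_) measurableSet_Ioo
    simp only [finrank_euclideanSpace, Fintype.card_fin, smul_eq_mul]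
    rw [Real.rpow_add hy.1]; simp [mul_comm]
  have hmp : MeasurePreserving (fun y : R2 => x - y) volume volume :=
    Measure.measurePreserving_sub_left volume x
  have he : MeasurableEmbedding (fun y : R2 => x - y) := (Homeomorph.subLeft x).measurableEmbedding
  have := (hmp.integrableOn_comp_preimage he).2 h1
  have hpre : (fun y : R2 => x - y) ⁻¹' Metric.ball 0 R = Metric.ball x R := by
    ext y
    simp only [Metric.mem_ball, mem_preimage, dist_eq_norm, sub_zero, norm_sub_rev]
  rwa [hpre] at this

/-- The velocity with kernel regularized at scale `ε`. -/
def regVelocity (α ε : ℝ) (Ω : Set R2) (x : R2) : R2 :=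
  ∫ y in Ω, regPow (1 + α) ε (x - y) • perp (x - y)

lemma sqgVelocity_eq (α : ℝ) (Ω : Set R2) (x : R2) :
    sqgVelocity α Ω x = regVelocity α 0 Ω x := by
  unfold sqgVelocity regVelocity
  simp only [regPow_zero_eq, mul_add, mul_one]

lemma tendsto_regVelocity {α : ℝ} (hα : 0 < α) (hα' : α < 1 / 2) {Ω : Set R2}
    (hb : IsBounded Ω) (x : R2) :
    Tendsto (fun ε => regVelocity α ε Ω x) (𝓝[>] 0) (𝓝 (sqgVelocity α Ω x)) := by
  rw [sqgVelocity_eq]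
  have hne : ∀ᵐ y ∂(volume.restrict Ω), y ≠ x := by
    have : ∀ᵐ y ∂(volume : Measure R2), y ≠ x := by simp [ae_iff]
    exact ae_restrict_of_ae this
  refine tendsto_integral_filter_of_dominated_convergence (fun y => ‖x - y‖ ^ (-(1 + 2 * α))) ?_ ?_
    (integrableOn_norm_sub_rpow hb x (by linarith)) ?_
  · filter_upwards [self_mem_nhdsWithin] with ε hε
    have hc : Continuous fun y => regPow (1 + α) ε (x - y) • perp (x - y) :=
      ((continuous_regPow _ (ne_of_gt hε)).comp (continuous_const.sub continuous_id)).smul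
        (continuous_perp.comp (continuous_const.sub continuous_id))
    exact hc.aestronglyMeasurable
  · refine Eventually.of_forall fun ε => ?_
    filter_upwards [hne] with y hy
    have hpos : 0 < ‖x - y‖ := norm_pos_iff.2 (sub_ne_zero.2 hy.symm)
    rw [norm_smul, norm_perp, Real.norm_of_nonneg (regPow_nonneg _ _ _)]
    calc _ ≤ ‖x - y‖ ^ (-(2 * (1 + α))) * ‖x - y‖ :=
          mul_le_mul_of_nonneg_right (regPow_le (by linarith) hpos le_rfl) hpos.le
      _ = _ := by
        rw [← Real.rpow_add_one hpos.ne']; congr 1; ring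
  · filter_upwards [hne] with y hy
    exact (tendsto_regPow_zero _ (sub_ne_zero.2 hy.symm)).smul_const _

/-- The regularized velocity as a single layer over the boundary. -/
lemma regVelocity_eq {α : ℝ} (hα : 0 < α) {γ p : ℝ → R2} (h : IsC1Loop γ p) {Ω : Set R2}
    (hb : IsBounded Ω) {σ : ℝ} (hG : GreenFormula γ p Ω σ) {ε : ℝ} (hε : 0 < ε) (x : R2) :
    regVelocity α ε Ω x =
      (σ / (2 * α)) • ∫ θ in (0)..(2 * π), regPow α ε (γ θ - x) • p θ := by
  refine ext_inner_left ℝ fun w => ?_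
  have hcv : Continuous fun y => regPow (1 + α) ε (x - y) • perp (x - y) :=
    ((continuous_regPow _ hε.ne').comp (continuous_const.sub continuous_id)).smul
      (continuous_perp.comp (continuous_const.sub continuous_id))
  have hiv : IntegrableOn (fun y => regPow (1 + α) ε (x - y) • perp (x - y)) Ω :=
    (hcv.continuousOn.integrableOn_compact hb.isCompact_closure).mono_set subset_closure
  have hcp : Continuous fun θ => regPow α ε (γ θ - x) • p θ :=
    ((continuous_regPow _ hε.ne').comp (h.cont.sub continuous_const)).smul h.cont_deriv
  have h1 := hG (fun y => regPow α ε (y - x))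
    ((contDiff_regPow α hε.ne').comp (contDiff_id.sub contDiff_const)) w
  have hfd : ∀ y, fderiv ℝ (fun y => regPow α ε (y - x)) y (perp w) =
      -(2 * α) * ⟪w, regPow (1 + α) ε (x - y) • perp (x - y)⟫ := by
    intro y
    have := (hasFDerivAt_regPow α (z := y - x) (Or.inl hε.ne')).comp y
      ((hasFDerivAt_id y).sub_const x)
    have e := this.fderiv
    simp only [comp_def, id] at e
    rw [e, ← neg_sub y x, regPow_neg, add_comm α 1]
    simp [inner_R2]
    ring
  simp only [hfd] at h1
  rw [integral_const_mul, integral_inner hiv] at h1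
  have h2 : ∫ θ in (0)..(2 * π), ⟪p θ, w⟫ * regPow α ε (γ θ - x) =
      ⟪w, ∫ θ in (0)..(2 * π), regPow α ε (γ θ - x) • p θ⟫ := by
    rw [← innerSL_apply_apply ℝ, ← ContinuousLinearMap.intervalIntegral_comp_comm _
      (hcp.intervalIntegrable _ _)]
    congr 1
    ext θ
    rw [innerSL_apply_apply, real_inner_smul_right, real_inner_comm]; ring
  rw [h2] at h1
  rw [real_inner_smul_right, regVelocity]
  field_simp
  linarith

/-- A `C¹` loop with quantitative Hölder and arc-chord bounds. -/
structure IsHolderLoop (β M c : ℝ) (γ p : ℝ → R2) : Prop extends IsC1Loop γ p where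
  c_pos : 0 < c
  bound : ∀ θ, ‖p θ‖ ≤ M
  holder : ∀ x y, ‖p x - p y‖ ≤ M * |x - y| ^ β
  chord_ge : ∀ ξ η, |η| ≤ π → c * |η| ≤ ‖γ (ξ + η) - γ ξ‖

/-- The chord from `γ ξ` to `γ (ξ + η)`. -/
def chord (γ : ℝ → R2) (ξ η : ℝ) : R2 := γ (ξ + η) - γ ξ

/-- The integrand of the single layer potential. -/
def layerKer (α ε : ℝ) (γ p : ℝ → R2) (ξ η : ℝ) : R2 :=
  regPow α ε (chord γ ξ η) • p (ξ + η)

/-- The single layer potential whose multiple is the velocity on the curve. -/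
def layer (α ε : ℝ) (γ p : ℝ → R2) (ξ : ℝ) : R2 := ∫ η in (-π)..π, layerKer α ε γ p ξ η

/-- The integrand of the strain. -/
def strainKer (α ε : ℝ) (γ p : ℝ → R2) (ξ η : ℝ) : R2 :=
  regPow (1 + α) ε (chord γ ξ η) •
    (⟪chord γ ξ η, p ξ⟫ • p (ξ + η) - ⟪chord γ ξ η, p (ξ + η)⟫ • p ξ)

/-- The derivative of the velocity along the curve, up to orientation. -/
def strain (α ε : ℝ) (γ p : ℝ → R2) (ξ : ℝ) : R2 := ∫ η in (-π)..π, strainKer α ε γ p ξ η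

lemma intervalIntegrable_abs_rpow {s : ℝ} (hs : -1 < s) :
    IntervalIntegrable (fun η : ℝ => |η| ^ s) volume (-π) π := by
  rw [intervalIntegrable_iff_integrableOn_Ioo_of_le (by linarith [Real.pi_pos])]
  have h := (integrableOn_fun_norm_addHaar (E := ℝ) volume (f := fun r => r ^ s) (r := π)).2 (by
    simpa using (intervalIntegral.integrableOn_Ioo_rpow_iff Real.pi_pos).2 hs)
  simpa [Real.ball_eq_Ioo] using h

lemma Function.Periodic.intervalIntegral_comp_add {E : Type*} [NormedAddCommGroup E]
    [NormedSpace ℝ E] {f : ℝ → E} (hf : Periodic f (2 * π)) (ξ : ℝ) :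
    ∫ η in (-π)..π, f (ξ + η) = ∫ θ in (0)..(2 * π), f θ := by
  have := hf.intervalIntegral_add_eq 0 (ξ - π)
  rw [zero_add] at this
  rw [intervalIntegral.integral_comp_add_left, this]
  congr 1; ring

namespace IsC1Loop

variable {γ p : ℝ → R2} {α ε : ℝ}

lemma layer_eq (h : IsC1Loop γ p) (ξ : ℝ) :
    layer α ε γ p ξ = ∫ θ in (0)..(2 * π), regPow α ε (γ θ - γ ξ) • p θ := by
  have hper : Periodic (fun θ => regPow α ε (γ θ - γ ξ) • p θ) (2 * π) := fun x => by
    simp only [h.per x, h.per_deriv x]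
  exact hper.intervalIntegral_comp_add ξ

lemma regVelocity_eq_layer (hα : 0 < α) (h : IsC1Loop γ p) {Ω : Set R2}
    (hb : IsBounded Ω) {σ : ℝ} (hG : GreenFormula γ p Ω σ) (hε : 0 < ε) (ξ : ℝ) :
    regVelocity α ε Ω (γ ξ) = (σ / (2 * α)) • layer α ε γ p ξ := by
  rw [regVelocity_eq hα h hb hG hε, h.layer_eq]

lemma hasDerivAt_regPow_chord (h : IsC1Loop γ p) (s : ℝ) (hε : 0 < ε) (z : R2) (θ : ℝ) :
    HasDerivAt (fun θ => regPow s ε (γ θ - z))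
      (-(2 * s) * (regPow (1 + s) ε (γ θ - z) * ⟪γ θ - z, p θ⟫)) θ := by
  have := (hasFDerivAt_regPow s (z := γ θ - z) (Or.inl hε.ne')).comp_hasDerivAt θ
    ((h.hasDeriv θ).sub_const z)
  rw [add_comm s 1] at this
  rwa [smul_apply, innerSL_apply_apply, smul_eq_mul, mul_assoc] at this

lemma integral_regPow_chord (h : IsC1Loop γ p) (hα : 0 < α) (hε : 0 < ε) (ξ : ℝ) :
    ∫ η in (-π)..π, regPow (1 + α) ε (chord γ ξ η) * ⟪chord γ ξ η, p (ξ + η)⟫ = 0 := by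
  have hper : Periodic (fun θ => regPow (1 + α) ε (γ θ - γ ξ) * ⟪γ θ - γ ξ, p θ⟫) (2 * π) :=
    fun x => by simp only [h.per x, h.per_deriv x]
  have h1 := hper.intervalIntegral_comp_add ξ
  simp only [chord]
  rw [h1]
  have hc : Continuous fun θ => regPow (1 + α) ε (γ θ - γ ξ) * ⟪γ θ - γ ξ, p θ⟫ :=
    ((continuous_regPow _ hε.ne').comp (h.cont.sub continuous_const)).mul
      ((h.cont.sub continuous_const).inner h.cont_deriv)
  have h2 := intervalIntegral.integral_eq_sub_of_hasDerivAt (a := 0) (b := 2 * π)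
    (fun θ _ => h.hasDerivAt_regPow_chord α hε (γ ξ) θ)
    ((hc.const_mul _).intervalIntegrable _ _)
  rw [intervalIntegral.integral_const_mul, ← h.per 0, zero_add, sub_self] at h2
  simpa [hα.ne'] using h2

lemma continuous_chord (h : IsC1Loop γ p) : Continuous (uncurry (chord γ)) :=
  (h.cont.comp (continuous_fst.add continuous_snd)).sub (h.cont.comp continuous_fst)

lemma continuous_layerKer (h : IsC1Loop γ p) (hε : 0 < ε) :
    Continuous (uncurry (layerKer α ε γ p)) :=
  ((continuous_regPow _ hε.ne').comp h.continuous_chord).smul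
    (h.cont_deriv.comp (continuous_fst.add continuous_snd))

lemma continuous_strainKer (h : IsC1Loop γ p) (hε : 0 < ε) :
    Continuous (uncurry (strainKer α ε γ p)) := by
  have h1 : Continuous fun q : ℝ × ℝ => chord γ q.1 q.2 := h.continuous_chord
  have h2 : Continuous fun q : ℝ × ℝ => p q.1 := h.cont_deriv.comp continuous_fst
  have h3 : Continuous fun q : ℝ × ℝ => p (q.1 + q.2) :=
    h.cont_deriv.comp (continuous_fst.add continuous_snd)
  have h4 : Continuous fun q : ℝ × ℝ => regPow (1 + α) ε (chord γ q.1 q.2) :=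
    (continuous_regPow _ hε.ne').comp h1
  have h5 : Continuous fun q : ℝ × ℝ => ⟪chord γ q.1 q.2, p q.1⟫ • p (q.1 + q.2) :=
    (h1.inner (𝕜 := ℝ) h2).smul h3
  have h6 : Continuous fun q : ℝ × ℝ => ⟪chord γ q.1 q.2, p (q.1 + q.2)⟫ • p q.1 :=
    (h1.inner (𝕜 := ℝ) h3).smul h2
  exact h4.smul (h5.sub h6)

lemma continuous_layer (h : IsC1Loop γ p) (hε : 0 < ε) : Continuous (layer α ε γ p) :=
  intervalIntegral.continuous_parametric_intervalIntegral_of_continuous'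
    (h.continuous_layerKer hε) _ _

lemma continuous_strain (h : IsC1Loop γ p) (hε : 0 < ε) : Continuous (strain α ε γ p) :=
  intervalIntegral.continuous_parametric_intervalIntegral_of_continuous'
    (h.continuous_strainKer hε) _ _

lemma strain_eq (h : IsC1Loop γ p) (hα : 0 < α) (hε : 0 < ε) (ξ : ℝ) :
    strain α ε γ p ξ =
      ∫ θ in (0)..(2 * π), (regPow (1 + α) ε (γ θ - γ ξ) * ⟪γ θ - γ ξ, p ξ⟫) • p θ := by
  have hper : Periodic (fun θ => (regPow (1 + α) ε (γ θ - γ ξ) * ⟪γ θ - γ ξ, p ξ⟫) • p θ)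
    (2 * π) := fun x => by simp only [h.per x, h.per_deriv x]
  rw [← hper.intervalIntegral_comp_add ξ]
  have hk : Continuous fun η => regPow (1 + α) ε (chord γ ξ η) :=
    (continuous_regPow _ hε.ne').comp (h.continuous_chord.comp (Continuous.prodMk_right ξ))
  have hc : Continuous fun η => chord γ ξ η := h.continuous_chord.comp (Continuous.prodMk_right ξ)
  have hp : Continuous fun η => p (ξ + η) := h.cont_deriv.comp (continuous_const.add continuous_id)
  have e : ∀ η, strainKer α ε γ p ξ η =
      (regPow (1 + α) ε (chord γ ξ η) * ⟪chord γ ξ η, p ξ⟫) • p (ξ + η) -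
      (regPow (1 + α) ε (chord γ ξ η) * ⟪chord γ ξ η, p (ξ + η)⟫) • p ξ := fun η => by
    rw [strainKer, smul_sub, smul_smul, smul_smul]
  simp only [strain, e]
  have h1 : Continuous fun η =>
      (regPow (1 + α) ε (chord γ ξ η) * ⟪chord γ ξ η, p ξ⟫) • p (ξ + η) :=
    (hk.mul (hc.inner continuous_const)).smul hp
  have h2 : Continuous fun η =>
      (regPow (1 + α) ε (chord γ ξ η) * ⟪chord γ ξ η, p (ξ + η)⟫) • p ξ :=
    (hk.mul (hc.inner hp)).smul continuous_const
  rw [intervalIntegral.integral_sub (h1.intervalIntegrable _ _) (h2.intervalIntegrable _ _),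
    intervalIntegral.integral_smul_const, h.integral_regPow_chord hα hε, zero_smul, sub_zero]
  rfl

lemma layer_sub_layer (h : IsC1Loop γ p) (hα : 0 < α) (hε : 0 < ε) (x y : ℝ) :
    layer α ε γ p y - layer α ε γ p x = (2 * α) • ∫ ξ in x..y, strain α ε γ p ξ := by
  have hcθ : ∀ ξ, Continuous fun θ => regPow α ε (γ θ - γ ξ) • p θ := fun ξ =>
    ((continuous_regPow _ hε.ne').comp (h.cont.sub continuous_const)).smul h.cont_deriv
  have hc2 : Continuous (uncurry fun ξ θ : ℝ =>
      (regPow (1 + α) ε (γ θ - γ ξ) * ⟪γ θ - γ ξ, p ξ⟫) • p θ) := by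
    have h1 : Continuous fun q : ℝ × ℝ => γ q.2 - γ q.1 :=
      (h.cont.comp continuous_snd).sub (h.cont.comp continuous_fst)
    exact (((continuous_regPow _ hε.ne').comp h1).mul
      (h1.inner (h.cont_deriv.comp continuous_fst))).smul (h.cont_deriv.comp continuous_snd)
  simp_rw [h.layer_eq, h.strain_eq hα hε]
  rw [← intervalIntegral.integral_sub ((hcθ y).intervalIntegrable _ _)
    ((hcθ x).intervalIntegrable _ _), intervalIntegral_swap_of_continuous hc2,
    ← intervalIntegral.integral_smul]
  congr 1
  ext1 θ
  have hd : ∀ ξ, HasDerivAt (fun ξ => regPow α ε (γ θ - γ ξ))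
      (2 * α * (regPow (1 + α) ε (γ θ - γ ξ) * ⟪γ θ - γ ξ, p ξ⟫)) ξ := by
    intro ξ
    have := h.hasDerivAt_regPow_chord α hε (γ θ) ξ
    simp only [← neg_sub (γ θ), regPow_neg, inner_neg_left] at this
    convert this using 1
    ring
  have hcξ : Continuous fun ξ => regPow (1 + α) ε (γ θ - γ ξ) * ⟪γ θ - γ ξ, p ξ⟫ :=
    ((continuous_regPow _ hε.ne').comp (continuous_const.sub h.cont)).mul
      ((continuous_const.sub h.cont).inner h.cont_deriv)
  rw [intervalIntegral.integral_smul_const, ← sub_smul, smul_smul,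
    ← intervalIntegral.integral_const_mul,
    intervalIntegral.integral_eq_sub_of_hasDerivAt (fun ξ _ => hd ξ)
      ((hcξ.const_mul _).intervalIntegrable _ _)]

end IsC1Loop

lemma measurable_regPow (s ε : ℝ) : Measurable (regPow s ε) := by
  unfold regPow
  fun_prop

lemma ae_ne_zero_imp {a b : ℝ} {q : ℝ → Prop} (h : ∀ η, η ≠ 0 → η ∈ uIoc a b → q η) :
    ∀ᵐ η : ℝ, η ∈ uIoc a b → q η := by
  have : ∀ᵐ η : ℝ, η ≠ 0 := by simp [ae_iff]
  filter_upwards [this] with η hη using h η hη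

lemma abs_le_pi_of_mem {η : ℝ} (h : η ∈ uIoc (-π) π) : |η| ≤ π := by
  rw [uIoc_of_le (by linarith [Real.pi_pos])] at h
  exact abs_le.2 ⟨h.1.le, h.2⟩

/-- The integral of `|η|^s` over a period. -/
def absMoment (s : ℝ) : ℝ := ∫ η in (-π)..π, |η| ^ s

lemma absMoment_nonneg (s : ℝ) : 0 ≤ absMoment s :=
  intervalIntegral.integral_nonneg (by linarith [Real.pi_pos]) fun _ _ => by positivity

lemma norm_integral_le_absMoment {E : Type*} [NormedAddCommGroup E] [NormedSpace ℝ E]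
    {f : ℝ → E} {C s : ℝ} (hs : -1 < s)
    (hf : ∀ η, η ≠ 0 → |η| ≤ π → ‖f η‖ ≤ C * |η| ^ s) :
    ‖∫ η in (-π)..π, f η‖ ≤ C * absMoment s := by
  rw [absMoment, ← intervalIntegral.integral_const_mul]
  refine intervalIntegral.norm_integral_le_of_norm_le (by linarith [Real.pi_pos]) ?_
    ((intervalIntegrable_abs_rpow hs).const_mul C)
  have := ae_ne_zero_imp (a := -π) (b := π) fun η h0 hη => hf η h0 (abs_le_pi_of_mem hη)
  rwa [uIoc_of_le (by linarith [Real.pi_pos])] at this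

namespace IsHolderLoop

variable {α β M c ε : ℝ} {γ p : ℝ → R2}

lemma M_nonneg (h : IsHolderLoop β M c γ p) : 0 ≤ M := (norm_nonneg _).trans (h.bound 0)

lemma norm_chord_le (h : IsHolderLoop β M c γ p) (ξ η : ℝ) : ‖chord γ ξ η‖ ≤ M * |η| := by
  have := convex_univ.norm_image_sub_le_of_norm_hasDerivWithin_le
    (f := γ) (f' := p) (C := M) (x := ξ) (y := ξ + η)
    (fun x _ => (h.hasDeriv x).hasDerivWithinAt) (fun x _ => h.bound x) (mem_univ _) (mem_univ _)
  simpa [chord] using this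

lemma le_norm_chord (h : IsHolderLoop β M c γ p) (ξ : ℝ) {η : ℝ} (hη : |η| ≤ π) :
    c * |η| ≤ ‖chord γ ξ η‖ := h.chord_ge ξ η hη

lemma chord_ne_zero (h : IsHolderLoop β M c γ p) (ξ : ℝ) {η : ℝ} (h0 : η ≠ 0) (hη : |η| ≤ π) :
    chord γ ξ η ≠ 0 := by
  have := h.le_norm_chord ξ hη
  have h1 := mul_pos h.c_pos (abs_pos.2 h0)
  exact norm_pos_iff.1 (h1.trans_le this)

lemma norm_chord_sub_le (h : IsHolderLoop β M c γ p) (hβ : 0 < β) (ξ η : ℝ) :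
    ‖chord γ ξ η - η • p ξ‖ ≤ M * |η| ^ β * |η| := by
  have := (convex_uIcc ξ (ξ + η)).norm_image_sub_le_of_norm_hasDerivWithin_le
    (f := fun x => γ x - (x - ξ) • p ξ) (f' := fun x => p x - p ξ) (C := M * |η| ^ β)
    (x := ξ) (y := ξ + η)
    (fun x _ => by
      have h1 := (((hasDerivAt_id x).sub_const ξ).smul_const (p ξ))
      simp only [id, one_smul] at h1
      exact ((h.hasDeriv x).sub h1).hasDerivWithinAt)
    (fun x hx => by
      refine (h.holder x ξ).trans ?_
      have h1 : |x - ξ| ≤ |η| := by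
        have := abs_sub_left_of_mem_uIcc hx
        simpa using this
      have := h.M_nonneg
      gcongr) left_mem_uIcc right_mem_uIcc
  simpa [chord, sub_right_comm] using this

lemma c_le_norm (h : IsHolderLoop β M c γ p) (hβ : 0 < β) (θ : ℝ) : c ≤ ‖p θ‖ := by
  have h1 : Tendsto (fun η : ℝ => M * |η| ^ β + ‖p θ‖) (𝓝[>] 0) (𝓝 ‖p θ‖) := by
    have hc : Continuous fun η : ℝ => M * |η| ^ β + ‖p θ‖ :=
      ((continuous_abs.rpow_const fun _ => Or.inr hβ.le).const_mul M).add continuous_const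
    have := (hc.tendsto 0).mono_left (nhdsWithin_le_nhds (s := Ioi 0))
    simpa [hβ.ne'] using this
  refine ge_of_tendsto h1 ?_
  filter_upwards [Ioo_mem_nhdsGT Real.pi_pos] with η hη
  have hη' : |η| = η := abs_of_pos hη.1
  have h2 := h.le_norm_chord θ (η := η) (by rw [hη']; exact hη.2.le)
  have h3 := h.norm_chord_sub_le hβ θ η
  have h4 : ‖chord γ θ η‖ ≤ ‖chord γ θ η - η • p θ‖ + ‖η • p θ‖ := by
    simpa using norm_add_le (chord γ θ η - η • p θ) (η • p θ)
  rw [norm_smul, Real.norm_eq_abs] at h4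
  have : c * |η| ≤ (M * |η| ^ β + ‖p θ‖) * |η| := by linarith
  exact le_of_mul_le_mul_right this (by rw [hη']; exact hη.1)

lemma regPow_chord_le (h : IsHolderLoop β M c γ p) {s : ℝ} (hs : 0 ≤ s) (ξ : ℝ) {η : ℝ}
    (h0 : η ≠ 0) (hη : |η| ≤ π) :
    regPow s ε (chord γ ξ η) ≤ c ^ (-(2 * s)) * |η| ^ (-(2 * s)) := by
  rw [← Real.mul_rpow h.c_pos.le (abs_nonneg η)]
  exact regPow_le hs (mul_pos h.c_pos (abs_pos.2 h0)) (h.le_norm_chord ξ hη)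

lemma norm_layerKer_le (h : IsHolderLoop β M c γ p) (hα : 0 < α) (ξ η : ℝ) (h0 : η ≠ 0)
    (hη : |η| ≤ π) :
    ‖layerKer α ε γ p ξ η‖ ≤ c ^ (-(2 * α)) * M * |η| ^ (-(2 * α)) := by
  have h1 := h.regPow_chord_le (ε := ε) hα.le ξ h0 hη
  have := h.M_nonneg
  have := h.c_pos
  rw [layerKer, norm_smul, Real.norm_of_nonneg (regPow_nonneg _ _ _)]
  calc _ ≤ (c ^ (-(2 * α)) * |η| ^ (-(2 * α))) * M :=
        mul_le_mul h1 (h.bound _) (norm_nonneg _) (by positivity)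
    _ = _ := by ring

lemma norm_strainKer_le (h : IsHolderLoop β M c γ p) (hα : 0 < α) (ξ η : ℝ) (h0 : η ≠ 0)
    (hη : |η| ≤ π) :
    ‖strainKer α ε γ p ξ η‖ ≤ 2 * c ^ (-(2 * (1 + α))) * M ^ 3 * |η| ^ (β - 1 - 2 * α) := by
  have h1 := h.regPow_chord_le (ε := ε) (s := 1 + α) (by linarith) ξ h0 hη
  have hM := h.M_nonneg
  have hc := h.c_pos
  have hη0 : 0 < |η| := abs_pos.2 h0
  have hch := h.norm_chord_le ξ η
  have hho : ‖p (ξ + η) - p ξ‖ ≤ M * |η| ^ β := by simpa using h.holder (ξ + η) ξ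
  have h2 : ‖⟪chord γ ξ η, p ξ⟫ • p (ξ + η) - ⟪chord γ ξ η, p (ξ + η)⟫ • p ξ‖ ≤
      2 * (M * |η|) * M * (M * |η| ^ β) := by
    have e : ⟪chord γ ξ η, p ξ⟫ • p (ξ + η) - ⟪chord γ ξ η, p (ξ + η)⟫ • p ξ =
        ⟪chord γ ξ η, p ξ⟫ • (p (ξ + η) - p ξ) - ⟪chord γ ξ η, p (ξ + η) - p ξ⟫ • p ξ := by
      rw [inner_sub_right, sub_smul, smul_sub]; abel
    rw [e]
    refine (norm_sub_le _ _).trans ?_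
    rw [norm_smul, norm_smul]
    have i1 := norm_inner_le_norm (𝕜 := ℝ) (chord γ ξ η) (p ξ)
    have i2 := norm_inner_le_norm (𝕜 := ℝ) (chord γ ξ η) (p (ξ + η) - p ξ)
    calc _ ≤ (M * |η| * M) * (M * |η| ^ β) + (M * |η| * (M * |η| ^ β)) * M := by
          gcongr
          · exact i1.trans (by gcongr; exact h.bound _)
          · exact i2.trans (by gcongr)
          · exact h.bound _
      _ = _ := by ring
  rw [strainKer, norm_smul, Real.norm_of_nonneg (regPow_nonneg _ _ _)]
  have e : |η| ^ (β - 1 - 2 * α) = |η| ^ (-(2 * (1 + α))) * |η| * |η| ^ β := by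
    rw [← Real.rpow_add_one hη0.ne', ← Real.rpow_add hη0]; congr 1; ring
  calc _ ≤ (c ^ (-(2 * (1 + α))) * |η| ^ (-(2 * (1 + α)))) * (2 * (M * |η|) * M * (M * |η| ^ β)) :=
        mul_le_mul h1 h2 (norm_nonneg _) (by positivity)
    _ = _ := by rw [e]; ring

lemma norm_layer_le (h : IsHolderLoop β M c γ p) (hα : 0 < α) (hα' : α < 1 / 2) (ξ : ℝ) :
    ‖layer α ε γ p ξ‖ ≤ c ^ (-(2 * α)) * M * absMoment (-(2 * α)) :=
  norm_integral_le_absMoment (by linarith) (h.norm_layerKer_le hα ξ)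

lemma norm_strain_le (h : IsHolderLoop β M c γ p) (hα : 0 < α) (hβ : 2 * α < β) (ξ : ℝ) :
    ‖strain α ε γ p ξ‖ ≤ 2 * c ^ (-(2 * (1 + α))) * M ^ 3 * absMoment (β - 1 - 2 * α) :=
  norm_integral_le_absMoment (by linarith) (h.norm_strainKer_le hα ξ)

lemma tendsto_strain (h : IsHolderLoop β M c γ p) (hα : 0 < α) (hβ : 2 * α < β) (ξ : ℝ) :
    Tendsto (fun ε => strain α ε γ p ξ) (𝓝[>] 0) (𝓝 (strain α 0 γ p ξ)) := by
  refine intervalIntegral.tendsto_integral_filter_of_dominated_convergence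
    (fun η => 2 * c ^ (-(2 * (1 + α))) * M ^ 3 * |η| ^ (β - 1 - 2 * α)) ?_ ?_
    ((intervalIntegrable_abs_rpow (by linarith)).const_mul _) ?_
  · filter_upwards [self_mem_nhdsWithin] with ε hε
    exact ((h.continuous_strainKer hε).comp (Continuous.prodMk_right ξ)).aestronglyMeasurable
  · exact Eventually.of_forall fun ε => ae_ne_zero_imp fun η h0 hη =>
      h.norm_strainKer_le hα ξ η h0 (abs_le_pi_of_mem hη)
  · exact ae_ne_zero_imp fun η h0 hη =>
      (tendsto_regPow_zero _ (h.chord_ne_zero ξ h0 (abs_le_pi_of_mem hη))).smul_const _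

lemma sqgVelocity_sub (h : IsHolderLoop β M c γ p) (hα : 0 < α) (hα' : α < 1 / 2)
    (hβ : 2 * α < β) {Ω : Set R2} (hb : IsBounded Ω) {σ : ℝ} (hG : GreenFormula γ p Ω σ)
    (x y : ℝ) :
    sqgVelocity α Ω (γ y) - sqgVelocity α Ω (γ x) = σ • ∫ ξ in x..y, strain α 0 γ p ξ := by
  have h1 := (tendsto_regVelocity hα hα' hb (γ y)).sub (tendsto_regVelocity hα hα' hb (γ x))
  have h2 : Tendsto (fun ε => ∫ ξ in x..y, strain α ε γ p ξ) (𝓝[>] 0)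
      (𝓝 (∫ ξ in x..y, strain α 0 γ p ξ)) := by
    refine intervalIntegral.tendsto_integral_filter_of_dominated_convergence
      (fun _ => 2 * c ^ (-(2 * (1 + α))) * M ^ 3 * absMoment (β - 1 - 2 * α)) ?_ ?_
      intervalIntegrable_const ?_
    · filter_upwards [self_mem_nhdsWithin] with ε hε
      exact (h.continuous_strain hε).aestronglyMeasurable
    · exact Eventually.of_forall fun ε => Eventually.of_forall fun ξ _ => h.norm_strain_le hα hβ ξ
    · exact Eventually.of_forall fun ξ _ => h.tendsto_strain hα hβ ξ
  refine tendsto_nhds_unique h1 ((h2.const_smul σ).congr' ?_)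
  filter_upwards [self_mem_nhdsWithin] with ε hε
  rw [h.regVelocity_eq_layer hα hb hG hε, h.regVelocity_eq_layer hα hb hG hε, ← smul_sub,
    h.layer_sub_layer hα hε, smul_smul]
  congr 1
  field_simp

lemma norm_sqgVelocity_le (h : IsHolderLoop β M c γ p) (hα : 0 < α) (hα' : α < 1 / 2)
    {Ω : Set R2} (hb : IsBounded Ω) {σ : ℝ} (hσ : |σ| ≤ 1) (hG : GreenFormula γ p Ω σ) (ξ : ℝ) :
    ‖sqgVelocity α Ω (γ ξ)‖ ≤
      1 / (2 * α) * (c ^ (-(2 * α)) * M * absMoment (-(2 * α))) := by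
  refine le_of_tendsto (tendsto_regVelocity hα hα' hb (γ ξ)).norm ?_
  filter_upwards [self_mem_nhdsWithin] with ε hε
  rw [h.regVelocity_eq_layer hα hb hG hε, norm_smul, Real.norm_eq_abs, abs_div,
    abs_of_pos (show 0 < 2 * α by linarith)]
  gcongr
  exact h.norm_layer_le hα hα' ξ

end IsHolderLoop

lemma continuous_strain_family {α β M c : ℝ} (hα : 0 < α) (hβ : 2 * α < β) {Γ P : ℝ → ℝ → R2}
    (hΓ : Continuous (uncurry Γ)) (hP : Continuous (uncurry P))
    (h : ∀ t, IsHolderLoop β M c (Γ t) (P t)) :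
    Continuous fun q : ℝ × ℝ => strain α 0 (Γ q.1) (P q.1) q.2 := by
  refine intervalIntegral.continuous_of_dominated_interval
    (bound := fun η => 2 * c ^ (-(2 * (1 + α))) * M ^ 3 * |η| ^ (β - 1 - 2 * α)) ?_ ?_
    ((intervalIntegrable_abs_rpow (by linarith)).const_mul _) ?_
  · intro q
    have hch : Continuous fun η => chord (Γ q.1) q.2 η :=
      (h q.1).continuous_chord.comp (Continuous.prodMk_right q.2)
    have hp : Continuous fun η => P q.1 (q.2 + η) :=
      (h q.1).cont_deriv.comp (continuous_const.add continuous_id)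
    have h1 : Continuous fun η => ⟪chord (Γ q.1) q.2 η, P q.1 q.2⟫ • P q.1 (q.2 + η) -
        ⟪chord (Γ q.1) q.2 η, P q.1 (q.2 + η)⟫ • P q.1 q.2 := by
      exact ((hch.inner (𝕜 := ℝ) continuous_const).smul hp).sub
        ((hch.inner (𝕜 := ℝ) hp).smul continuous_const)
    exact (((measurable_regPow (1 + α) 0).comp hch.measurable).aemeasurable.smul
      h1.measurable.aemeasurable).aestronglyMeasurable
  · exact fun q => ae_ne_zero_imp fun η h0 hη =>
      (h q.1).norm_strainKer_le hα q.2 η h0 (abs_le_pi_of_mem hη)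
  · refine ae_ne_zero_imp fun η h0 hη => ?_
    have hp : Continuous fun q : ℝ × ℝ => P q.1 q.2 := hP
    have hp' : Continuous fun q : ℝ × ℝ => P q.1 (q.2 + η) :=
      hP.comp (continuous_fst.prodMk (continuous_snd.add continuous_const))
    have hch : Continuous fun q : ℝ × ℝ => chord (Γ q.1) q.2 η :=
      (hΓ.comp (continuous_fst.prodMk (continuous_snd.add continuous_const))).sub hΓ
    have hk : Continuous fun q : ℝ × ℝ => regPow (1 + α) 0 (chord (Γ q.1) q.2 η) :=
      continuous_iff_continuousAt.2 fun q =>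
        ContinuousAt.comp (f := fun q : ℝ × ℝ => chord (Γ q.1) q.2 η) (x := q)
          (continuousAt_regPow (1 + α) (Or.inr
            ((h q.1).chord_ne_zero q.2 h0 (abs_le_pi_of_mem hη)))) hch.continuousAt
    have h1 : Continuous fun q : ℝ × ℝ => ⟪chord (Γ q.1) q.2 η, P q.1 q.2⟫ • P q.1 (q.2 + η) :=
      (hch.inner (𝕜 := ℝ) hp).smul hp'
    have h2 : Continuous fun q : ℝ × ℝ => ⟪chord (Γ q.1) q.2 η, P q.1 (q.2 + η)⟫ • P q.1 q.2 :=
      (hch.inner (𝕜 := ℝ) hp').smul hp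
    exact hk.smul (h1.sub h2)

lemma regPow_smul (s ε : ℝ) {η : ℝ} (hη : η ≠ 0) (z : R2) :
    regPow s ε (η • z) = |η| ^ (-(2 * s)) * regPow s (ε / η) z := by
  have h1 : ‖η • z‖ ^ 2 + ε ^ 2 = |η| ^ 2 * (‖z‖ ^ 2 + (ε / η) ^ 2) := by
    rw [norm_smul, Real.norm_eq_abs, mul_pow, sq_abs]
    field_simp
  rw [regPow, regPow, h1, Real.mul_rpow (by positivity) (by positivity),
    ← Real.rpow_natCast |η| 2, ← Real.rpow_mul (abs_nonneg η)]
  congr 2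
  push_cast
  ring

lemma abs_regPow_sub_le {s c : ℝ} (hs : 0 ≤ s) (hc : 0 < c) (ε : ℝ) {z w : R2} (hz : c ≤ ‖z‖)
    (hw : c ≤ ‖w‖) :
    |regPow s ε z - regPow s ε w| ≤ 2 * s * c ^ (-(2 * s) - 1) * ‖z - w‖ := by
  have hd : ∀ u ∈ Ici c, HasDerivWithinAt (fun u : ℝ => (u ^ 2 + ε ^ 2) ^ (-s))
      ((2 * u) * (-s) * (u ^ 2 + ε ^ 2) ^ (-s - 1)) (Ici c) u := fun u hu => by
    have hu0 : 0 < u := hc.trans_le hu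
    have h1 : HasDerivAt (fun u : ℝ => u ^ 2 + ε ^ 2) (2 * u) u := by
      simpa using (hasDerivAt_pow 2 u).add_const (ε ^ 2)
    exact (h1.rpow_const (Or.inl (by positivity))).hasDerivWithinAt
  have hb : ∀ u ∈ Ici c, ‖(2 * u) * (-s) * (u ^ 2 + ε ^ 2) ^ (-s - 1)‖ ≤
      2 * s * c ^ (-(2 * s) - 1) := fun u hu => by
    have hu0 : 0 < u := hc.trans_le hu
    have h1 : (u ^ 2 + ε ^ 2) ^ (-s - 1) ≤ (u ^ 2) ^ (-s - 1) :=
      Real.rpow_le_rpow_of_nonpos (by positivity) (by nlinarith [sq_nonneg ε]) (by linarith)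
    have h2 : (u ^ 2) ^ (-s - 1) * u = u ^ (-(2 * s) - 1) := by
      rw [← Real.rpow_natCast u 2, ← Real.rpow_mul hu0.le, ← Real.rpow_add_one hu0.ne']
      congr 1; push_cast; ring
    have h3 : u ^ (-(2 * s) - 1) ≤ c ^ (-(2 * s) - 1) :=
      Real.rpow_le_rpow_of_nonpos hc hu (by linarith)
    have h4 : 0 ≤ (u ^ 2 + ε ^ 2) ^ (-s - 1) := by positivity
    rw [norm_mul, Real.norm_of_nonneg h4, Real.norm_eq_abs, mul_neg, abs_neg,
      abs_of_nonneg (by positivity)]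
    calc 2 * u * s * (u ^ 2 + ε ^ 2) ^ (-s - 1) ≤ 2 * u * s * (u ^ 2) ^ (-s - 1) := by gcongr
      _ = 2 * s * ((u ^ 2) ^ (-s - 1) * u) := by ring
      _ ≤ _ := by rw [h2]; gcongr
  have := (convex_Ici c).norm_image_sub_le_of_norm_hasDerivWithin_le hd hb hw hz
  refine this.trans ?_
  have := abs_norm_sub_norm_le z w
  have h0 : 0 ≤ c ^ (-(2 * s) - 1) := by positivity
  rw [Real.norm_eq_abs]
  gcongr

/-- Families of pairs of vectors of size `O(m)` whose differences are `O(n)`. -/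
def RelClose {ι E : Type*} [NormedAddCommGroup E] (m n : ι → ℝ) (f g : ι → E) : Prop :=
  ∃ C, 0 ≤ C ∧ ∀ i, ‖f i‖ ≤ C * m i ∧ ‖g i‖ ≤ C * m i ∧ ‖f i - g i‖ ≤ C * n i

namespace RelClose

variable {ι E F G : Type*} [NormedAddCommGroup E] [NormedAddCommGroup F] [NormedAddCommGroup G]
  {m n m' n' m'' n'' : ι → ℝ} {f g f₂ g₂ : ι → E}

lemma add (h : RelClose m n f g) (h' : RelClose m n f₂ g₂) :
    RelClose m n (fun i => f i + f₂ i) (fun i => g i + g₂ i) := by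
  obtain ⟨C, hC, h⟩ := h
  obtain ⟨C', hC', h'⟩ := h'
  refine ⟨C + C', by positivity, fun i => ?_⟩
  obtain ⟨a1, a2, a3⟩ := h i
  obtain ⟨b1, b2, b3⟩ := h' i
  refine ⟨(norm_add_le _ _).trans (by linarith), (norm_add_le _ _).trans (by linarith), ?_⟩
  rw [add_sub_add_comm]
  exact (norm_add_le _ _).trans (by linarith)

lemma neg (h : RelClose m n f g) : RelClose m n (fun i => -f i) (fun i => -g i) := by
  obtain ⟨C, hC, h⟩ := h
  refine ⟨C, hC, fun i => ?_⟩
  rw [norm_neg, norm_neg, ← neg_sub', norm_neg]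
  exact h i

lemma sub (h : RelClose m n f g) (h' : RelClose m n f₂ g₂) :
    RelClose m n (fun i => f i - f₂ i) (fun i => g i - g₂ i) := by
  simpa only [sub_eq_add_neg] using h.add h'.neg

/-- A bound for the sizes improves the size part of `RelClose`. -/
lemma of_size {K : ℝ} (h : RelClose m n f g) (hm : ∀ i, 0 ≤ m' i) (hn : ∀ i, 0 ≤ n i)
    (hf : ∀ i, ‖f i‖ ≤ K * m' i) (hg : ∀ i, ‖g i‖ ≤ K * m' i) : RelClose m' n f g := by
  obtain ⟨C, hC, h⟩ := h
  refine ⟨C + |K|, by positivity, fun i => ?_⟩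
  have h1 : K * m' i ≤ (C + |K|) * m' i :=
    mul_le_mul_of_nonneg_right (by linarith [le_abs_self K]) (hm i)
  have h2 : C * n i ≤ (C + |K|) * n i :=
    mul_le_mul_of_nonneg_right (by linarith [abs_nonneg K]) (hn i)
  exact ⟨(hf i).trans h1, (hg i).trans h1, (h i).2.2.trans h2⟩

lemma bilin [NormedSpace ℝ E] [NormedSpace ℝ F] [NormedSpace ℝ G] (B : E →L[ℝ] F →L[ℝ] G)
    {f' g' : ι → F} (h : RelClose m n f g) (h' : RelClose m' n' f' g') {K : ℝ} (hK : 0 ≤ K)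
    (hmm : ∀ i, m i * m' i ≤ K * m'' i) (hmn : ∀ i, m i * n' i + n i * m' i ≤ K * n'' i) :
    RelClose m'' n'' (fun i => B (f i) (f' i)) (fun i => B (g i) (g' i)) := by
  obtain ⟨C, hC, h⟩ := h
  obtain ⟨C', hC', h'⟩ := h'
  have key : ∀ {a : E} {b : F} {A A' : ℝ}, ‖a‖ ≤ A → ‖b‖ ≤ A' → ‖B a b‖ ≤ ‖B‖ * (A * A') :=
    fun {a b A A'} h1 h2 => (B.le_opNorm₂ a b).trans (by
      rw [mul_assoc]
      have := (norm_nonneg a).trans h1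
      gcongr)
  have hK' : ∀ {y z : ℝ}, y ≤ K * z → ‖B‖ * (C * C') * y ≤ ‖B‖ * (C * C') * K * z :=
    fun {y z} hy => by
      rw [mul_assoc _ K]
      exact mul_le_mul_of_nonneg_left hy (by positivity)
  refine ⟨‖B‖ * (C * C') * K, by positivity, fun i => ?_⟩
  obtain ⟨a1, a2, a3⟩ := h i
  obtain ⟨b1, b2, b3⟩ := h' i
  refine ⟨(key a1 b1).trans (le_trans (le_of_eq (by ring)) (hK' (hmm i))),
    (key a2 b2).trans (le_trans (le_of_eq (by ring)) (hK' (hmm i))), ?_⟩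
  have e : B (f i) (f' i) - B (g i) (g' i) = B (f i) (f' i - g' i) + B (f i - g i) (g' i) := by
    rw [map_sub, map_sub, sub_apply]; abel
  rw [e]
  refine (norm_add_le _ _).trans ((add_le_add (key a1 b3) (key a3 b2)).trans
    (le_trans (le_of_eq ?_) (hK' (hmn i))))
  ring

end RelClose

/-- The data of two curves at a pair of points, with chords normalised by the parameter
distance. -/
structure PairData (A B c : ℝ) where
  (z₁ z₂ T₁ T₂ S₁ S₂ : R2) (g₁ g₂ h₁ h₂ ε b x : ℝ)
  b_nonneg : 0 ≤ b
  b_le : b ≤ B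
  x_nonneg : 0 ≤ x
  norm_T₁ : ‖T₁‖ = 1
  norm_T₂ : ‖T₂‖ = 1
  norm_S₁ : ‖S₁‖ = 1
  norm_S₂ : ‖S₂‖ = 1
  g₁_le : |g₁| ≤ A
  g₂_le : |g₂| ≤ A
  h₁_le : |h₁| ≤ A
  h₂_le : |h₂| ≤ A
  z₁_le : ‖z₁‖ ≤ A
  z₂_le : ‖z₂‖ ≤ A
  le_z₁ : c ≤ ‖z₁‖
  le_z₂ : c ≤ ‖z₂‖
  z₁_sub : ‖z₁ - g₁ • T₁‖ ≤ A * b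
  z₂_sub : ‖z₂ - g₂ • T₂‖ ≤ A * b
  S₁_sub : ‖S₁ - T₁‖ ≤ A * b
  S₂_sub : ‖S₂ - T₂‖ ≤ A * b
  h₂_sub : |h₂ - g₂| ≤ A * b
  z_close : ‖z₁ - z₂‖ ≤ x
  T_close : ‖T₁ - T₂‖ ≤ x
  S_close : ‖S₁ - S₂‖ ≤ x
  g_close : |g₁ - g₂| ≤ x
  h_close : |h₁ - h₂| ≤ x

/-- The component of `S` orthogonal to the unit vector `T`. -/
def orthPart (T S : R2) : R2 := S - ⟪S, T⟫ • T

lemma orthPart_eq {T S : R2} (hT : ‖T‖ = 1) (hS : ‖S‖ = 1) :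
    orthPart T S = (S - T) + (1 / 2 * ⟪S - T, S - T⟫) • T := by
  have h1 : ⟪S - T, S - T⟫ = 2 - 2 * ⟪S, T⟫ := by
    rw [real_inner_sub_sub_self, real_inner_self_eq_norm_sq, real_inner_self_eq_norm_sq, hT, hS]
    ring
  rw [orthPart, h1, show 1 / 2 * (2 - 2 * ⟪S, T⟫) = 1 - ⟪S, T⟫ by ring, sub_smul, one_smul]
  abel

namespace PairData

variable {A B c : ℝ} {E : Type*} [NormedAddCommGroup E]

abbrev Bdd (f g : PairData A B c → E) : Prop := RelClose (fun _ => 1) (fun P => P.x) f g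
abbrev Small (f g : PairData A B c → E) : Prop := RelClose (fun P => P.b) (fun P => P.x) f g
abbrev Small₂ (f g : PairData A B c → E) : Prop :=
  RelClose (fun P => P.b) (fun P => P.b * P.x) f g

section Mul

variable {F G : Type*} [NormedAddCommGroup F] [NormedAddCommGroup G]
  [NormedSpace ℝ E] [NormedSpace ℝ F] [NormedSpace ℝ G] {f g : PairData A B c → E}
  {f' g' : PairData A B c → F} (L : E →L[ℝ] F →L[ℝ] G)

lemma bdd_bdd (h : Bdd f g) (h' : Bdd f' g') :
    Bdd (fun i => L (f i) (f' i)) (fun i => L (g i) (g' i)) :=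
  h.bilin L h' (K := 2) (by norm_num) (fun P => by norm_num) (fun P => le_of_eq (by ring))

lemma bdd_small₂ (h : Bdd f g) (h' : Small₂ f' g') :
    Small₂ (fun i => L (f i) (f' i)) (fun i => L (g i) (g' i)) :=
  h.bilin L h' (K := 2) (by norm_num) (fun P => by nlinarith [P.b_nonneg])
    (fun P => le_of_eq (by ring))

lemma small_small (h : Small f g) (h' : Small f' g') (hB : 0 ≤ B) :
    Small₂ (fun i => L (f i) (f' i)) (fun i => L (g i) (g' i)) :=
  h.bilin L h' (K := 2 + B) (by positivity)
    (fun P => by nlinarith [P.b_nonneg, P.b_le]) (fun P => by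
      nlinarith [mul_nonneg (mul_nonneg P.b_nonneg P.x_nonneg) hB])

end Mul

variable (A B c)

lemma bdd_z : Bdd (fun P : PairData A B c => P.z₁) fun P => P.z₂ :=
  ⟨|A| + 1, by positivity, fun P => ⟨by linarith [P.z₁_le, le_abs_self A],
    by linarith [P.z₂_le, le_abs_self A], by nlinarith [P.z_close, P.x_nonneg, abs_nonneg A]⟩⟩

lemma bdd_g : Bdd (fun P : PairData A B c => P.g₁) fun P => P.g₂ :=
  ⟨|A| + 1, by positivity, fun P => ⟨by rw [norm_eq_abs]; linarith [P.g₁_le, le_abs_self A],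
    by rw [norm_eq_abs]; linarith [P.g₂_le, le_abs_self A],
    by rw [norm_eq_abs]; nlinarith [P.g_close, P.x_nonneg, abs_nonneg A]⟩⟩

lemma bdd_h : Bdd (fun P : PairData A B c => P.h₁) fun P => P.h₂ :=
  ⟨|A| + 1, by positivity, fun P => ⟨by rw [norm_eq_abs]; linarith [P.h₁_le, le_abs_self A],
    by rw [norm_eq_abs]; linarith [P.h₂_le, le_abs_self A],
    by rw [norm_eq_abs]; nlinarith [P.h_close, P.x_nonneg, abs_nonneg A]⟩⟩

lemma bdd_T : Bdd (fun P : PairData A B c => P.T₁) fun P => P.T₂ :=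
  ⟨1, by norm_num, fun P => ⟨by rw [P.norm_T₁]; norm_num, by rw [P.norm_T₂]; norm_num,
    by linarith [P.T_close]⟩⟩

lemma bdd_S : Bdd (fun P : PairData A B c => P.S₁) fun P => P.S₂ :=
  ⟨1, by norm_num, fun P => ⟨by rw [P.norm_S₁]; norm_num, by rw [P.norm_S₂]; norm_num,
    by linarith [P.S_close]⟩⟩

lemma bdd_regPow {s : ℝ} (hs : 0 ≤ s) (hc : 0 < c) :
    Bdd (fun P : PairData A B c => regPow s P.ε P.z₁) fun P => regPow s P.ε P.z₂ := by
  refine ⟨c ^ (-(2 * s)) + 2 * s * c ^ (-(2 * s) - 1), by positivity, fun P => ?_⟩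
  have p1 : 0 ≤ c ^ (-(2 * s)) := by positivity
  have p2 : 0 ≤ 2 * s * c ^ (-(2 * s) - 1) := by positivity
  rw [Real.norm_of_nonneg (regPow_nonneg _ _ _), Real.norm_of_nonneg (regPow_nonneg _ _ _),
    norm_eq_abs]
  have h1 := regPow_le (ε := P.ε) hs hc P.le_z₁
  have h2 := regPow_le (ε := P.ε) hs hc P.le_z₂
  have h3 := abs_regPow_sub_le hs hc P.ε P.le_z₁ P.le_z₂
  have h4 := mul_le_mul_of_nonneg_left P.z_close p2
  have h5 := P.x_nonneg
  exact ⟨by linarith, by linarith, by nlinarith⟩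

lemma small_sub : Small (fun P : PairData A B c => P.S₁ - P.T₁) fun P => P.S₂ - P.T₂ :=
  ((bdd_S A B c).sub (bdd_T A B c)).of_size (fun P => P.b_nonneg) (fun P => P.x_nonneg)
    (fun P => P.S₁_sub) (fun P => P.S₂_sub)

lemma small_z_sub :
    Small (fun P : PairData A B c => P.z₁ - P.g₁ • P.T₁) fun P => P.z₂ - P.g₂ • P.T₂ :=
  ((bdd_z A B c).sub (bdd_bdd (ContinuousLinearMap.lsmul ℝ ℝ) (bdd_g A B c)
    (bdd_T A B c))).of_size (fun P => P.b_nonneg) (fun P => P.x_nonneg)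
    (fun P => P.z₁_sub) (fun P => P.z₂_sub)

lemma small₂_half_sq (hB : 0 ≤ B) : Small₂
    (fun P : PairData A B c => (1 / 2 * ⟪P.S₁ - P.T₁, P.S₁ - P.T₁⟫) • P.T₁)
    fun P => (1 / 2 * ⟪P.S₂ - P.T₂, P.S₂ - P.T₂⟫) • P.T₂ := by
  have h1 := small_small (innerSL ℝ) (small_sub A B c) (small_sub A B c) hB
  have h2 := bdd_small₂ (ContinuousLinearMap.lsmul ℝ ℝ (E := ℝ)) (f := fun _ => 1 / 2)
    (g := fun _ => 1 / 2) ⟨1, by norm_num, fun P => ⟨by norm_num, by norm_num, by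
      simpa using P.x_nonneg⟩⟩ h1
  exact bdd_small₂ (ContinuousLinearMap.lsmul ℝ ℝ (E := R2)).flip (bdd_T A B c) h2

lemma small_orthPart (hB : 0 ≤ B) :
    Small (fun P : PairData A B c => orthPart P.T₁ P.S₁) fun P => orthPart P.T₂ P.S₂ := by
  simp only [orthPart_eq, norm_T₁, norm_S₁, norm_T₂, norm_S₂]
  refine (small_sub A B c).add ?_
  obtain ⟨C, hC, h⟩ := small₂_half_sq A B c hB
  refine ⟨C * (1 + B), by positivity, fun P => ?_⟩
  obtain ⟨h1, h2, h3⟩ := h P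
  have h4 : C * P.b ≤ C * (1 + B) * P.b := by
    nlinarith [mul_nonneg (mul_nonneg hC hB) P.b_nonneg]
  have h5 : C * (P.b * P.x) ≤ C * (1 + B) * P.x := by
    nlinarith [mul_le_mul_of_nonneg_right P.b_le (mul_nonneg hC P.x_nonneg),
      mul_nonneg hC P.x_nonneg]
  exact ⟨h1.trans h4, h2.trans h4, h3.trans h5⟩

/-- The normalised kernel of the stretching rate. -/
lemma small₂_stretch (hB : 0 ≤ B) {s : ℝ} (hs : 0 ≤ s) (hc : 0 < c) : Small₂
    (fun P : PairData A B c => P.g₁ * (P.h₁ * (regPow s P.ε P.z₁ *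
      ⟪P.z₁ - P.g₁ • P.T₁, orthPart P.T₁ P.S₁⟫)))
    fun P => P.g₂ * (P.h₂ * (regPow s P.ε P.z₂ *
      ⟪P.z₂ - P.g₂ • P.T₂, orthPart P.T₂ P.S₂⟫)) :=
  bdd_small₂ (ContinuousLinearMap.mul ℝ ℝ) (bdd_g A B c)
    (bdd_small₂ (ContinuousLinearMap.mul ℝ ℝ) (bdd_h A B c)
      (bdd_small₂ (ContinuousLinearMap.mul ℝ ℝ) (bdd_regPow A B c hs hc)
        (small_small (innerSL ℝ) (small_z_sub A B c) (small_orthPart A B c hB) hB)))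

/-- The normalised kernel of the single layer potential. -/
lemma bdd_layer {s : ℝ} (hs : 0 ≤ s) (hc : 0 < c) : Bdd
    (fun P : PairData A B c => regPow s P.ε P.z₁ • (P.h₁ • P.S₁))
    fun P => regPow s P.ε P.z₂ • (P.h₂ • P.S₂) :=
  bdd_bdd (ContinuousLinearMap.lsmul ℝ ℝ) (bdd_regPow A B c hs hc)
    (bdd_bdd (ContinuousLinearMap.lsmul ℝ ℝ) (bdd_h A B c) (bdd_S A B c))

/-- The normalised kernel of the tangent rotation, up to its symmetric leading part. -/
lemma exists_rotation_le (hB : 0 ≤ B) {s : ℝ} (hs : 0 ≤ s) (hc : 0 < c) :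
    ∃ C, 0 ≤ C ∧ ∀ P : PairData A B c,
      ‖(P.h₁ * (regPow s P.ε P.z₁ * ⟪P.z₁, P.T₁⟫)) • orthPart P.T₁ P.S₁ -
        (P.h₂ * (regPow s P.ε P.z₂ * ⟪P.z₂, P.T₂⟫)) • orthPart P.T₂ P.S₂ -
        (regPow s P.ε P.z₂ * (⟪P.z₂, P.g₂ • P.T₂ + P.h₂ • P.S₂⟫ / 2)) •
          ((P.S₁ - P.S₂) - (P.T₁ - P.T₂))‖ ≤ C * (P.b * P.x) := by
  have hK := bdd_bdd (ContinuousLinearMap.mul ℝ ℝ) (bdd_h A B c)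
    (bdd_bdd (ContinuousLinearMap.mul ℝ ℝ) (bdd_regPow A B c hs hc)
      (bdd_bdd (innerSL ℝ) (bdd_z A B c) (bdd_T A B c)))
  obtain ⟨C₁, hC₁, h₁⟩ :=
    bdd_small₂ (ContinuousLinearMap.lsmul ℝ ℝ (E := R2)) hK (small₂_half_sq A B c hB)
  obtain ⟨C₂, hC₂, h₂⟩ := hK
  obtain ⟨C₃, hC₃, h₃⟩ := bdd_regPow A B c hs hc
  refine ⟨C₁ + C₂ * |A| + C₃ * (|A| * (|A| + |A| * |A|)), by positivity, fun P => ?_⟩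
  set K₁ := P.h₁ * (regPow s P.ε P.z₁ * ⟪P.z₁, P.T₁⟫)
  set K₂ := P.h₂ * (regPow s P.ε P.z₂ * ⟪P.z₂, P.T₂⟫) with hK₂
  have h₁ : ‖K₁ • (1 / 2 * ⟪P.S₁ - P.T₁, P.S₁ - P.T₁⟫) • P.T₁ -
      K₂ • (1 / 2 * ⟪P.S₂ - P.T₂, P.S₂ - P.T₂⟫) • P.T₂‖ ≤ C₁ * (P.b * P.x) := (h₁ P).2.2
  have h₂ : ‖K₁ - K₂‖ ≤ C₂ * P.x := (h₂ P).2.2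
  have h₃ : ‖regPow s P.ε P.z₂‖ ≤ C₃ * 1 := (h₃ P).2.1
  have hA : 0 ≤ A := (abs_nonneg _).trans P.g₁_le
  have hb := P.b_nonneg
  have hx := P.x_nonneg
  rw [abs_of_nonneg hA]
  have hK₀ : K₂ - regPow s P.ε P.z₂ * (⟪P.z₂, P.g₂ • P.T₂ + P.h₂ • P.S₂⟫ / 2) =
      regPow s P.ε P.z₂ * (⟪P.z₂, (P.h₂ - P.g₂) • P.T₂ - P.h₂ • (P.S₂ - P.T₂)⟫ / 2) := by
    rw [hK₂]
    simp only [inner_add_right, inner_sub_right, inner_smul_right]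
    ring
  have hK₀' : |K₂ - regPow s P.ε P.z₂ * (⟪P.z₂, P.g₂ • P.T₂ + P.h₂ • P.S₂⟫ / 2)| ≤
      C₃ * (A * (A * P.b + A * (A * P.b)) / 2) := by
    rw [hK₀, abs_mul, abs_div, abs_two]
    have i1 : ‖(P.h₂ - P.g₂) • P.T₂ - P.h₂ • (P.S₂ - P.T₂)‖ ≤ A * P.b + A * (A * P.b) := by
      refine (norm_sub_le _ _).trans ?_
      rw [norm_smul, norm_smul, P.norm_T₂, mul_one, norm_eq_abs, norm_eq_abs]
      have := P.h₂_sub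
      have := P.h₂_le
      have := P.S₂_sub
      gcongr
    have i2 := (abs_real_inner_le_norm P.z₂ _).trans
      (mul_le_mul P.z₂_le i1 (norm_nonneg _) hA)
    rw [mul_one, norm_eq_abs] at h₃
    gcongr
  have e : K₁ • orthPart P.T₁ P.S₁ - K₂ • orthPart P.T₂ P.S₂ -
        (regPow s P.ε P.z₂ * (⟪P.z₂, P.g₂ • P.T₂ + P.h₂ • P.S₂⟫ / 2)) •
          ((P.S₁ - P.S₂) - (P.T₁ - P.T₂)) =
      (K₁ - K₂) • (P.S₁ - P.T₁) +
      (K₂ - regPow s P.ε P.z₂ * (⟪P.z₂, P.g₂ • P.T₂ + P.h₂ • P.S₂⟫ / 2)) •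
          ((P.S₁ - P.S₂) - (P.T₁ - P.T₂)) +
      (K₁ • (1 / 2 * ⟪P.S₁ - P.T₁, P.S₁ - P.T₁⟫) • P.T₁ -
        K₂ • (1 / 2 * ⟪P.S₂ - P.T₂, P.S₂ - P.T₂⟫) • P.T₂) := by
    rw [orthPart_eq P.norm_T₁ P.norm_S₁, orthPart_eq P.norm_T₂ P.norm_S₂]
    module
  rw [e]
  have j1 : ‖(K₁ - K₂) • (P.S₁ - P.T₁)‖ ≤ C₂ * P.x * (A * P.b) := by
    rw [norm_smul]
    have := P.S₁_sub
    gcongr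
  have j2 : ‖(K₂ - regPow s P.ε P.z₂ * (⟪P.z₂, P.g₂ • P.T₂ + P.h₂ • P.S₂⟫ / 2)) •
      ((P.S₁ - P.S₂) - (P.T₁ - P.T₂))‖ ≤
      C₃ * (A * (A * P.b + A * (A * P.b)) / 2) * (P.x + P.x) := by
    rw [norm_smul, norm_eq_abs]
    have := (norm_sub_le (P.S₁ - P.S₂) (P.T₁ - P.T₂)).trans (add_le_add P.S_close P.T_close)
    gcongr
  refine (norm_add₃_le.trans (add_le_add_three j1 j2 h₁)).trans (le_of_eq ?_)
  ring

end PairData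

/-- The unit vector field in the direction of `p`. -/
def unitVec (p : ℝ → R2) (θ : ℝ) : R2 := ‖p θ‖⁻¹ • p θ

/-- The squared distance of two parametrised curves at a parameter. -/
def curveDistSq (γ₁ p₁ γ₂ p₂ : ℝ → R2) (ξ : ℝ) : ℝ :=
  ‖γ₁ ξ - γ₂ ξ‖ ^ 2 + (‖p₁ ξ‖ - ‖p₂ ξ‖) ^ 2 + ‖unitVec p₁ ξ - unitVec p₂ ξ‖ ^ 2

/-- The squared distance of two parametrised curves at a pair of parameters. -/
def pairDistSq (γ₁ p₁ γ₂ p₂ : ℝ → R2) (ξ η : ℝ) : ℝ :=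
  curveDistSq γ₁ p₁ γ₂ p₂ ξ + curveDistSq γ₁ p₁ γ₂ p₂ (ξ + η) +
    ‖η⁻¹ • (chord γ₁ ξ η - chord γ₂ ξ η)‖ ^ 2

/-- The component along the tangent of the strain integrand. -/
def stretchKer (α ε : ℝ) (γ p : ℝ → R2) (ξ η : ℝ) : ℝ :=
  ⟪unitVec p ξ, strainKer α ε γ p ξ η⟫

/-- The component orthogonal to the tangent of the strain integrand, divided by the speed. -/
def rotKer (α ε : ℝ) (γ p : ℝ → R2) (ξ η : ℝ) : R2 :=
  ‖p ξ‖⁻¹ • orthPart (unitVec p ξ) (strainKer α ε γ p ξ η)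

/-- The symmetric leading coefficient of the tangent rotation. -/
def symKer (α ε : ℝ) (γ p : ℝ → R2) (ξ η : ℝ) : ℝ :=
  regPow (1 + α) ε (chord γ ξ η) * (⟪chord γ ξ η, p ξ + p (ξ + η)⟫ / 2)

lemma curveDistSq_nonneg (γ₁ p₁ γ₂ p₂ : ℝ → R2) (ξ : ℝ) : 0 ≤ curveDistSq γ₁ p₁ γ₂ p₂ ξ := by
  unfold curveDistSq; positivity

lemma pairDistSq_nonneg (γ₁ p₁ γ₂ p₂ : ℝ → R2) (ξ η : ℝ) : 0 ≤ pairDistSq γ₁ p₁ γ₂ p₂ ξ η := by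
  have h1 := curveDistSq_nonneg γ₁ p₁ γ₂ p₂ ξ
  have h2 := curveDistSq_nonneg γ₁ p₁ γ₂ p₂ (ξ + η)
  unfold pairDistSq; positivity

lemma norm_normalize_sub_le {v w : R2} (hv : v ≠ 0) (hw : w ≠ 0) :
    ‖‖v‖⁻¹ • v - ‖w‖⁻¹ • w‖ ≤ 2 * ‖w‖⁻¹ * ‖v - w‖ := by
  have hv' : 0 < ‖v‖ := norm_pos_iff.2 hv
  have hw' : 0 < ‖w‖ := norm_pos_iff.2 hw
  have e : ‖v‖⁻¹ • v - ‖w‖⁻¹ • w = (‖v‖⁻¹ - ‖w‖⁻¹) • v + ‖w‖⁻¹ • (v - w) := by module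
  have h1 : ‖(‖v‖⁻¹ - ‖w‖⁻¹) • v‖ ≤ ‖w‖⁻¹ * ‖v - w‖ := by
    rw [norm_smul, norm_eq_abs, show ‖v‖⁻¹ - ‖w‖⁻¹ = (‖w‖ - ‖v‖) * (‖v‖⁻¹ * ‖w‖⁻¹) by field_simp,
      abs_mul, abs_of_pos (show 0 < ‖v‖⁻¹ * ‖w‖⁻¹ by positivity)]
    have := abs_norm_sub_norm_le w v
    rw [norm_sub_rev] at this
    calc |‖w‖ - ‖v‖| * (‖v‖⁻¹ * ‖w‖⁻¹) * ‖v‖ = ‖w‖⁻¹ * |‖w‖ - ‖v‖| := by field_simp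
      _ ≤ _ := by gcongr
  have h2 : ‖‖w‖⁻¹ • (v - w)‖ = ‖w‖⁻¹ * ‖v - w‖ := by
    rw [norm_smul, norm_inv, norm_norm]
  rw [e]
  exact (norm_add_le _ _).trans (by rw [h2]; linarith)

namespace IsC1Loop

variable {α ε : ℝ} {γ p : ℝ → R2}

lemma norm_unitVec (h : IsC1Loop γ p) (θ : ℝ) : ‖unitVec p θ‖ = 1 := by
  rw [unitVec, norm_smul, norm_inv, norm_norm, inv_mul_cancel₀ (norm_ne_zero_iff.2 (h.ne_zero θ))]

lemma norm_smul_unitVec (h : IsC1Loop γ p) (θ : ℝ) : ‖p θ‖ • unitVec p θ = p θ := by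
  rw [unitVec, smul_smul, mul_inv_cancel₀ (norm_ne_zero_iff.2 (h.ne_zero θ)), one_smul]

lemma continuous_unitVec (h : IsC1Loop γ p) : Continuous (unitVec p) :=
  (h.cont_deriv.norm.inv₀ fun θ => norm_ne_zero_iff.2 (h.ne_zero θ)).smul h.cont_deriv

lemma strainKer_eq (h : IsC1Loop γ p) (ξ η : ℝ) : strainKer α ε γ p ξ η =
    (regPow (1 + α) ε (chord γ ξ η) * (‖p ξ‖ * ‖p (ξ + η)‖)) •
      (⟪chord γ ξ η, unitVec p ξ⟫ • unitVec p (ξ + η) -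
        ⟪chord γ ξ η, unitVec p (ξ + η)⟫ • unitVec p ξ) := by
  rw [strainKer]
  nth_rw 1 [← h.norm_smul_unitVec ξ, ← h.norm_smul_unitVec (ξ + η)]
  nth_rw 2 [← h.norm_smul_unitVec ξ, ← h.norm_smul_unitVec (ξ + η)]
  rw [inner_smul_right, inner_smul_right]
  module

lemma stretchKer_eq (h : IsC1Loop γ p) (ξ η : ℝ) : stretchKer α ε γ p ξ η =
    -(regPow (1 + α) ε (chord γ ξ η) * (‖p ξ‖ * ‖p (ξ + η)‖) *
      ⟪chord γ ξ η - η • p ξ, orthPart (unitVec p ξ) (unitVec p (ξ + η))⟫) := by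
  have h1 : ⟪unitVec p ξ, unitVec p ξ⟫ = 1 := by
    rw [real_inner_self_eq_norm_sq, h.norm_unitVec, one_pow]
  have h2 : ⟪p ξ, orthPart (unitVec p ξ) (unitVec p (ξ + η))⟫ = 0 := by
    nth_rw 1 [← h.norm_smul_unitVec ξ]
    rw [orthPart, inner_smul_left, inner_sub_right, inner_smul_right, h1,
      real_inner_comm (unitVec p ξ)]
    simp
  rw [inner_sub_left, inner_smul_left, h2, mul_zero, sub_zero, stretchKer, h.strainKer_eq,
    inner_smul_right, orthPart, inner_sub_right, inner_sub_right, inner_smul_right,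
    inner_smul_right, inner_smul_right, h1, real_inner_comm (unitVec p ξ) (unitVec p (ξ + η))]
  ring

lemma rotKer_eq (h : IsC1Loop γ p) (ξ η : ℝ) : rotKer α ε γ p ξ η =
    (regPow (1 + α) ε (chord γ ξ η) * ‖p (ξ + η)‖ * ⟪chord γ ξ η, unitVec p ξ⟫) •
      orthPart (unitVec p ξ) (unitVec p (ξ + η)) := by
  have h1 : ⟪unitVec p ξ, unitVec p ξ⟫ = 1 := by
    rw [real_inner_self_eq_norm_sq, h.norm_unitVec, one_pow]
  have h2 : ‖p ξ‖ ≠ 0 := norm_ne_zero_iff.2 (h.ne_zero ξ)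
  rw [rotKer, h.strainKer_eq, orthPart, orthPart, inner_smul_left, inner_sub_left,
    inner_smul_left, inner_smul_left, h1]
  simp only [RCLike.conj_to_real]
  have e : ∀ a b x y z : ℝ, ∀ T S : R2, a ≠ 0 → a⁻¹ • ((x * (a * b)) • (y • S - z • T) -
      (x * (a * b) * (y * ⟪S, T⟫ - z * 1)) • T) = (x * b * y) • (S - ⟪S, T⟫ • T) := by
    intro a b x y z T S ha
    have : a⁻¹ * a = 1 := inv_mul_cancel₀ ha
    match_scalars <;> field_simp
    ring
  exact e _ _ _ _ _ _ _ h2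

end IsC1Loop

namespace IsHolderLoop

variable {α β M c ε : ℝ} {γ₁ p₁ γ₂ p₂ : ℝ → R2}

/-- The bound used for all data of a pair of points on two Hölder loops. -/
def pairBound (M c : ℝ) : ℝ := M + 2 * M / c

lemma norm_unitVec_sub_le {γ p : ℝ → R2} (h : IsHolderLoop β M c γ p) (hβ : 0 < β) (ξ η : ℝ) :
    ‖unitVec p (ξ + η) - unitVec p ξ‖ ≤ 2 * M / c * |η| ^ β := by
  refine (norm_normalize_sub_le (h.ne_zero _) (h.ne_zero _)).trans ?_
  have h1 : ‖p ξ‖⁻¹ ≤ c⁻¹ := inv_anti₀ h.c_pos (h.c_le_norm hβ ξ)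
  have h2 : ‖p (ξ + η) - p ξ‖ ≤ M * |η| ^ β := by simpa using h.holder (ξ + η) ξ
  have := h.M_nonneg
  have := h.c_pos
  calc _ ≤ 2 * c⁻¹ * (M * |η| ^ β) := by gcongr
    _ = _ := by ring

/-- The normalised data of two Hölder loops at a pair of parameters. -/
def pairData (h₁ : IsHolderLoop β M c γ₁ p₁) (h₂ : IsHolderLoop β M c γ₂ p₂) (hβ : 0 < β)
    (ε ξ η : ℝ) (h0 : η ≠ 0) (hη : |η| ≤ π) : PairData (pairBound M c) (π ^ β) c := by
  have hM := h₁.M_nonneg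
  have hc := h₁.c_pos
  have hA : M ≤ pairBound M c := le_add_of_nonneg_right (by positivity)
  have hA' : 2 * M / c ≤ pairBound M c := le_add_of_nonneg_left hM
  have hη0 : 0 < |η| := abs_pos.2 h0
  have hb : 0 ≤ |η| ^ β := by positivity
  have hd := curveDistSq_nonneg γ₁ p₁ γ₂ p₂ ξ
  have hd' := curveDistSq_nonneg γ₁ p₁ γ₂ p₂ (ξ + η)
  have hz : ∀ {γ p : ℝ → R2}, IsHolderLoop β M c γ p → ‖η⁻¹ • chord γ ξ η‖ ≤ pairBound M c :=
    fun {γ p} h => by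
      rw [norm_smul, norm_inv, norm_eq_abs, inv_mul_le_iff₀ hη0, mul_comm]
      exact (h.norm_chord_le ξ η).trans (by gcongr)
  have hz' : ∀ {γ p : ℝ → R2}, IsHolderLoop β M c γ p → c ≤ ‖η⁻¹ • chord γ ξ η‖ :=
    fun {γ p} h => by
      rw [norm_smul, norm_inv, norm_eq_abs, le_inv_mul_iff₀ hη0, mul_comm]
      exact h.le_norm_chord ξ hη
  have hzs : ∀ {γ p : ℝ → R2}, IsHolderLoop β M c γ p →
      ‖η⁻¹ • chord γ ξ η - ‖p ξ‖ • unitVec p ξ‖ ≤ pairBound M c * |η| ^ β := fun {γ p} h => by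
    have e : η⁻¹ • chord γ ξ η - p ξ = η⁻¹ • (chord γ ξ η - η • p ξ) := by
      rw [smul_sub, smul_smul, inv_mul_cancel₀ h0, one_smul]
    rw [h.norm_smul_unitVec, e, norm_smul, norm_inv, norm_eq_abs, inv_mul_le_iff₀ hη0, mul_comm]
    exact (h.norm_chord_sub_le hβ ξ η).trans (by gcongr)
  have hS : ∀ {γ p : ℝ → R2}, IsHolderLoop β M c γ p →
      ‖unitVec p (ξ + η) - unitVec p ξ‖ ≤ pairBound M c * |η| ^ β := fun {γ p} h =>
    (h.norm_unitVec_sub_le hβ ξ η).trans (by gcongr)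
  have hg : ∀ {γ p : ℝ → R2}, IsHolderLoop β M c γ p → ∀ θ, |‖p θ‖| ≤ pairBound M c :=
    fun {γ p} h θ => by rw [abs_norm]; exact (h.bound θ).trans hA
  have hX : ∀ {y : ℝ}, y ^ 2 ≤ pairDistSq γ₁ p₁ γ₂ p₂ ξ η →
      |y| ≤ √(pairDistSq γ₁ p₁ γ₂ p₂ ξ η) := fun h => Real.abs_le_sqrt h
  exact
  { z₁ := η⁻¹ • chord γ₁ ξ η
    z₂ := η⁻¹ • chord γ₂ ξ η
    T₁ := unitVec p₁ ξ
    T₂ := unitVec p₂ ξ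
    S₁ := unitVec p₁ (ξ + η)
    S₂ := unitVec p₂ (ξ + η)
    g₁ := ‖p₁ ξ‖
    g₂ := ‖p₂ ξ‖
    h₁ := ‖p₁ (ξ + η)‖
    h₂ := ‖p₂ (ξ + η)‖
    ε := ε / η
    b := |η| ^ β
    x := √(pairDistSq γ₁ p₁ γ₂ p₂ ξ η)
    b_nonneg := hb
    b_le := by gcongr
    x_nonneg := Real.sqrt_nonneg _
    norm_T₁ := h₁.norm_unitVec _
    norm_T₂ := h₂.norm_unitVec _
    norm_S₁ := h₁.norm_unitVec _
    norm_S₂ := h₂.norm_unitVec _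
    g₁_le := hg h₁ _
    g₂_le := hg h₂ _
    h₁_le := hg h₁ _
    h₂_le := hg h₂ _
    z₁_le := hz h₁
    z₂_le := hz h₂
    le_z₁ := hz' h₁
    le_z₂ := hz' h₂
    z₁_sub := hzs h₁
    z₂_sub := hzs h₂
    S₁_sub := hS h₁
    S₂_sub := hS h₂
    h₂_sub := by
      refine (abs_norm_sub_norm_le _ _).trans ?_
      have : ‖p₂ (ξ + η) - p₂ ξ‖ ≤ M * |η| ^ β := by simpa using h₂.holder (ξ + η) ξ
      exact this.trans (by gcongr)
    z_close := by
      rw [← smul_sub, ← abs_norm]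
      exact hX (by unfold pairDistSq; linarith)
    T_close := by
      rw [← abs_norm]
      refine hX ?_
      unfold pairDistSq curveDistSq at *
      nlinarith [sq_nonneg ‖γ₁ ξ - γ₂ ξ‖, sq_nonneg (‖p₁ ξ‖ - ‖p₂ ξ‖),
        sq_nonneg ‖η⁻¹ • (chord γ₁ ξ η - chord γ₂ ξ η)‖]
    S_close := by
      rw [← abs_norm]
      refine hX ?_
      unfold pairDistSq curveDistSq at *
      nlinarith [sq_nonneg ‖γ₁ (ξ + η) - γ₂ (ξ + η)‖, sq_nonneg (‖p₁ (ξ + η)‖ - ‖p₂ (ξ + η)‖),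
        sq_nonneg ‖η⁻¹ • (chord γ₁ ξ η - chord γ₂ ξ η)‖]
    g_close := by
      refine hX ?_
      unfold pairDistSq curveDistSq at *
      nlinarith [sq_nonneg ‖γ₁ ξ - γ₂ ξ‖, sq_nonneg ‖unitVec p₁ ξ - unitVec p₂ ξ‖,
        sq_nonneg ‖η⁻¹ • (chord γ₁ ξ η - chord γ₂ ξ η)‖]
    h_close := by
      refine hX ?_
      unfold pairDistSq curveDistSq at *
      nlinarith [sq_nonneg ‖γ₁ (ξ + η) - γ₂ (ξ + η)‖,
        sq_nonneg ‖unitVec p₁ (ξ + η) - unitVec p₂ (ξ + η)‖,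
        sq_nonneg ‖η⁻¹ • (chord γ₁ ξ η - chord γ₂ ξ η)‖] }

end IsHolderLoop

lemma chord_eq_smul (γ : ℝ → R2) (ξ : ℝ) {η : ℝ} (h0 : η ≠ 0) :
    chord γ ξ η = η • (η⁻¹ • chord γ ξ η) := by
  rw [smul_smul, mul_inv_cancel₀ h0, one_smul]

lemma abs_rpow_mul_abs {η : ℝ} (h0 : η ≠ 0) (α : ℝ) :
    |η| ^ (-(2 * (1 + α))) * |η| = |η| ^ (-1 - 2 * α) := by
  rw [← Real.rpow_add_one (abs_ne_zero.2 h0)]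
  congr 1; ring

lemma abs_rpow_mul_rpow {η : ℝ} (h0 : η ≠ 0) (α β : ℝ) :
    |η| ^ (-1 - 2 * α) * |η| ^ β = |η| ^ (β - 1 - 2 * α) := by
  rw [← Real.rpow_add (abs_pos.2 h0)]
  congr 1; ring

namespace IsHolderLoop

section

variable {α β M c ε : ℝ} {γ₁ p₁ γ₂ p₂ : ℝ → R2}

lemma abs_le_sqrt_pairDistSq₁ (ξ η : ℝ) :
    ‖γ₁ ξ - γ₂ ξ‖ ≤ √(pairDistSq γ₁ p₁ γ₂ p₂ ξ η) := by
  rw [← abs_norm]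
  refine Real.abs_le_sqrt ?_
  have := curveDistSq_nonneg γ₁ p₁ γ₂ p₂ (ξ + η)
  unfold pairDistSq curveDistSq at *
  nlinarith [sq_nonneg ‖unitVec p₁ ξ - unitVec p₂ ξ‖, sq_nonneg (‖p₁ ξ‖ - ‖p₂ ξ‖),
    sq_nonneg ‖η⁻¹ • (chord γ₁ ξ η - chord γ₂ ξ η)‖]

lemma mul_le_of_le_sqrt {a b X C : ℝ} (hb0 : 0 ≤ b) (ha : a ≤ √X)
    (hb : b ≤ C * √X) (hX : 0 ≤ X) : a * b ≤ C * X := by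
  calc a * b ≤ √X * (C * √X) := by gcongr
    _ = C * (√X * √X) := by ring
    _ = _ := by rw [Real.mul_self_sqrt hX]

end

variable (α β M c : ℝ)

/-- The pointwise estimate for the single layer part of the energy identity. -/
lemma exists_layer_le (hα : 0 < α) (hβ : 0 < β) (hc : 0 < c) : ∃ C, 0 ≤ C ∧
    ∀ γ₁ p₁ γ₂ p₂ : ℝ → R2, IsHolderLoop β M c γ₁ p₁ → IsHolderLoop β M c γ₂ p₂ →
      ∀ ε ξ η : ℝ, η ≠ 0 → |η| ≤ π →
        |⟪γ₁ ξ - γ₂ ξ, layerKer α ε γ₁ p₁ ξ η - layerKer α ε γ₂ p₂ ξ η⟫| ≤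
          C * |η| ^ (-(2 * α)) * pairDistSq γ₁ p₁ γ₂ p₂ ξ η := by
  obtain ⟨C, hC, h⟩ := PairData.bdd_layer (pairBound M c) (π ^ β) c hα.le hc
  refine ⟨C, hC, fun γ₁ p₁ γ₂ p₂ h₁ h₂ ε ξ η h0 hη => ?_⟩
  have hP := (h (h₁.pairData h₂ hβ ε ξ η h0 hη)).2.2
  have e : ∀ {γ p : ℝ → R2}, IsC1Loop γ p → layerKer α ε γ p ξ η = |η| ^ (-(2 * α)) •
      (regPow α (ε / η) (η⁻¹ • chord γ ξ η) • (‖p (ξ + η)‖ • unitVec p (ξ + η))) :=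
    fun {γ p} hγ => by
      rw [hγ.norm_smul_unitVec, layerKer, smul_smul, ← regPow_smul α ε h0, ← chord_eq_smul γ ξ h0]
  rw [e h₁.toIsC1Loop, e h₂.toIsC1Loop, ← smul_sub, inner_smul_right, abs_mul,
    abs_of_nonneg (show 0 ≤ |η| ^ (-(2 * α)) by positivity), mul_comm C, mul_assoc]
  refine mul_le_mul_of_nonneg_left ?_ (by positivity)
  refine (abs_real_inner_le_norm _ _).trans ?_
  exact mul_le_of_le_sqrt (norm_nonneg _) (abs_le_sqrt_pairDistSq₁ ξ η) hP
    (pairDistSq_nonneg _ _ _ _ ξ η)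

/-- The pointwise estimate for the arc-length part of the energy identity. -/
lemma exists_stretch_le (hα : 0 < α) (hβ : 0 < β) (hc : 0 < c) : ∃ C, 0 ≤ C ∧
    ∀ γ₁ p₁ γ₂ p₂ : ℝ → R2, IsHolderLoop β M c γ₁ p₁ → IsHolderLoop β M c γ₂ p₂ →
      ∀ ε ξ η : ℝ, η ≠ 0 → |η| ≤ π →
        |(‖p₁ ξ‖ - ‖p₂ ξ‖) * (stretchKer α ε γ₁ p₁ ξ η - stretchKer α ε γ₂ p₂ ξ η)| ≤
          C * |η| ^ (β - 1 - 2 * α) * pairDistSq γ₁ p₁ γ₂ p₂ ξ η := by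
  obtain ⟨C, hC, h⟩ := PairData.small₂_stretch (pairBound M c) (π ^ β) c (by positivity)
    (s := 1 + α) (by linarith) hc
  refine ⟨C, hC, fun γ₁ p₁ γ₂ p₂ h₁ h₂ ε ξ η h0 hη => ?_⟩
  let P := h₁.pairData h₂ hβ ε ξ η h0 hη
  have hP := (h P).2.2
  have e : ∀ {γ p : ℝ → R2}, IsC1Loop γ p → stretchKer α ε γ p ξ η =
      -(|η| ^ (-(2 * (1 + α))) * η) * (‖p ξ‖ * (‖p (ξ + η)‖ *
        (regPow (1 + α) (ε / η) (η⁻¹ • chord γ ξ η) *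
        ⟪η⁻¹ • chord γ ξ η - ‖p ξ‖ • unitVec p ξ,
          orthPart (unitVec p ξ) (unitVec p (ξ + η))⟫))) := fun {γ p} hγ => by
    have e1 : chord γ ξ η - η • p ξ = η • (η⁻¹ • chord γ ξ η - p ξ) := by
      rw [smul_sub, ← chord_eq_smul γ ξ h0]
    rw [hγ.stretchKer_eq, e1, inner_smul_left, hγ.norm_smul_unitVec]
    nth_rw 1 [chord_eq_smul γ ξ h0]
    rw [regPow_smul _ ε h0]
    simp only [RCLike.conj_to_real]
    ring
  rw [e h₁.toIsC1Loop, e h₂.toIsC1Loop, ← mul_sub, ← mul_assoc, mul_right_comm]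
  have hb : |(‖p₁ ξ‖ - ‖p₂ ξ‖)| ≤ √(pairDistSq γ₁ p₁ γ₂ p₂ ξ η) := P.g_close
  have hP' := mul_le_of_le_sqrt (abs_nonneg _) hb (hP.trans (le_of_eq (mul_assoc _ _ _).symm))
    (pairDistSq_nonneg _ _ _ _ ξ η)
  rw [← abs_mul] at hP'
  rw [abs_mul, mul_comm, abs_neg, abs_mul, abs_of_nonneg (show 0 ≤ |η| ^ (-(2 * (1 + α))) by
    positivity), abs_rpow_mul_abs h0]
  rw [← abs_rpow_mul_rpow h0]
  refine (mul_le_mul_of_nonneg_left hP' (by positivity)).trans (le_of_eq ?_)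
  change _ * (C * |η| ^ β * _) = _
  ring

/-- The pointwise estimate for the tangent part of the energy identity. -/
lemma exists_rot_le (hα : 0 < α) (hβ : 0 < β) (hc : 0 < c) : ∃ C, 0 ≤ C ∧
    ∀ γ₁ p₁ γ₂ p₂ : ℝ → R2, IsHolderLoop β M c γ₁ p₁ → IsHolderLoop β M c γ₂ p₂ →
      ∀ ε ξ η : ℝ, η ≠ 0 → |η| ≤ π →
        |⟪unitVec p₁ ξ - unitVec p₂ ξ, rotKer α ε γ₁ p₁ ξ η - rotKer α ε γ₂ p₂ ξ η⟫ -
          symKer α ε γ₂ p₂ ξ η * ⟪unitVec p₁ ξ - unitVec p₂ ξ,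
            (unitVec p₁ (ξ + η) - unitVec p₂ (ξ + η)) - (unitVec p₁ ξ - unitVec p₂ ξ)⟫| ≤
          C * |η| ^ (β - 1 - 2 * α) * pairDistSq γ₁ p₁ γ₂ p₂ ξ η := by
  obtain ⟨C, hC, h⟩ := PairData.exists_rotation_le (pairBound M c) (π ^ β) c (by positivity)
    (s := 1 + α) (by linarith) hc
  refine ⟨C, hC, fun γ₁ p₁ γ₂ p₂ h₁ h₂ ε ξ η h0 hη => ?_⟩
  let P := h₁.pairData h₂ hβ ε ξ η h0 hη
  have hP := h P
  have e : ∀ {γ p : ℝ → R2}, IsC1Loop γ p → rotKer α ε γ p ξ η =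
      (|η| ^ (-(2 * (1 + α))) * η) • ((‖p (ξ + η)‖ *
        (regPow (1 + α) (ε / η) (η⁻¹ • chord γ ξ η) * ⟪η⁻¹ • chord γ ξ η, unitVec p ξ⟫)) •
          orthPart (unitVec p ξ) (unitVec p (ξ + η))) := fun {γ p} hγ => by
    have hη2 : η * η⁻¹ = 1 := mul_inv_cancel₀ h0
    rw [hγ.rotKer_eq, smul_smul, inner_smul_left]
    nth_rw 1 [chord_eq_smul γ ξ h0]
    rw [regPow_smul _ ε h0]
    simp only [RCLike.conj_to_real]
    congr 1
    linear_combination -(|η| ^ (-(2 * (1 + α))) * regPow (1 + α) (ε / η) (η⁻¹ • chord γ ξ η) *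
      ‖p (ξ + η)‖ * ⟪chord γ ξ η, unitVec p ξ⟫) * hη2
  have e' : symKer α ε γ₂ p₂ ξ η = (|η| ^ (-(2 * (1 + α))) * η) *
      (regPow (1 + α) (ε / η) (η⁻¹ • chord γ₂ ξ η) * (⟪η⁻¹ • chord γ₂ ξ η,
        ‖p₂ ξ‖ • unitVec p₂ ξ + ‖p₂ (ξ + η)‖ • unitVec p₂ (ξ + η)⟫ / 2)) := by
    have hη2 : η * η⁻¹ = 1 := mul_inv_cancel₀ h0
    rw [h₂.norm_smul_unitVec, h₂.norm_smul_unitVec, inner_smul_left, symKer]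
    nth_rw 1 [chord_eq_smul γ₂ ξ h0]
    rw [regPow_smul _ ε h0]
    simp only [RCLike.conj_to_real]
    linear_combination -(|η| ^ (-(2 * (1 + α))) * regPow (1 + α) (ε / η) (η⁻¹ • chord γ₂ ξ η) *
      ⟪chord γ₂ ξ η, p₂ ξ + p₂ (ξ + η)⟫ / 2) * hη2
  have e₂ : ∀ (q k : ℝ) (W v₁ v₂ d : R2), ⟪W, q • v₁ - q • v₂⟫ - q * k * ⟪W, d⟫ =
      q * ⟪W, v₁ - v₂ - k • d⟫ := fun q k W v₁ v₂ d => by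
    simp only [inner_sub_right, inner_smul_right]; ring
  have hb : ‖unitVec p₁ ξ - unitVec p₂ ξ‖ ≤ √(pairDistSq γ₁ p₁ γ₂ p₂ ξ η) := P.T_close
  have hP' := mul_le_of_le_sqrt (norm_nonneg _) hb (hP.trans (le_of_eq (mul_assoc _ _ _).symm))
    (pairDistSq_nonneg _ _ _ _ ξ η)
  rw [e h₁.toIsC1Loop, e h₂.toIsC1Loop, e', e₂, abs_mul, abs_mul,
    abs_of_nonneg (show 0 ≤ |η| ^ (-(2 * (1 + α))) by positivity), abs_rpow_mul_abs h0,
    ← abs_rpow_mul_rpow h0]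
  refine (mul_le_mul_of_nonneg_left ((abs_real_inner_le_norm _ _).trans hP')
    (by positivity)).trans (le_of_eq ?_)
  change _ * (C * |η| ^ β * _) = _
  ring

end IsHolderLoop

lemma Function.Periodic.intervalIntegral_comp_add_right {E : Type*} [NormedAddCommGroup E]
    [NormedSpace ℝ E] {f : ℝ → E} (hf : Periodic f (2 * π)) (a : ℝ) :
    ∫ ξ in (0)..(2 * π), f (ξ + a) = ∫ ξ in (0)..(2 * π), f ξ := by
  have := hf.intervalIntegral_add_eq a 0
  rw [zero_add] at this
  rw [intervalIntegral.integral_comp_add_right, zero_add, add_comm (2 * π), this]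

lemma norm_sq_integral_le {E : Type*} [NormedAddCommGroup E] [NormedSpace ℝ E]
    {f : ℝ → E} (hf : Continuous f) :
    ‖∫ τ in (0 : ℝ)..1, f τ‖ ^ 2 ≤ ∫ τ in (0 : ℝ)..1, ‖f τ‖ ^ 2 := by
  have h1 : ‖∫ τ in (0 : ℝ)..1, f τ‖ ≤ ∫ τ in (0 : ℝ)..1, ‖f τ‖ :=
    intervalIntegral.norm_integral_le_integral_norm (by norm_num)
  set m := ∫ τ in (0 : ℝ)..1, ‖f τ‖ with hm
  have h2 : 0 ≤ ∫ τ in (0 : ℝ)..1, (‖f τ‖ - m) ^ 2 :=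
    intervalIntegral.integral_nonneg (by norm_num) fun _ _ => sq_nonneg _
  have e : ∀ τ, (‖f τ‖ - m) ^ 2 = ‖f τ‖ ^ 2 - 2 * m * ‖f τ‖ + m ^ 2 := fun τ => by ring
  simp only [e] at h2
  have c1 : IntervalIntegrable (fun τ => ‖f τ‖ ^ 2) volume 0 1 :=
    (hf.norm.pow 2).intervalIntegrable _ _
  have c2 : IntervalIntegrable (fun τ => 2 * m * ‖f τ‖) volume 0 1 :=
    (hf.norm.const_mul _).intervalIntegrable _ _
  rw [intervalIntegral.integral_add (c1.sub c2) intervalIntegrable_const,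
    intervalIntegral.integral_sub c1 c2, intervalIntegral.integral_const_mul, ← hm,
    intervalIntegral.integral_const] at h2
  have h3 : ‖∫ τ in (0 : ℝ)..1, f τ‖ ^ 2 ≤ m ^ 2 := by gcongr
  simp only [sub_zero, one_smul] at h2
  nlinarith

lemma abs_integral_integral_le {G : ℝ → ℝ → ℝ} (hG : Continuous (uncurry G)) {C s : ℝ}
    (hs : -1 < s) (h : ∀ η, η ≠ 0 → |η| ≤ π → |∫ ξ in (0)..(2 * π), G ξ η| ≤ C * |η| ^ s) :
    |∫ ξ in (0)..(2 * π), ∫ η in (-π)..π, G ξ η| ≤ C * absMoment s := by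
  rw [intervalIntegral_swap_of_continuous hG]
  exact norm_integral_le_absMoment (f := fun η => ∫ ξ in (0)..(2 * π), G ξ η) hs h

lemma integral_integral_comp_swap {G : ℝ → ℝ → ℝ} (hG : Continuous (uncurry G))
    (hper : ∀ η, Periodic (fun ξ => G ξ η) (2 * π)) :
    ∫ ξ in (0)..(2 * π), ∫ η in (-π)..π, G (ξ + η) (-η) =
      ∫ ξ in (0)..(2 * π), ∫ η in (-π)..π, G ξ η := by
  have hG' : Continuous (uncurry fun ξ η => G (ξ + η) (-η)) :=
    hG.comp ((continuous_fst.add continuous_snd).prodMk continuous_snd.neg)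
  rw [intervalIntegral_swap_of_continuous hG', intervalIntegral_swap_of_continuous hG]
  simp_rw [fun η => (hper (-η)).intervalIntegral_comp_add_right η]
  rw [intervalIntegral.integral_comp_neg fun η => ∫ ξ in (0)..(2 * π), G ξ η, neg_neg]

/-- The squared distance in the energy norm of two parametrised curves. -/
def curveEnergy (γ₁ p₁ γ₂ p₂ : ℝ → R2) : ℝ := ∫ ξ in (0)..(2 * π), curveDistSq γ₁ p₁ γ₂ p₂ ξ

lemma curveEnergy_nonneg (γ₁ p₁ γ₂ p₂ : ℝ → R2) : 0 ≤ curveEnergy γ₁ p₁ γ₂ p₂ :=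
  intervalIntegral.integral_nonneg (by positivity) fun ξ _ => curveDistSq_nonneg γ₁ p₁ γ₂ p₂ ξ

namespace IsC1Loop

variable {α ε : ℝ} {γ p γ₁ p₁ γ₂ p₂ : ℝ → R2}

lemma periodic_unitVec (h : IsC1Loop γ p) : Periodic (unitVec p) (2 * π) := fun x => by
  simp only [unitVec, h.per_deriv x]

lemma continuous_curveDistSq (h₁ : IsC1Loop γ₁ p₁) (h₂ : IsC1Loop γ₂ p₂) :
    Continuous (curveDistSq γ₁ p₁ γ₂ p₂) :=
  (((h₁.cont.sub h₂.cont).norm.pow 2).add ((h₁.cont_deriv.norm.sub h₂.cont_deriv.norm).pow 2)).add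
    ((h₁.continuous_unitVec.sub h₂.continuous_unitVec).norm.pow 2)

lemma periodic_curveDistSq (h₁ : IsC1Loop γ₁ p₁) (h₂ : IsC1Loop γ₂ p₂) :
    Periodic (curveDistSq γ₁ p₁ γ₂ p₂) (2 * π) := fun x => by
  simp only [curveDistSq, h₁.per x, h₂.per x, h₁.per_deriv x, h₂.per_deriv x,
    h₁.periodic_unitVec x, h₂.periodic_unitVec x]

lemma continuous_pairDistSq (h₁ : IsC1Loop γ₁ p₁) (h₂ : IsC1Loop γ₂ p₂) (η : ℝ) :
    Continuous fun ξ => pairDistSq γ₁ p₁ γ₂ p₂ ξ η := by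
  have h := h₁.continuous_curveDistSq h₂
  have hc : ∀ {γ p : ℝ → R2}, IsC1Loop γ p → Continuous fun ξ => chord γ ξ η := fun {γ p} hγ =>
    hγ.continuous_chord.comp (Continuous.prodMk_left η)
  exact (h.add (h.comp (continuous_id.add continuous_const))).add
    ((((hc h₁).sub (hc h₂)).const_smul η⁻¹).norm.pow 2)

lemma inv_smul_chord (h : IsC1Loop γ p) (ξ : ℝ) {η : ℝ} (h0 : η ≠ 0) :
    η⁻¹ • chord γ ξ η = ∫ τ in (0 : ℝ)..1, p (ξ + τ * η) := by
  have hd : ∀ τ, HasDerivAt (fun τ => η⁻¹ • γ (ξ + τ * η)) (p (ξ + τ * η)) τ := fun τ => by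
    have h1 : HasDerivAt (fun τ : ℝ => ξ + τ * η) η τ := by
      simpa using ((hasDerivAt_id τ).mul_const η).const_add ξ
    have := ((h.hasDeriv (ξ + τ * η)).scomp τ h1).const_smul η⁻¹
    rwa [smul_smul, inv_mul_cancel₀ h0, one_smul] at this
  have hc : Continuous fun τ => p (ξ + τ * η) :=
    h.cont_deriv.comp (continuous_const.add (continuous_id.mul continuous_const))
  rw [intervalIntegral.integral_eq_sub_of_hasDerivAt (fun τ _ => hd τ)
    (hc.intervalIntegrable _ _), one_mul, zero_mul, add_zero, ← smul_sub]
  rfl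

lemma norm_sub_sq_le_curveDistSq (h₁ : IsC1Loop γ₁ p₁) (h₂ : IsC1Loop γ₂ p₂) {M : ℝ}
    (hM : ∀ θ, ‖p₂ θ‖ ≤ M) (ξ : ℝ) :
    ‖p₁ ξ - p₂ ξ‖ ^ 2 ≤ 2 * (1 + M ^ 2) * curveDistSq γ₁ p₁ γ₂ p₂ ξ := by
  have e : p₁ ξ - p₂ ξ = (‖p₁ ξ‖ - ‖p₂ ξ‖) • unitVec p₁ ξ +
      ‖p₂ ξ‖ • (unitVec p₁ ξ - unitVec p₂ ξ) := by
    nth_rw 1 [← h₁.norm_smul_unitVec ξ, ← h₂.norm_smul_unitVec ξ]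
    module
  have h3 : ‖p₁ ξ - p₂ ξ‖ ≤ |‖p₁ ξ‖ - ‖p₂ ξ‖| + M * ‖unitVec p₁ ξ - unitVec p₂ ξ‖ := by
    rw [e]
    refine (norm_add_le _ _).trans ?_
    rw [norm_smul, norm_smul, h₁.norm_unitVec, mul_one, norm_norm, norm_eq_abs]
    have := hM ξ
    gcongr
  have h4 : ‖p₁ ξ - p₂ ξ‖ ^ 2 ≤ (|‖p₁ ξ‖ - ‖p₂ ξ‖| + M * ‖unitVec p₁ ξ - unitVec p₂ ξ‖) ^ 2 := by
    gcongr
  rw [curveDistSq, ← sq_abs (‖p₁ ξ‖ - ‖p₂ ξ‖)]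
  nlinarith [sq_nonneg (|‖p₁ ξ‖ - ‖p₂ ξ‖| - M * ‖unitVec p₁ ξ - unitVec p₂ ξ‖),
    sq_nonneg ‖γ₁ ξ - γ₂ ξ‖, sq_nonneg (M * ‖γ₁ ξ - γ₂ ξ‖), sq_nonneg (M * |‖p₁ ξ‖ - ‖p₂ ξ‖|),
    sq_nonneg ‖unitVec p₁ ξ - unitVec p₂ ξ‖]

lemma integral_pairDistSq_le (h₁ : IsC1Loop γ₁ p₁) (h₂ : IsC1Loop γ₂ p₂) {M : ℝ}
    (hM : ∀ θ, ‖p₂ θ‖ ≤ M) {η : ℝ} (h0 : η ≠ 0) :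
    ∫ ξ in (0)..(2 * π), pairDistSq γ₁ p₁ γ₂ p₂ ξ η ≤
      (2 + 2 * (1 + M ^ 2)) * curveEnergy γ₁ p₁ γ₂ p₂ := by
  have hq := h₁.continuous_curveDistSq h₂
  have hqp := h₁.periodic_curveDistSq h₂
  have hpi : (0 : ℝ) ≤ 2 * π := by positivity
  have hq2 : Continuous fun q : ℝ × ℝ => curveDistSq γ₁ p₁ γ₂ p₂ (q.1 + q.2 * η) := by
    fun_prop
  have hle : ∀ ξ, pairDistSq γ₁ p₁ γ₂ p₂ ξ η ≤ curveDistSq γ₁ p₁ γ₂ p₂ ξ +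
      curveDistSq γ₁ p₁ γ₂ p₂ (ξ + η) +
      2 * (1 + M ^ 2) * ∫ τ in (0 : ℝ)..1, curveDistSq γ₁ p₁ γ₂ p₂ (ξ + τ * η) := fun ξ => by
    have c1 : Continuous fun τ => p₁ (ξ + τ * η) :=
      h₁.cont_deriv.comp (continuous_const.add (continuous_id.mul continuous_const))
    have c2 : Continuous fun τ => p₂ (ξ + τ * η) :=
      h₂.cont_deriv.comp (continuous_const.add (continuous_id.mul continuous_const))
    have c3 : Continuous fun τ => curveDistSq γ₁ p₁ γ₂ p₂ (ξ + τ * η) := by fun_prop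
    unfold pairDistSq
    rw [smul_sub, h₁.inv_smul_chord ξ h0, h₂.inv_smul_chord ξ h0,
      ← intervalIntegral.integral_sub (c1.intervalIntegrable _ _) (c2.intervalIntegrable _ _),
      ← intervalIntegral.integral_const_mul]
    gcongr
    refine (norm_sq_integral_le (c1.sub c2)).trans ?_
    exact intervalIntegral.integral_mono_on (by norm_num)
      (((c1.sub c2).norm.pow 2).intervalIntegrable _ _) ((c3.const_mul _).intervalIntegrable _ _)
      fun τ _ => h₁.norm_sub_sq_le_curveDistSq h₂ hM _
  have c4 : Continuous fun ξ => curveDistSq γ₁ p₁ γ₂ p₂ (ξ + η) := by fun_prop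
  have c5 : Continuous fun ξ => ∫ τ in (0 : ℝ)..1, curveDistSq γ₁ p₁ γ₂ p₂ (ξ + τ * η) :=
    intervalIntegral.continuous_parametric_intervalIntegral_of_continuous' hq2 _ _
  have c6 : Continuous fun ξ => curveDistSq γ₁ p₁ γ₂ p₂ ξ + curveDistSq γ₁ p₁ γ₂ p₂ (ξ + η) :=
    hq.add c4
  have c7 : Continuous fun ξ => curveDistSq γ₁ p₁ γ₂ p₂ ξ + curveDistSq γ₁ p₁ γ₂ p₂ (ξ + η) +
      2 * (1 + M ^ 2) * ∫ τ in (0 : ℝ)..1, curveDistSq γ₁ p₁ γ₂ p₂ (ξ + τ * η) :=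
    c6.add (c5.const_mul _)
  refine (intervalIntegral.integral_mono_on hpi
    ((h₁.continuous_pairDistSq h₂ η).intervalIntegrable _ _)
    (c7.intervalIntegrable _ _) fun ξ _ => hle ξ).trans ?_
  rw [intervalIntegral.integral_add (c6.intervalIntegrable _ _)
    ((c5.const_mul _).intervalIntegrable _ _), intervalIntegral.integral_add
    (hq.intervalIntegrable _ _) (c4.intervalIntegrable _ _), hqp.intervalIntegral_comp_add_right,
    intervalIntegral.integral_const_mul,
    intervalIntegral_swap_of_continuous (F := fun ξ τ => curveDistSq γ₁ p₁ γ₂ p₂ (ξ + τ * η)) hq2]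
  simp_rw [hqp.intervalIntegral_comp_add_right]
  rw [intervalIntegral.integral_const, sub_zero, one_smul]
  change curveEnergy _ _ _ _ + curveEnergy _ _ _ _ + _ * curveEnergy _ _ _ _ ≤ _
  apply le_of_eq; ring

/-- A kernel bound in terms of `pairDistSq` bounds the iterated integral by the energy. -/
lemma abs_integral_integral_le_curveEnergy (h₁ : IsC1Loop γ₁ p₁) (h₂ : IsC1Loop γ₂ p₂) {M : ℝ}
    (hM : ∀ θ, ‖p₂ θ‖ ≤ M) {G : ℝ → ℝ → ℝ} (hG : Continuous (uncurry G)) {C s : ℝ}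
    (hs : -1 < s) (hC : 0 ≤ C)
    (h : ∀ ξ η, η ≠ 0 → |η| ≤ π → |G ξ η| ≤ C * |η| ^ s * pairDistSq γ₁ p₁ γ₂ p₂ ξ η) :
    |∫ ξ in (0)..(2 * π), ∫ η in (-π)..π, G ξ η| ≤
      C * (2 + 2 * (1 + M ^ 2)) * absMoment s * curveEnergy γ₁ p₁ γ₂ p₂ := by
  refine (abs_integral_integral_le hG hs (C := C * (2 + 2 * (1 + M ^ 2)) *
    curveEnergy γ₁ p₁ γ₂ p₂) fun η h0 hη => ?_).trans (le_of_eq (by ring))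
  have hpi : (0 : ℝ) ≤ 2 * π := by positivity
  have := intervalIntegral.norm_integral_le_of_norm_le (μ := volume) (f := fun ξ => G ξ η)
    (g := fun ξ => C * |η| ^ s * pairDistSq γ₁ p₁ γ₂ p₂ ξ η) hpi
    (Eventually.of_forall fun ξ _ => h ξ η h0 hη)
    (((h₁.continuous_pairDistSq h₂ η).const_mul _).intervalIntegrable _ _)
  refine this.trans ?_
  rw [intervalIntegral.integral_const_mul]
  refine (mul_le_mul_of_nonneg_left (h₁.integral_pairDistSq_le h₂ hM h0)
    (by positivity)).trans (le_of_eq ?_)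
  ring

end IsC1Loop

/-- The rate of rotation of the tangent of a curve with derivative `p` when `p` evolves with
velocity `U`. -/
def rotPart (p U : ℝ → R2) (ξ : ℝ) : R2 := ‖p ξ‖⁻¹ • orthPart (unitVec p ξ) (U ξ)

/-- Half of the time derivative of `curveDistSq` for curves moving with velocities `v₁, v₂`,
whose derivatives move with velocities `U₁, U₂`. -/
def energyRate (γ₁ v₁ p₁ U₁ γ₂ v₂ p₂ U₂ : ℝ → R2) (ξ : ℝ) : ℝ :=
  ⟪γ₁ ξ - γ₂ ξ, v₁ ξ - v₂ ξ⟫ +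
    (‖p₁ ξ‖ - ‖p₂ ξ‖) * (⟪unitVec p₁ ξ, U₁ ξ⟫ - ⟪unitVec p₂ ξ, U₂ ξ⟫) +
    ⟪unitVec p₁ ξ - unitVec p₂ ξ, rotPart p₁ U₁ ξ - rotPart p₂ U₂ ξ⟫

lemma norm_orthPart_le {T : R2} (hT : ‖T‖ = 1) (S : R2) : ‖orthPart T S‖ ≤ 2 * ‖S‖ := by
  have h1 : |⟪S, T⟫| ≤ ‖S‖ := by simpa [hT] using abs_real_inner_le_norm S T
  refine (norm_sub_le _ _).trans ?_
  rw [norm_smul, hT, mul_one, norm_eq_abs]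
  linarith

lemma orthPart_smul (T S : R2) (a : ℝ) : orthPart T (a • S) = a • orthPart T S := by
  rw [orthPart, orthPart, real_inner_smul_left]; module

lemma rotPart_smul (p U : ℝ → R2) (a : ℝ) (ξ : ℝ) :
    rotPart p (fun ξ => a • U ξ) ξ = a • rotPart p U ξ := by
  rw [rotPart, rotPart, orthPart_smul, smul_comm]

lemma continuous_orthPart {X : Type*} [TopologicalSpace X] {f g : X → R2} (hf : Continuous f)
    (hg : Continuous g) : Continuous fun x => orthPart (f x) (g x) :=
  hg.sub ((hg.inner (𝕜 := ℝ) hf).smul hf)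

lemma intervalIntegral_integral_add {F G : ℝ → ℝ → ℝ} (hF : Continuous (uncurry F))
    (hG : Continuous (uncurry G)) (a b c d : ℝ) :
    ∫ x in a..b, ∫ y in c..d, (F x y + G x y) =
      (∫ x in a..b, ∫ y in c..d, F x y) + ∫ x in a..b, ∫ y in c..d, G x y := by
  have h1 : ∀ {F : ℝ → ℝ → ℝ}, Continuous (uncurry F) → ∀ x, Continuous (F x) := fun h x =>
    h.comp (Continuous.prodMk_right x)
  have h2 : ∀ {F : ℝ → ℝ → ℝ}, Continuous (uncurry F) →
      Continuous fun x => ∫ y in c..d, F x y := fun h =>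
    intervalIntegral.continuous_parametric_intervalIntegral_of_continuous' h _ _
  rw [← intervalIntegral.integral_add ((h2 hF).intervalIntegrable _ _)
    ((h2 hG).intervalIntegrable _ _)]
  refine intervalIntegral.integral_congr fun x _ => ?_
  exact intervalIntegral.integral_add ((h1 hF x).intervalIntegrable _ _)
    ((h1 hG x).intervalIntegrable _ _)

lemma integral_antisymm_mul_inner {k : ℝ → ℝ → ℝ} (hk : Continuous (uncurry k))
    (hkp : ∀ η, Periodic (fun ξ => k ξ η) (2 * π)) (hanti : ∀ ξ η, k (ξ + η) (-η) = -k ξ η)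
    {W : ℝ → R2} (hW : Continuous W) (hWp : Periodic W (2 * π)) :
    ∫ ξ in (0)..(2 * π), ∫ η in (-π)..π, k ξ η * ⟪W ξ, W (ξ + η) - W ξ⟫ =
      -∫ ξ in (0)..(2 * π), ‖W ξ‖ ^ 2 * ∫ η in (-π)..π, k ξ η := by
  have hW1 : Continuous fun q : ℝ × ℝ => W q.1 := hW.comp continuous_fst
  have hW2 : Continuous fun q : ℝ × ℝ => W (q.1 + q.2) :=
    hW.comp (continuous_fst.add continuous_snd)
  obtain ⟨G, hG⟩ : ∃ G : ℝ → ℝ → ℝ, ∀ ξ η, G ξ η = k ξ η * ⟪W ξ, W (ξ + η) - W ξ⟫ :=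
    ⟨_, fun _ _ => rfl⟩
  obtain ⟨H, hH⟩ : ∃ H : ℝ → ℝ → ℝ, ∀ ξ η, H ξ η = ‖W ξ‖ ^ 2 * k ξ η := ⟨_, fun _ _ => rfl⟩
  have cG : Continuous (uncurry G) := by
    have : uncurry G = fun q : ℝ × ℝ => uncurry k q * ⟪W q.1, W (q.1 + q.2) - W q.1⟫ :=
      funext fun q => hG q.1 q.2
    rw [this]
    exact hk.mul (hW1.inner (𝕜 := ℝ) (hW2.sub hW1))
  have cH : Continuous (uncurry H) := by
    have : uncurry H = fun q : ℝ × ℝ => ‖W q.1‖ ^ 2 * uncurry k q := funext fun q => hH q.1 q.2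
    rw [this]
    exact (hW1.norm.pow 2).mul hk
  have hsw : Continuous fun q : ℝ × ℝ => (q.1 + q.2, -q.2) :=
    (continuous_fst.add continuous_snd).prodMk continuous_snd.neg
  have cG' : Continuous (uncurry fun ξ η => G (ξ + η) (-η)) := cG.comp hsw
  have cH' : Continuous (uncurry fun ξ η => H (ξ + η) (-η)) := cH.comp hsw
  have pG : ∀ η, Periodic (fun ξ => G ξ η) (2 * π) := fun η ξ => by
    have e : ξ + 2 * π + η = ξ + η + 2 * π := by ring
    have := hkp η ξ
    simp only [hG, e, hWp _] at this ⊢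
    rw [this]
  have pH : ∀ η, Periodic (fun ξ => H ξ η) (2 * π) := fun η ξ => by
    have := hkp η ξ
    simp only [hH, hWp _] at this ⊢
    rw [this]
  have key : ∀ ξ η, G ξ η + G (ξ + η) (-η) + (H ξ η + H (ξ + η) (-η)) = 0 := fun ξ η => by
    simp only [hG, hH, hanti, add_neg_cancel_right, inner_sub_right,
      real_inner_self_eq_norm_sq, real_inner_comm (W ξ) (W (ξ + η))]
    ring
  have h1 : ∫ ξ in (0)..(2 * π), ∫ η in (-π)..π,
      (G ξ η + G (ξ + η) (-η) + (H ξ η + H (ξ + η) (-η))) = 0 := by simp [key]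
  rw [intervalIntegral_integral_add (F := fun ξ η => G ξ η + G (ξ + η) (-η))
    (G := fun ξ η => H ξ η + H (ξ + η) (-η)) (cG.add cG') (cH.add cH'),
    intervalIntegral_integral_add cG cG', intervalIntegral_integral_add cH cH',
    integral_integral_comp_swap cG pG, integral_integral_comp_swap cH pH] at h1
  simp_rw [← intervalIntegral.integral_const_mul, ← hG, ← hH]
  linarith

namespace IsC1Loop

variable {α ε : ℝ} {γ p γ₁ p₁ γ₂ p₂ : ℝ → R2}

lemma continuous_rotPart (h : IsC1Loop γ p) {U : ℝ → R2} (hU : Continuous U) :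
    Continuous (rotPart p U) :=
  (h.cont_deriv.norm.inv₀ fun θ => norm_ne_zero_iff.2 (h.ne_zero θ)).smul
    (continuous_orthPart h.continuous_unitVec hU)

lemma continuous_energyRate (h₁ : IsC1Loop γ₁ p₁) (h₂ : IsC1Loop γ₂ p₂) {v₁ v₂ U₁ U₂ : ℝ → R2}
    (hv₁ : Continuous v₁) (hv₂ : Continuous v₂) (hU₁ : Continuous U₁) (hU₂ : Continuous U₂) :
    Continuous (energyRate γ₁ v₁ p₁ U₁ γ₂ v₂ p₂ U₂) :=
  (((h₁.cont.sub h₂.cont).inner (𝕜 := ℝ) (hv₁.sub hv₂)).add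
    ((h₁.cont_deriv.norm.sub h₂.cont_deriv.norm).mul
      ((h₁.continuous_unitVec.inner (𝕜 := ℝ) hU₁).sub
        (h₂.continuous_unitVec.inner (𝕜 := ℝ) hU₂)))).add
    ((h₁.continuous_unitVec.sub h₂.continuous_unitVec).inner (𝕜 := ℝ)
      ((h₁.continuous_rotPart hU₁).sub (h₂.continuous_rotPart hU₂)))

lemma continuous_regPow_chord (h : IsC1Loop γ p) (s : ℝ) (hε : 0 < ε) :
    Continuous fun q : ℝ × ℝ => regPow s ε (chord γ q.1 q.2) :=
  (continuous_regPow _ hε.ne').comp h.continuous_chord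

lemma continuous_symKer (h : IsC1Loop γ p) (hε : 0 < ε) :
    Continuous (uncurry (symKer α ε γ p)) := by
  have h1 : Continuous fun q : ℝ × ℝ => chord γ q.1 q.2 := h.continuous_chord
  have h2 : Continuous fun q : ℝ × ℝ => p q.1 + p (q.1 + q.2) :=
    (h.cont_deriv.comp continuous_fst).add (h.cont_deriv.comp (continuous_fst.add continuous_snd))
  exact (h.continuous_regPow_chord (1 + α) hε).mul ((h1.inner (𝕜 := ℝ) h2).div_const 2)

lemma continuous_stretchKer (h : IsC1Loop γ p) (hε : 0 < ε) :
    Continuous (uncurry (stretchKer α ε γ p)) :=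
  (h.continuous_unitVec.comp continuous_fst).inner (𝕜 := ℝ) (h.continuous_strainKer hε)

lemma continuous_rotKer (h : IsC1Loop γ p) (hε : 0 < ε) :
    Continuous (uncurry (rotKer α ε γ p)) :=
  ((h.cont_deriv.norm.inv₀ fun θ => norm_ne_zero_iff.2 (h.ne_zero θ)).comp continuous_fst).smul
    (continuous_orthPart (h.continuous_unitVec.comp continuous_fst) (h.continuous_strainKer hε))

lemma integral_stretchKer (h : IsC1Loop γ p) (hε : 0 < ε) (ξ : ℝ) :
    ∫ η in (-π)..π, stretchKer α ε γ p ξ η = ⟪unitVec p ξ, strain α ε γ p ξ⟫ :=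
  (innerSL ℝ (unitVec p ξ)).intervalIntegral_comp_comm
    (((h.continuous_strainKer hε).comp (Continuous.prodMk_right ξ)).intervalIntegrable _ _)

lemma integral_rotKer (h : IsC1Loop γ p) (hε : 0 < ε) (ξ : ℝ) :
    ∫ η in (-π)..π, rotKer α ε γ p ξ η = rotPart p (strain α ε γ p) ξ := by
  have := (‖p ξ‖⁻¹ • (ContinuousLinearMap.id ℝ R2 - (innerSL ℝ (unitVec p ξ)).smulRight
    (unitVec p ξ))).intervalIntegral_comp_comm (a := -π) (b := π) (μ := volume)
    (((h.continuous_strainKer (α := α) hε).comp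
      (Continuous.prodMk_right ξ)).intervalIntegrable _ _)
  simp only [smul_apply, sub_apply, ContinuousLinearMap.id_apply,
    ContinuousLinearMap.smulRight_apply, innerSL_apply_apply] at this
  simp only [rotPart, rotKer, orthPart, real_inner_comm (unitVec p ξ), strain]
  exact this

lemma symKer_add_neg (ξ η : ℝ) :
    symKer α ε γ p (ξ + η) (-η) = -symKer α ε γ p ξ η := by
  have e : chord γ (ξ + η) (-η) = -chord γ ξ η := by
    rw [chord, chord, add_neg_cancel_right, neg_sub]
  rw [symKer, symKer, e, regPow_neg, inner_neg_left, add_neg_cancel_right, add_comm (p ξ)]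
  ring

lemma integral_symKer (h : IsC1Loop γ p) (hα : 0 < α) (hε : 0 < ε) (ξ : ℝ) :
    ∫ η in (-π)..π, symKer α ε γ p ξ η =
      ∫ η in (-π)..π,
        regPow (1 + α) ε (chord γ ξ η) * (⟪chord γ ξ η, p ξ - p (ξ + η)⟫ / 2) := by
  have hc : Continuous fun η => chord γ ξ η := h.continuous_chord.comp (Continuous.prodMk_right ξ)
  have hk : Continuous fun η => regPow (1 + α) ε (chord γ ξ η) :=
    (continuous_regPow _ hε.ne').comp hc
  have hp : Continuous fun η => p (ξ + η) := h.cont_deriv.comp (continuous_const.add continuous_id)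
  have e : ∀ η, symKer α ε γ p ξ η =
      regPow (1 + α) ε (chord γ ξ η) * (⟪chord γ ξ η, p ξ - p (ξ + η)⟫ / 2) +
        regPow (1 + α) ε (chord γ ξ η) * ⟪chord γ ξ η, p (ξ + η)⟫ := fun η => by
    rw [symKer, inner_add_right, inner_sub_right]; ring
  simp_rw [e]
  rw [intervalIntegral.integral_add, h.integral_regPow_chord hα hε, add_zero]
  · exact (hk.mul ((hc.inner (𝕜 := ℝ) (continuous_const.sub hp)).div_const 2)).intervalIntegrable
      _ _
  · exact (hk.mul (hc.inner (𝕜 := ℝ) hp)).intervalIntegrable _ _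

/-- Integration by parts for the antisymmetric kernel `symKer`. -/
lemma integral_symKer_mul_inner (h : IsC1Loop γ p) (hε : 0 < ε) {W : ℝ → R2}
    (hW : Continuous W) (hWp : Periodic W (2 * π)) :
    ∫ ξ in (0)..(2 * π), ∫ η in (-π)..π, symKer α ε γ p ξ η * ⟪W ξ, W (ξ + η) - W ξ⟫ =
      -∫ ξ in (0)..(2 * π), ‖W ξ‖ ^ 2 * ∫ η in (-π)..π, symKer α ε γ p ξ η :=
  integral_antisymm_mul_inner (h.continuous_symKer hε) (fun η ξ => by
    have e : ξ + 2 * π + η = ξ + η + 2 * π := by ring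
    simp only [symKer, chord, e, h.per _, h.per_deriv _]) symKer_add_neg hW hWp

end IsC1Loop

namespace IsHolderLoop

variable {α β M c ε : ℝ} {γ p γ₁ p₁ γ₂ p₂ : ℝ → R2}

lemma abs_integral_symKer_le (h : IsHolderLoop β M c γ p) (hα : 0 < α) (hβ : 2 * α < β)
    (hε : 0 < ε) (ξ : ℝ) : |∫ η in (-π)..π, symKer α ε γ p ξ η| ≤
      c ^ (-(2 * (1 + α))) * M ^ 2 * absMoment (β - 1 - 2 * α) := by
  rw [h.integral_symKer hα hε]
  refine norm_integral_le_absMoment (f := fun η =>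
    regPow (1 + α) ε (chord γ ξ η) * (⟪chord γ ξ η, p ξ - p (ξ + η)⟫ / 2)) (by linarith)
    fun η h0 hη => ?_
  have hM := h.M_nonneg
  have hc := h.c_pos
  have h1 : |⟪chord γ ξ η, p ξ - p (ξ + η)⟫| ≤ M * |η| * (M * |η| ^ β) := by
    refine (abs_real_inner_le_norm _ _).trans ?_
    have := h.norm_chord_le ξ η
    have h2 : ‖p ξ - p (ξ + η)‖ ≤ M * |η| ^ β := by simpa using h.holder ξ (ξ + η)
    gcongr
  have h3 := h.regPow_chord_le (ε := ε) (s := 1 + α) (by linarith) ξ h0 hη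
  rw [norm_mul, norm_eq_abs, norm_eq_abs, abs_of_nonneg (regPow_nonneg _ _ _), abs_div, abs_two,
    ← abs_rpow_mul_rpow h0, ← abs_rpow_mul_abs h0]
  calc _ ≤ (c ^ (-(2 * (1 + α))) * |η| ^ (-(2 * (1 + α)))) * (M * |η| * (M * |η| ^ β) / 1) := by
        gcongr
        norm_num
    _ = _ := by ring

lemma integral_sq_unitVec_le (h₁ : IsC1Loop γ₁ p₁) (h₂ : IsC1Loop γ₂ p₂) :
    ∫ ξ in (0)..(2 * π), ‖unitVec p₁ ξ - unitVec p₂ ξ‖ ^ 2 ≤ curveEnergy γ₁ p₁ γ₂ p₂ := by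
  refine intervalIntegral.integral_mono_on (by positivity)
    (((h₁.continuous_unitVec.sub h₂.continuous_unitVec).norm.pow 2).intervalIntegrable _ _)
    ((h₁.continuous_curveDistSq h₂).intervalIntegrable _ _) fun ξ _ => ?_
  unfold curveDistSq
  nlinarith [sq_nonneg ‖γ₁ ξ - γ₂ ξ‖, sq_nonneg (‖p₁ ξ‖ - ‖p₂ ξ‖)]

end IsHolderLoop

lemma intervalIntegral_inner_sub {k₁ k₂ : ℝ → R2} (h₁ : Continuous k₁) (h₂ : Continuous k₂)
    (a : R2) (x y : ℝ) :
    ∫ η in x..y, ⟪a, k₁ η - k₂ η⟫ = ⟪a, (∫ η in x..y, k₁ η) - ∫ η in x..y, k₂ η⟫ := by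
  rw [← intervalIntegral.integral_sub (h₁.intervalIntegrable _ _) (h₂.intervalIntegrable _ _)]
  exact (innerSL ℝ a).intervalIntegral_comp_comm ((h₁.sub h₂).intervalIntegrable _ _)

lemma intervalIntegral_lincomb {a b c : ℝ → ℝ} (ha : Continuous a) (hb : Continuous b)
    (hc : Continuous c) (r s t x y : ℝ) : ∫ ξ in x..y, (r * a ξ + s * b ξ + t * c ξ) =
      r * (∫ ξ in x..y, a ξ) + s * (∫ ξ in x..y, b ξ) + t * ∫ ξ in x..y, c ξ := by
  have h : Continuous fun ξ => r * a ξ + s * b ξ := by fun_prop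
  rw [intervalIntegral.integral_add (h.intervalIntegrable _ _)
    ((hc.const_mul _).intervalIntegrable _ _), intervalIntegral.integral_add
    ((ha.const_mul _).intervalIntegrable _ _) ((hb.const_mul _).intervalIntegrable _ _),
    intervalIntegral.integral_const_mul, intervalIntegral.integral_const_mul,
    intervalIntegral.integral_const_mul]

namespace IsC1Loop

variable {α ε : ℝ} {γ₁ p₁ γ₂ p₂ : ℝ → R2}

lemma inner_layer_sub (h₁ : IsC1Loop γ₁ p₁) (h₂ : IsC1Loop γ₂ p₂) (hε : 0 < ε) (ξ : ℝ) :
    ⟪γ₁ ξ - γ₂ ξ, layer α ε γ₁ p₁ ξ - layer α ε γ₂ p₂ ξ⟫ =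
      ∫ η in (-π)..π, ⟪γ₁ ξ - γ₂ ξ, layerKer α ε γ₁ p₁ ξ η - layerKer α ε γ₂ p₂ ξ η⟫ :=
  (intervalIntegral_inner_sub ((h₁.continuous_layerKer hε).comp (Continuous.prodMk_right ξ))
    ((h₂.continuous_layerKer hε).comp (Continuous.prodMk_right ξ)) _ _ _).symm

lemma mul_stretch_sub (h₁ : IsC1Loop γ₁ p₁) (h₂ : IsC1Loop γ₂ p₂) (hε : 0 < ε) (ξ : ℝ) :
    (‖p₁ ξ‖ - ‖p₂ ξ‖) *
        (⟪unitVec p₁ ξ, strain α ε γ₁ p₁ ξ⟫ - ⟪unitVec p₂ ξ, strain α ε γ₂ p₂ ξ⟫) =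
      ∫ η in (-π)..π,
        (‖p₁ ξ‖ - ‖p₂ ξ‖) * (stretchKer α ε γ₁ p₁ ξ η - stretchKer α ε γ₂ p₂ ξ η) := by
  have c₁ : Continuous (stretchKer α ε γ₁ p₁ ξ) :=
    (h₁.continuous_stretchKer hε).uncurry_left ξ
  have c₂ : Continuous (stretchKer α ε γ₂ p₂ ξ) :=
    (h₂.continuous_stretchKer hε).uncurry_left ξ
  rw [intervalIntegral.integral_const_mul, intervalIntegral.integral_sub
    (c₁.intervalIntegrable _ _) (c₂.intervalIntegrable _ _), h₁.integral_stretchKer hε,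
    h₂.integral_stretchKer hε]

lemma inner_rotPart_sub (h₁ : IsC1Loop γ₁ p₁) (h₂ : IsC1Loop γ₂ p₂) (hε : 0 < ε) (ξ : ℝ) :
    ⟪unitVec p₁ ξ - unitVec p₂ ξ,
        rotPart p₁ (strain α ε γ₁ p₁) ξ - rotPart p₂ (strain α ε γ₂ p₂) ξ⟫ =
      ∫ η in (-π)..π,
        ⟪unitVec p₁ ξ - unitVec p₂ ξ, rotKer α ε γ₁ p₁ ξ η - rotKer α ε γ₂ p₂ ξ η⟫ := by
  rw [← h₁.integral_rotKer hε, ← h₂.integral_rotKer hε]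
  exact (intervalIntegral_inner_sub
    ((h₁.continuous_rotKer hε).comp (Continuous.prodMk_right ξ))
    ((h₂.continuous_rotKer hε).comp (Continuous.prodMk_right ξ)) _ _ _).symm

lemma energyRate_smul (s t : ℝ) (v₁ U₁ v₂ U₂ : ℝ → R2) (ξ : ℝ) :
    energyRate γ₁ (fun ξ => s • v₁ ξ) p₁ (fun ξ => t • U₁ ξ) γ₂ (fun ξ => s • v₂ ξ) p₂
        (fun ξ => t • U₂ ξ) ξ =
      s * ⟪γ₁ ξ - γ₂ ξ, v₁ ξ - v₂ ξ⟫ +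
        t * ((‖p₁ ξ‖ - ‖p₂ ξ‖) * (⟪unitVec p₁ ξ, U₁ ξ⟫ - ⟪unitVec p₂ ξ, U₂ ξ⟫)) +
        t * ⟪unitVec p₁ ξ - unitVec p₂ ξ, rotPart p₁ U₁ ξ - rotPart p₂ U₂ ξ⟫ := by
  simp only [energyRate, rotPart_smul, ← smul_sub, real_inner_smul_right]
  ring

end IsC1Loop

namespace IsHolderLoop

variable (α β M c : ℝ)

lemma exists_integral_layer_le (hα : 0 < α) (hα' : α < 1 / 2) (hβ : 0 < β) (hc : 0 < c) :
    ∃ C, 0 ≤ C ∧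
    ∀ γ₁ p₁ γ₂ p₂ : ℝ → R2, IsHolderLoop β M c γ₁ p₁ → IsHolderLoop β M c γ₂ p₂ →
      ∀ ε > 0, |∫ ξ in (0)..(2 * π), ⟪γ₁ ξ - γ₂ ξ, layer α ε γ₁ p₁ ξ - layer α ε γ₂ p₂ ξ⟫| ≤
        C * curveEnergy γ₁ p₁ γ₂ p₂ := by
  obtain ⟨C, hC, h⟩ := exists_layer_le α β M c hα hβ hc
  refine ⟨C * (2 + 2 * (1 + M ^ 2)) * absMoment (-(2 * α)),
    mul_nonneg (by positivity) (absMoment_nonneg _), fun γ₁ p₁ γ₂ p₂ h₁ h₂ ε hε => ?_⟩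
  simp_rw [h₁.inner_layer_sub h₂.toIsC1Loop hε]
  refine h₁.abs_integral_integral_le_curveEnergy h₂.toIsC1Loop h₂.bound ?_ (by linarith) hC
    (h γ₁ p₁ γ₂ p₂ h₁ h₂ ε)
  exact ((h₁.cont.sub h₂.cont).comp continuous_fst).inner (𝕜 := ℝ)
    ((h₁.continuous_layerKer hε).sub (h₂.continuous_layerKer hε))

lemma exists_integral_stretch_le (hα : 0 < α) (hβ : 2 * α < β) (hc : 0 < c) : ∃ C, 0 ≤ C ∧
    ∀ γ₁ p₁ γ₂ p₂ : ℝ → R2, IsHolderLoop β M c γ₁ p₁ → IsHolderLoop β M c γ₂ p₂ →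
      ∀ ε > 0, |∫ ξ in (0)..(2 * π), (‖p₁ ξ‖ - ‖p₂ ξ‖) *
        (⟪unitVec p₁ ξ, strain α ε γ₁ p₁ ξ⟫ - ⟪unitVec p₂ ξ, strain α ε γ₂ p₂ ξ⟫)| ≤
        C * curveEnergy γ₁ p₁ γ₂ p₂ := by
  obtain ⟨C, hC, h⟩ := exists_stretch_le α β M c hα (by linarith) hc
  refine ⟨C * (2 + 2 * (1 + M ^ 2)) * absMoment (β - 1 - 2 * α),
    mul_nonneg (by positivity) (absMoment_nonneg _), fun γ₁ p₁ γ₂ p₂ h₁ h₂ ε hε => ?_⟩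
  simp_rw [h₁.mul_stretch_sub h₂.toIsC1Loop hε]
  refine h₁.abs_integral_integral_le_curveEnergy h₂.toIsC1Loop h₂.bound ?_ (by linarith) hC
    (h γ₁ p₁ γ₂ p₂ h₁ h₂ ε)
  exact ((h₁.cont_deriv.norm.sub h₂.cont_deriv.norm).comp continuous_fst).mul
    ((h₁.continuous_stretchKer hε).sub (h₂.continuous_stretchKer hε))

lemma exists_integral_rot_le (hα : 0 < α) (hβ : 2 * α < β) (hc : 0 < c) : ∃ C, 0 ≤ C ∧
    ∀ γ₁ p₁ γ₂ p₂ : ℝ → R2, IsHolderLoop β M c γ₁ p₁ → IsHolderLoop β M c γ₂ p₂ →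
      ∀ ε > 0, |∫ ξ in (0)..(2 * π), ⟪unitVec p₁ ξ - unitVec p₂ ξ,
        rotPart p₁ (strain α ε γ₁ p₁) ξ - rotPart p₂ (strain α ε γ₂ p₂) ξ⟫| ≤
        C * curveEnergy γ₁ p₁ γ₂ p₂ := by
  obtain ⟨C, hC, h⟩ := exists_rot_le α β M c hα (by linarith) hc
  set K := c ^ (-(2 * (1 + α))) * M ^ 2 * absMoment (β - 1 - 2 * α)
  have hK : 0 ≤ K := mul_nonneg (by positivity) (absMoment_nonneg _)
  refine ⟨C * (2 + 2 * (1 + M ^ 2)) * absMoment (β - 1 - 2 * α) + K,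
    add_nonneg (mul_nonneg (by positivity) (absMoment_nonneg _)) hK,
    fun γ₁ p₁ γ₂ p₂ h₁ h₂ ε hε => ?_⟩
  simp_rw [h₁.inner_rotPart_sub h₂.toIsC1Loop hε]
  obtain ⟨W, hW⟩ : ∃ W : ℝ → R2, ∀ ξ, W ξ = unitVec p₁ ξ - unitVec p₂ ξ := ⟨_, fun _ => rfl⟩
  have cW : Continuous W := by
    rw [show W = fun ξ => unitVec p₁ ξ - unitVec p₂ ξ from funext hW]
    exact h₁.continuous_unitVec.sub h₂.continuous_unitVec
  have pW : Periodic W (2 * π) := fun ξ => by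
    rw [hW, hW, h₁.periodic_unitVec, h₂.periodic_unitVec]
  obtain ⟨F, hF⟩ : ∃ F : ℝ → ℝ → ℝ, ∀ ξ η, F ξ η =
    ⟪W ξ, rotKer α ε γ₁ p₁ ξ η - rotKer α ε γ₂ p₂ ξ η⟫ := ⟨_, fun _ _ => rfl⟩
  obtain ⟨G, hG⟩ : ∃ G : ℝ → ℝ → ℝ, ∀ ξ η, G ξ η =
    symKer α ε γ₂ p₂ ξ η * ⟪W ξ, W (ξ + η) - W ξ⟫ := ⟨_, fun _ _ => rfl⟩
  have cW1 : Continuous fun q : ℝ × ℝ => W q.1 := cW.comp continuous_fst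
  have cF : Continuous (uncurry F) := by
    rw [show uncurry F = fun q : ℝ × ℝ => ⟪W q.1, uncurry (rotKer α ε γ₁ p₁) q -
      uncurry (rotKer α ε γ₂ p₂) q⟫ from funext fun q => hF q.1 q.2]
    exact cW1.inner (𝕜 := ℝ) ((h₁.continuous_rotKer hε).sub (h₂.continuous_rotKer hε))
  have cG : Continuous (uncurry G) := by
    rw [show uncurry G = fun q : ℝ × ℝ => uncurry (symKer α ε γ₂ p₂) q *
      ⟪W q.1, W (q.1 + q.2) - W q.1⟫ from funext fun q => hG q.1 q.2]
    exact (h₂.continuous_symKer hε).mul (cW1.inner (𝕜 := ℝ)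
      ((cW.comp (continuous_fst.add continuous_snd)).sub cW1))
  have cFG : Continuous (uncurry fun ξ η => F ξ η - G ξ η) := cF.sub cG
  have h3 := h₁.abs_integral_integral_le_curveEnergy h₂.toIsC1Loop h₂.bound cFG
    (C := C) (s := β - 1 - 2 * α) (by linarith) hC fun ξ η h0 hη => by
      have := h γ₁ p₁ γ₂ p₂ h₁ h₂ ε ξ η h0 hη
      rwa [← hW, ← hW, ← hF, ← hG] at this
  have h4 : |∫ ξ in (0)..(2 * π), ∫ η in (-π)..π, G ξ η| ≤ K * curveEnergy γ₁ p₁ γ₂ p₂ := by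
    simp_rw [hG]
    rw [h₂.integral_symKer_mul_inner hε cW pW, abs_neg]
    have cS : Continuous fun ξ => ∫ η in (-π)..π, symKer α ε γ₂ p₂ ξ η :=
      intervalIntegral.continuous_parametric_intervalIntegral_of_continuous'
        (h₂.continuous_symKer hε) _ _
    have h5 := intervalIntegral.norm_integral_le_of_norm_le (μ := volume) (a := 0) (b := 2 * π)
      (f := fun ξ => ‖W ξ‖ ^ 2 * ∫ η in (-π)..π, symKer α ε γ₂ p₂ ξ η)
      (g := fun ξ => K * ‖W ξ‖ ^ 2) (by positivity)
      (Eventually.of_forall fun ξ _ => by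
        rw [norm_mul, norm_pow, norm_norm, mul_comm]
        exact mul_le_mul_of_nonneg_right (h₂.abs_integral_symKer_le hα hβ hε ξ) (by positivity))
      (((cW.norm.pow 2).const_mul K).intervalIntegrable _ _)
    refine h5.trans ?_
    rw [intervalIntegral.integral_const_mul]
    simp_rw [hW]
    exact mul_le_mul_of_nonneg_left
      (integral_sq_unitVec_le h₁.toIsC1Loop h₂.toIsC1Loop) hK
  simp_rw [← hW, ← hF]
  have h6 := intervalIntegral_integral_add cFG cG 0 (2 * π) (-π) π
  simp only [sub_add_cancel] at h6
  rw [h6, add_mul]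
  exact (abs_add_le _ _).trans (add_le_add h3 h4)

lemma exists_integral_energyRate_reg_le (hα : 0 < α) (hα' : α < 1 / 2) (hβ : 2 * α < β)
    (hc : 0 < c) : ∃ C, 0 ≤ C ∧
    ∀ γ₁ p₁ γ₂ p₂ : ℝ → R2, IsHolderLoop β M c γ₁ p₁ → IsHolderLoop β M c γ₂ p₂ →
      ∀ ε > 0, ∀ σ, |σ| ≤ 1 → |∫ ξ in (0)..(2 * π),
        energyRate γ₁ (fun ξ => (σ / (2 * α)) • layer α ε γ₁ p₁ ξ) p₁
          (fun ξ => σ • strain α ε γ₁ p₁ ξ) γ₂ (fun ξ => (σ / (2 * α)) • layer α ε γ₂ p₂ ξ) p₂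
          (fun ξ => σ • strain α ε γ₂ p₂ ξ) ξ| ≤ C * curveEnergy γ₁ p₁ γ₂ p₂ := by
  obtain ⟨A, hA, h1⟩ := exists_integral_layer_le α β M c hα hα' (by linarith) hc
  obtain ⟨B, hB, h2⟩ := exists_integral_stretch_le α β M c hα hβ hc
  obtain ⟨D, hD, h3⟩ := exists_integral_rot_le α β M c hα hβ hc
  refine ⟨1 / (2 * α) * A + B + D, by positivity, fun γ₁ p₁ γ₂ p₂ h₁ h₂ ε hε σ hσ => ?_⟩
  have h1 := h1 γ₁ p₁ γ₂ p₂ h₁ h₂ ε hε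
  have h2 := h2 γ₁ p₁ γ₂ p₂ h₁ h₂ ε hε
  have h3 := h3 γ₁ p₁ γ₂ p₂ h₁ h₂ ε hε
  have hE := curveEnergy_nonneg γ₁ p₁ γ₂ p₂
  simp_rw [IsC1Loop.energyRate_smul]
  have c1 : Continuous fun ξ => ⟪γ₁ ξ - γ₂ ξ, layer α ε γ₁ p₁ ξ - layer α ε γ₂ p₂ ξ⟫ :=
    (h₁.cont.sub h₂.cont).inner (𝕜 := ℝ) ((h₁.continuous_layer hε).sub (h₂.continuous_layer hε))
  have c2 : Continuous fun ξ => (‖p₁ ξ‖ - ‖p₂ ξ‖) *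
        (⟪unitVec p₁ ξ, strain α ε γ₁ p₁ ξ⟫ - ⟪unitVec p₂ ξ, strain α ε γ₂ p₂ ξ⟫) :=
    (h₁.cont_deriv.norm.sub h₂.cont_deriv.norm).mul
      ((h₁.continuous_unitVec.inner (𝕜 := ℝ) (h₁.continuous_strain hε)).sub
        (h₂.continuous_unitVec.inner (𝕜 := ℝ) (h₂.continuous_strain hε)))
  have c3 : Continuous fun ξ => ⟪unitVec p₁ ξ - unitVec p₂ ξ,
        rotPart p₁ (strain α ε γ₁ p₁) ξ - rotPart p₂ (strain α ε γ₂ p₂) ξ⟫ :=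
    (h₁.continuous_unitVec.sub h₂.continuous_unitVec).inner (𝕜 := ℝ)
      ((h₁.continuous_rotPart (h₁.continuous_strain hε)).sub
        (h₂.continuous_rotPart (h₂.continuous_strain hε)))
  rw [intervalIntegral_lincomb c1 c2 c3]
  refine (abs_add_three _ _ _).trans ?_
  rw [abs_mul, abs_mul, abs_mul, abs_div, abs_of_pos (show 0 < 2 * α by linarith), add_mul,
    add_mul, mul_assoc (1 / (2 * α))]
  have h4 : |σ| / (2 * α) ≤ 1 / (2 * α) := by gcongr
  refine add_le_add_three (mul_le_mul h4 h1 (abs_nonneg _) (by positivity)) ?_ ?_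
  · exact (mul_le_of_le_one_left (abs_nonneg _) hσ).trans h2
  · exact (mul_le_of_le_one_left (abs_nonneg _) hσ).trans h3

end IsHolderLoop

/-- The uniform bound on the velocity along Hölder loops. -/
def velocityBound (α M c : ℝ) : ℝ := 1 / (2 * α) * (c ^ (-(2 * α)) * M * absMoment (-(2 * α)))

/-- The uniform bound on the strain along Hölder loops. -/
def strainBound (α β M c : ℝ) : ℝ :=
  2 * c ^ (-(2 * (1 + α))) * M ^ 3 * absMoment (β - 1 - 2 * α)

namespace IsHolderLoop

variable {α β M c : ℝ} {γ p γ₁ p₁ γ₂ p₂ v₁ v₂ U₁ U₂ : ℝ → R2}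

lemma norm_rotPart_le (h : IsHolderLoop β M c γ p) (hβ : 0 < β) (U : ℝ → R2) (ξ : ℝ) :
    ‖rotPart p U ξ‖ ≤ 2 / c * ‖U ξ‖ := by
  have h1 := norm_orthPart_le (h.norm_unitVec ξ) (U ξ)
  have h2 : ‖p ξ‖⁻¹ ≤ c⁻¹ := inv_anti₀ h.c_pos (h.c_le_norm hβ ξ)
  have := h.c_pos
  rw [rotPart, norm_smul, norm_inv, norm_norm]
  calc _ ≤ c⁻¹ * (2 * ‖U ξ‖) := by gcongr
    _ = _ := by ring

lemma abs_energyRate_le (h₁ : IsHolderLoop β M c γ₁ p₁) (h₂ : IsHolderLoop β M c γ₂ p₂)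
    (hβ : 0 < β) {V K : ℝ} {ξ : ℝ} (hv₁ : ‖v₁ ξ‖ ≤ V) (hv₂ : ‖v₂ ξ‖ ≤ V) (hU₁ : ‖U₁ ξ‖ ≤ K)
    (hU₂ : ‖U₂ ξ‖ ≤ K) : |energyRate γ₁ v₁ p₁ U₁ γ₂ v₂ p₂ U₂ ξ| ≤
      (2 * V + 2 * K + 4 / c * K) * (1 + curveDistSq γ₁ p₁ γ₂ p₂ ξ) := by
  have hc := h₁.c_pos
  have hV : 0 ≤ V := (norm_nonneg _).trans hv₁
  have hK : 0 ≤ K := (norm_nonneg _).trans hU₁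
  obtain ⟨D, hD⟩ : ∃ D, D = curveDistSq γ₁ p₁ γ₂ p₂ ξ := ⟨_, rfl⟩
  have h1 : ‖γ₁ ξ - γ₂ ξ‖ ≤ 1 + D := by
    rw [hD]; unfold curveDistSq
    nlinarith [sq_nonneg (‖γ₁ ξ - γ₂ ξ‖ - 1), sq_nonneg ‖γ₁ ξ - γ₂ ξ‖,
      sq_nonneg (‖p₁ ξ‖ - ‖p₂ ξ‖), sq_nonneg ‖unitVec p₁ ξ - unitVec p₂ ξ‖]
  have h2 : |‖p₁ ξ‖ - ‖p₂ ξ‖| ≤ 1 + D := by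
    rw [hD]; unfold curveDistSq
    rw [← sq_abs (‖p₁ ξ‖ - ‖p₂ ξ‖)]
    nlinarith [sq_nonneg (|‖p₁ ξ‖ - ‖p₂ ξ‖| - 1), sq_nonneg ‖γ₁ ξ - γ₂ ξ‖,
      sq_nonneg |‖p₁ ξ‖ - ‖p₂ ξ‖|, sq_nonneg ‖unitVec p₁ ξ - unitVec p₂ ξ‖]
  have h3 : ‖unitVec p₁ ξ - unitVec p₂ ξ‖ ≤ 1 + D := by
    rw [hD]; unfold curveDistSq
    nlinarith [sq_nonneg (‖unitVec p₁ ξ - unitVec p₂ ξ‖ - 1), sq_nonneg ‖γ₁ ξ - γ₂ ξ‖,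
      sq_nonneg (‖p₁ ξ‖ - ‖p₂ ξ‖), sq_nonneg ‖unitVec p₁ ξ - unitVec p₂ ξ‖]
  have hs : ∀ {p U : ℝ → R2}, IsC1Loop γ₁ p ∨ IsC1Loop γ₂ p → ‖U ξ‖ ≤ K →
      |⟪unitVec p ξ, U ξ⟫| ≤ K := fun {p U} h hU => by
    have : ‖unitVec p ξ‖ = 1 := h.elim (fun h => h.norm_unitVec ξ) fun h => h.norm_unitVec ξ
    refine (abs_real_inner_le_norm _ _).trans ?_
    rwa [this, one_mul]
  have e1 : |⟪γ₁ ξ - γ₂ ξ, v₁ ξ - v₂ ξ⟫| ≤ (1 + D) * (V + V) :=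
    (abs_real_inner_le_norm _ _).trans (mul_le_mul h1 ((norm_sub_le _ _).trans
      (add_le_add hv₁ hv₂)) (norm_nonneg _) ((norm_nonneg _).trans h1))
  have e2 : |(‖p₁ ξ‖ - ‖p₂ ξ‖) * (⟪unitVec p₁ ξ, U₁ ξ⟫ - ⟪unitVec p₂ ξ, U₂ ξ⟫)| ≤
      (1 + D) * (K + K) := by
    rw [abs_mul]
    exact mul_le_mul h2 ((abs_sub _ _).trans (add_le_add (hs (Or.inl h₁.toIsC1Loop) hU₁)
      (hs (Or.inr h₂.toIsC1Loop) hU₂))) (abs_nonneg _) ((norm_nonneg _).trans h1)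
  have hr : ∀ {γ p U : ℝ → R2}, IsHolderLoop β M c γ p → ‖U ξ‖ ≤ K →
      ‖rotPart p U ξ‖ ≤ 2 / c * K := fun {γ p U} h hU =>
    (h.norm_rotPart_le hβ U ξ).trans (by gcongr)
  have e3 : |⟪unitVec p₁ ξ - unitVec p₂ ξ, rotPart p₁ U₁ ξ - rotPart p₂ U₂ ξ⟫| ≤
      (1 + D) * (2 / c * K + 2 / c * K) :=
    (abs_real_inner_le_norm _ _).trans (mul_le_mul h3 ((norm_sub_le _ _).trans
      (add_le_add (hr h₁ hU₁) (hr h₂ hU₂))) (norm_nonneg _) ((norm_nonneg _).trans h1))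
  rw [← hD]
  refine (abs_add_three _ _ _).trans ((add_le_add_three e1 e2 e3).trans (le_of_eq ?_))
  ring

lemma continuous_strain_zero (h : IsHolderLoop β M c γ p) (hα : 0 < α) (hβ : 2 * α < β) :
    Continuous (strain α 0 γ p) := by
  have h1 : Continuous (uncurry fun _ : ℝ => γ) := h.cont.comp continuous_snd
  have h2 : Continuous (uncurry fun _ : ℝ => p) := h.cont_deriv.comp continuous_snd
  have h3 := continuous_strain_family hα hβ h1 h2 fun _ => h
  simpa only [comp_def] using h3.comp (Continuous.prodMk_right (0 : ℝ))

lemma tendsto_energyRate {l : Filter ℝ} {v₁ v₂ U₁ U₂ : ℝ → ℝ → R2}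
    {w₁ w₂ W₁ W₂ : ℝ → R2} {ξ : ℝ} (hv₁ : Tendsto (fun ε => v₁ ε ξ) l (𝓝 (w₁ ξ)))
    (hv₂ : Tendsto (fun ε => v₂ ε ξ) l (𝓝 (w₂ ξ)))
    (hU₁ : Tendsto (fun ε => U₁ ε ξ) l (𝓝 (W₁ ξ)))
    (hU₂ : Tendsto (fun ε => U₂ ε ξ) l (𝓝 (W₂ ξ))) :
    Tendsto (fun ε => energyRate γ₁ (v₁ ε) p₁ (U₁ ε) γ₂ (v₂ ε) p₂ (U₂ ε) ξ) l
      (𝓝 (energyRate γ₁ w₁ p₁ W₁ γ₂ w₂ p₂ W₂ ξ)) := by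
  have hr : ∀ {p W : ℝ → R2} {U : ℝ → ℝ → R2}, Tendsto (fun ε => U ε ξ) l (𝓝 (W ξ)) →
      Tendsto (fun ε => rotPart p (U ε) ξ) l (𝓝 (rotPart p W ξ)) := fun {p W U} h => by
    unfold rotPart orthPart
    exact (h.sub ((h.inner tendsto_const_nhds).smul_const _)).const_smul _
  unfold energyRate
  exact ((tendsto_const_nhds.inner (hv₁.sub hv₂)).add
    (((tendsto_const_nhds.inner hU₁).sub (tendsto_const_nhds.inner hU₂)).const_mul _)).add
    (tendsto_const_nhds.inner ((hr hU₁).sub (hr hU₂)))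

lemma tendsto_integral_energyRate (h₁ : IsHolderLoop β M c γ₁ p₁) (h₂ : IsHolderLoop β M c γ₂ p₂)
    (hβ : 0 < β) {V K : ℝ} {v₁ v₂ U₁ U₂ : ℝ → ℝ → R2} {w₁ w₂ W₁ W₂ : ℝ → R2}
    (hc : ∀ ε > 0, Continuous (v₁ ε) ∧ Continuous (v₂ ε) ∧ Continuous (U₁ ε) ∧ Continuous (U₂ ε))
    (hb : ∀ ε ξ, ‖v₁ ε ξ‖ ≤ V ∧ ‖v₂ ε ξ‖ ≤ V ∧ ‖U₁ ε ξ‖ ≤ K ∧ ‖U₂ ε ξ‖ ≤ K)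
    (hv₁ : ∀ ξ, Tendsto (fun ε => v₁ ε ξ) (𝓝[>] 0) (𝓝 (w₁ ξ)))
    (hv₂ : ∀ ξ, Tendsto (fun ε => v₂ ε ξ) (𝓝[>] 0) (𝓝 (w₂ ξ)))
    (hU₁ : ∀ ξ, Tendsto (fun ε => U₁ ε ξ) (𝓝[>] 0) (𝓝 (W₁ ξ)))
    (hU₂ : ∀ ξ, Tendsto (fun ε => U₂ ε ξ) (𝓝[>] 0) (𝓝 (W₂ ξ))) :
    Tendsto (fun ε => ∫ ξ in (0)..(2 * π),
      energyRate γ₁ (v₁ ε) p₁ (U₁ ε) γ₂ (v₂ ε) p₂ (U₂ ε) ξ) (𝓝[>] 0)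
      (𝓝 (∫ ξ in (0)..(2 * π), energyRate γ₁ w₁ p₁ W₁ γ₂ w₂ p₂ W₂ ξ)) := by
  refine intervalIntegral.tendsto_integral_filter_of_dominated_convergence
    (fun ξ => (2 * V + 2 * K + 4 / c * K) * (1 + curveDistSq γ₁ p₁ γ₂ p₂ ξ)) ?_ ?_ ?_ ?_
  · filter_upwards [self_mem_nhdsWithin] with ε hε
    obtain ⟨a, b, d, e⟩ := hc ε hε
    exact (h₁.continuous_energyRate h₂.toIsC1Loop a b d e).aestronglyMeasurable
  · refine Eventually.of_forall fun ε => Eventually.of_forall fun ξ _ => ?_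
    obtain ⟨a, b, d, e⟩ := hb ε ξ
    exact h₁.abs_energyRate_le h₂ hβ a b d e
  · exact ((continuous_const.add (h₁.continuous_curveDistSq h₂.toIsC1Loop)).const_mul
      _).intervalIntegrable _ _
  · exact Eventually.of_forall fun ξ _ =>
      tendsto_energyRate (hv₁ ξ) (hv₂ ξ) (hU₁ ξ) (hU₂ ξ)

variable (α β M c) in
/-- At a fixed time, the energy rate of two curves of the same orientation is controlled by the
energy. -/
lemma exists_integral_energyRate_le (hα : 0 < α) (hα' : α < 1 / 2) (hβ : 2 * α < β)
    (hc : 0 < c) : ∃ C, 0 ≤ C ∧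
    ∀ γ₁ p₁ γ₂ p₂ : ℝ → R2, IsHolderLoop β M c γ₁ p₁ → IsHolderLoop β M c γ₂ p₂ →
      ∀ (Ω₁ Ω₂ : Set R2) (σ : ℝ), IsBounded Ω₁ → IsBounded Ω₂ → |σ| ≤ 1 →
        GreenFormula γ₁ p₁ Ω₁ σ → GreenFormula γ₂ p₂ Ω₂ σ →
        |∫ ξ in (0)..(2 * π), energyRate γ₁ (fun ξ => sqgVelocity α Ω₁ (γ₁ ξ)) p₁
          (fun ξ => σ • strain α 0 γ₁ p₁ ξ) γ₂ (fun ξ => sqgVelocity α Ω₂ (γ₂ ξ)) p₂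
          (fun ξ => σ • strain α 0 γ₂ p₂ ξ) ξ| ≤ C * curveEnergy γ₁ p₁ γ₂ p₂ := by
  obtain ⟨C, hC, h⟩ := exists_integral_energyRate_reg_le α β M c hα hα' hβ hc
  refine ⟨C, hC, fun γ₁ p₁ γ₂ p₂ h₁ h₂ Ω₁ Ω₂ σ hb₁ hb₂ hσ hG₁ hG₂ => ?_⟩
  have hV : ∀ {γ p : ℝ → R2}, IsHolderLoop β M c γ p → ∀ ε ξ,
      ‖(σ / (2 * α)) • layer α ε γ p ξ‖ ≤ velocityBound α M c := fun {γ p} hγ ε ξ => by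
    rw [norm_smul, norm_eq_abs, abs_div, abs_of_pos (show 0 < 2 * α by linarith), velocityBound]
    have := hγ.norm_layer_le (ε := ε) hα hα' ξ
    gcongr
  have hU : ∀ {γ p : ℝ → R2}, IsHolderLoop β M c γ p → ∀ ε ξ,
      ‖σ • strain α ε γ p ξ‖ ≤ strainBound α β M c := fun {γ p} hγ ε ξ => by
    rw [norm_smul, norm_eq_abs]
    exact (mul_le_of_le_one_left (norm_nonneg _) hσ).trans (hγ.norm_strain_le hα hβ ξ)
  have hvlim : ∀ {γ p : ℝ → R2} {Ω : Set R2}, IsHolderLoop β M c γ p → IsBounded Ω →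
      GreenFormula γ p Ω σ → ∀ ξ, Tendsto (fun ε => (σ / (2 * α)) • layer α ε γ p ξ) (𝓝[>] 0)
        (𝓝 (sqgVelocity α Ω (γ ξ))) := fun {γ p Ω} hγ hb hG ξ => by
    refine (tendsto_regVelocity hα hα' hb (γ ξ)).congr' ?_
    filter_upwards [self_mem_nhdsWithin] with ε hε
    exact hγ.regVelocity_eq_layer hα hb hG hε ξ
  have hUlim : ∀ {γ p : ℝ → R2}, IsHolderLoop β M c γ p →
      ∀ ξ, Tendsto (fun ε => σ • strain α ε γ p ξ) (𝓝[>] 0)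
        (𝓝 (σ • strain α 0 γ p ξ)) := fun {γ p} hγ ξ => (hγ.tendsto_strain hα hβ ξ).const_smul σ
  refine le_of_tendsto (tendsto_integral_energyRate h₁ h₂ (by linarith)
    (v₁ := fun ε ξ => (σ / (2 * α)) • layer α ε γ₁ p₁ ξ)
    (v₂ := fun ε ξ => (σ / (2 * α)) • layer α ε γ₂ p₂ ξ)
    (U₁ := fun ε ξ => σ • strain α ε γ₁ p₁ ξ) (U₂ := fun ε ξ => σ • strain α ε γ₂ p₂ ξ)
    (fun ε hε => ⟨(h₁.continuous_layer hε).fun_const_smul _,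
      (h₂.continuous_layer hε).fun_const_smul _,
      (h₁.continuous_strain hε).fun_const_smul _, (h₂.continuous_strain hε).fun_const_smul _⟩)
    (fun ε ξ => ⟨hV h₁ ε ξ, hV h₂ ε ξ, hU h₁ ε ξ, hU h₂ ε ξ⟩)
    (hvlim h₁ hb₁ hG₁) (hvlim h₂ hb₂ hG₂) (hUlim h₁) (hUlim h₂)).abs ?_
  filter_upwards [self_mem_nhdsWithin] with ε hε
  exact h γ₁ p₁ γ₂ p₂ h₁ h₂ ε hε σ hσ

end IsHolderLoop

section LoopFamily

variable {β M T : ℝ} {Γ P : ℝ → ℝ → R2}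

lemma continuous_uncurry_of_lipschitz (hM : ∀ t x y, ‖Γ t x - Γ t y‖ ≤ M * |x - y|)
    (hΓ : ∀ x, Continuous fun t => Γ t x) : Continuous (uncurry Γ) := by
  have hlip : ∀ t, LipschitzWith M.toNNReal (Γ t) := fun t =>
    LipschitzWith.of_dist_le_mul fun x y => by
      rw [dist_eq_norm, dist_eq_norm, norm_eq_abs]
      exact (hM t x y).trans (by gcongr; exact le_coe_toNNReal M)
  exact continuous_prod_of_continuous_lipschitzWith' _ M.toNNReal hlip hΓ

lemma continuous_uncurry_deriv (hβ : 0 < β) (hΓ : Continuous (uncurry Γ))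
    (hd : ∀ t x, HasDerivAt (Γ t) (P t x) x)
    (hP : ∀ t x y, ‖P t x - P t y‖ ≤ M * |x - y| ^ β) : Continuous (uncurry P) := by
  have hM : 0 ≤ M := by simpa using (norm_nonneg _).trans (hP 0 1 0)
  have key : ∀ h > 0, ∀ t x, ‖h⁻¹ • (Γ t (x + h) - Γ t x) - P t x‖ ≤ M * h ^ β := by
    intro h hh t x
    have h1 := (convex_Icc x (x + h)).norm_image_sub_le_of_norm_hasDerivWithin_le
      (f := fun y => Γ t y - (y - x) • P t x) (f' := fun y => P t y - P t x) (C := M * h ^ β)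
      (x := x) (y := x + h) (fun y _ => by
        simpa using ((hd t y).fun_sub (((hasDerivAt_id y).sub_const x).smul_const
          (P t x))).hasDerivWithinAt)
      (fun y hy => (hP t y x).trans (by
        have : |y - x| ≤ h := by rw [abs_of_nonneg] <;> linarith [hy.1, hy.2]
        gcongr)) (by simp [hh.le]) (by simp [hh.le])
    have h2 : h⁻¹ • (Γ t (x + h) - Γ t x) - P t x = h⁻¹ • (Γ t (x + h) - (x + h - x) • P t x -
        (Γ t x - (x - x) • P t x)) := by
      have : h⁻¹ • h • P t x = P t x := inv_smul_smul₀ hh.ne' _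
      simp only [add_sub_cancel_left, sub_self, zero_smul, sub_zero, smul_sub, this]
      abel
    rw [h2, norm_smul, norm_inv, norm_eq_abs, abs_of_pos hh, inv_mul_le_iff₀ hh]
    simpa [abs_of_pos hh, mul_comm, mul_assoc] using h1
  have hu : TendstoUniformly
      (fun h : ℝ => fun q : ℝ × ℝ => h⁻¹ • (Γ q.1 (q.2 + h) - Γ q.1 q.2)) (uncurry P)
      (𝓝[>] 0) := by
    rw [Metric.tendstoUniformly_iff]
    intro ε hε
    have h0 : Tendsto (fun h : ℝ => M * h ^ β) (𝓝[>] 0) (𝓝 0) := by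
      have : ContinuousAt (fun h : ℝ => M * h ^ β) 0 :=
        (continuousAt_rpow_const _ _ (Or.inr hβ.le)).const_mul _
      have h1 := this.tendsto.mono_left (nhdsWithin_le_nhds (s := Ioi 0))
      simpa [zero_rpow hβ.ne'] using h1
    filter_upwards [h0.eventually_lt_const hε, self_mem_nhdsWithin] with h h1 h2 q
    rw [dist_eq_norm, norm_sub_rev]
    exact (key h h2 q.1 q.2).trans_lt h1
  refine hu.continuous (Eventually.frequently (Eventually.of_forall fun h => ?_))
  have h1 : Continuous fun q : ℝ × ℝ => Γ q.1 (q.2 + h) :=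
    hΓ.comp (continuous_fst.prodMk (continuous_snd.add continuous_const))
  have h2 : Continuous fun q : ℝ × ℝ => Γ q.1 q.2 := hΓ
  exact (h1.fun_sub h2).fun_const_smul _

lemma exists_chord_ge (hl : ∀ t, IsC1Loop (Γ t) (P t))
    (hP : Continuous (uncurry P)) (a b : ℝ) :
    ∃ c > 0, ∀ t ∈ Icc a b, ∀ ξ η, |η| ≤ π → c * |η| ≤ ‖Γ t (ξ + η) - Γ t ξ‖ := by
  obtain ⟨Q, hQ⟩ : ∃ Q : (ℝ × ℝ) × ℝ → R2, ∀ q, Q q =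
    ∫ s in (0)..1, P q.1.1 (q.1.2 + s * q.2) := ⟨_, fun _ => rfl⟩
  have hQc : Continuous Q := by
    have : Continuous (uncurry fun (q : (ℝ × ℝ) × ℝ) (s : ℝ) => P q.1.1 (q.1.2 + s * q.2)) := by
      have h1 : Continuous fun r : ((ℝ × ℝ) × ℝ) × ℝ => (r.1.1.1, r.1.1.2 + r.2 * r.1.2) := by
        fun_prop
      exact hP.comp h1
    rw [funext hQ]
    exact intervalIntegral.continuous_parametric_intervalIntegral_of_continuous' this 0 1
  have hQs : ∀ t ξ η, η • Q ((t, ξ), η) = Γ t (ξ + η) - Γ t ξ := by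
    intro t ξ η
    have h1 := intervalIntegral.integral_eq_sub_of_hasDerivAt (a := 0) (b := 1)
      (f := fun s : ℝ => Γ t (ξ + s * η)) (f' := fun s => η • P t (ξ + s * η))
      (fun s _ => by
        have h2 : HasDerivAt (fun s : ℝ => ξ + s * η) η s := by
          simpa using ((hasDerivAt_id s).mul_const η).const_add ξ
        exact ((hl t).hasDeriv (ξ + s * η)).scomp s h2)
      (((hl t).cont_deriv.comp (by fun_prop)).const_smul η |>.intervalIntegrable _ _)
    rw [hQ, ← intervalIntegral.integral_smul, h1]
    simp
  have hQ0 : ∀ t ξ η, |η| ≤ π → 0 < ‖Q ((t, ξ), η)‖ := by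
    intro t ξ η hη
    rw [norm_pos_iff]
    intro h0
    by_cases hz : η = 0
    · apply (hl t).ne_zero ξ
      simpa [hQ, hz] using h0
    · have h1 := hQs t ξ η
      rw [h0, smul_zero] at h1
      have h2 := (hl t).eq_of_abs_sub_lt (sub_eq_zero.1 h1.symm) (by
        rw [add_sub_cancel_left]; linarith [pi_pos])
      exact hz (by linarith)
  have hK : IsCompact ((Icc a b ×ˢ Icc (0 : ℝ) (2 * π)) ×ˢ Icc (-π) π) :=
    (isCompact_Icc.prod isCompact_Icc).prod isCompact_Icc
  obtain ⟨c, hc, hmin⟩ : ∃ c > 0, ∀ q ∈ (Icc a b ×ˢ Icc (0 : ℝ) (2 * π)) ×ˢ Icc (-π) π,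
      c ≤ ‖Q q‖ := by
    exact hK.exists_forall_le' hQc.norm.continuousOn fun q hq =>
      hQ0 q.1.1 q.1.2 q.2 (abs_le.2 hq.2)
  refine ⟨c, hc, fun t ht ξ η hη => ?_⟩
  obtain ⟨k, ζ, hζ, hk⟩ : ∃ k : ℤ, ∃ ζ ∈ Ico 0 (2 * π), ξ = ζ + k * (2 * π) := by
    obtain ⟨k, hk, -⟩ := existsUnique_zsmul_near_of_pos' two_pi_pos ξ
    exact ⟨k, _, hk, by simp⟩
  have hper : ∀ x, Γ t (x + k * (2 * π)) = Γ t x := fun x => by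
    simpa using (hl t).per.int_mul k x
  have h1 : Γ t (ξ + η) - Γ t ξ = η • Q ((t, ζ), η) := by
    rw [hQs, hk, hper, ← hper (ζ + η)]
    ring_nf
  rw [h1, norm_smul, norm_eq_abs, mul_comm]
  exact mul_le_mul_of_nonneg_left (hmin _ ⟨⟨ht, hζ.1, hζ.2.le⟩, abs_le.1 hη⟩) (abs_nonneg _)

end LoopFamily

/-- The nearest point of `[0, T]`. -/
def clampTime (T t : ℝ) : ℝ := max 0 (min t T)

lemma clampTime_mem {T : ℝ} (hT : 0 ≤ T) (t : ℝ) : clampTime T t ∈ Icc 0 T :=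
  ⟨le_max_left _ _, max_le hT (min_le_right _ _)⟩

lemma clampTime_of_mem {T t : ℝ} (ht : t ∈ Icc 0 T) : clampTime T t = t := by
  rw [clampTime, min_eq_left ht.2, max_eq_right ht.1]

lemma continuous_clampTime (T : ℝ) : Continuous (clampTime T) := by
  unfold clampTime; fun_prop

/-- A family of loops with uniform Hölder and arc-chord bounds and orientation `σ`, transported on
`(0, T)` by the velocities of the domains `Ω t` they enclose. -/
structure IsHolderFlow (α β T M c σ : ℝ) (Ω : ℝ → Set R2) (Γ P : ℝ → ℝ → R2) : Prop where
  cont : Continuous (uncurry Γ)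
  cont_deriv : Continuous (uncurry P)
  loop : ∀ t, IsHolderLoop β M c (Γ t) (P t)
  norm_le : ∀ t ξ, ‖Γ t ξ‖ ≤ M
  bounded : ∀ t, IsBounded (Ω t)
  sign : σ = 1 ∨ σ = -1
  green : ∀ t, GreenFormula (Γ t) (P t) (Ω t) σ
  area_pos : ∀ t, 0 < σ * signedArea (Γ t) (P t)
  hasDeriv : ∀ t ∈ Ioo 0 T, ∀ x,
    HasDerivAt (fun s => Γ s x) (sqgVelocity α (Ω t) (Γ t x)) t

lemma IsHolderLoop.mono {β M M' c c' : ℝ} {γ p : ℝ → R2} (h : IsHolderLoop β M c γ p)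
    (hM : M ≤ M') (hc : 0 < c') (hcc : c' ≤ c) : IsHolderLoop β M' c' γ p where
  toIsC1Loop := h.toIsC1Loop
  c_pos := hc
  bound θ := (h.bound θ).trans hM
  holder x y := (h.holder x y).trans (by gcongr)
  chord_ge ξ η hη := (by gcongr : c' * |η| ≤ c * |η|).trans (h.chord_ge ξ η hη)

lemma IsHolderFlow.mono {α β T M M' c c' σ : ℝ} {Ω : ℝ → Set R2} {Γ P : ℝ → ℝ → R2}
    (h : IsHolderFlow α β T M c σ Ω Γ P) (hM : M ≤ M') (hc : 0 < c') (hcc : c' ≤ c) :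
    IsHolderFlow α β T M' c' σ Ω Γ P :=
  { h with
    loop := fun t => (h.loop t).mono hM hc hcc
    norm_le := fun t ξ => (h.norm_le t ξ).trans hM }

lemma continuous_signedArea {Γ P : ℝ → ℝ → R2} (hΓ : Continuous (uncurry Γ))
    (hP : Continuous (uncurry P)) : Continuous fun t => signedArea (Γ t) (P t) := by
  unfold signedArea
  have : Continuous (uncurry fun t θ => P t θ 0 * Γ t θ 1) := by
    have h1 : Continuous fun q : ℝ × ℝ => P q.1 q.2 0 :=
      (EuclideanSpace.proj (0 : Fin 2) : R2 →L[ℝ] ℝ).continuous.comp hP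
    have h2 : Continuous fun q : ℝ × ℝ => Γ q.1 q.2 1 :=
      (EuclideanSpace.proj (1 : Fin 2) : R2 →L[ℝ] ℝ).continuous.comp hΓ
    exact h1.mul h2
  exact (intervalIntegral.continuous_parametric_intervalIntegral_of_continuous' this _ _).neg

/-- The orientation of a continuous family of loops is constant in time. -/
lemma exists_common_orientation {Ω : ℝ → Set R2} {Γ P : ℝ → ℝ → R2}
    (hΓ : Continuous (uncurry Γ)) (hP : Continuous (uncurry P))
    (hl : ∀ t, IsC1Loop (Γ t) (P t)) (hΩ : ∀ t, IsOpen (Ω t)) (hb : ∀ t, IsBounded (Ω t))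
    (hne : ∀ t, (Ω t).Nonempty) (hfr : ∀ t, frontier (Ω t) = range (Γ t)) :
    ∃ σ : ℝ, (σ = 1 ∨ σ = -1) ∧ ∀ t, GreenFormula (Γ t) (P t) (Ω t) σ ∧
      0 < σ * signedArea (Γ t) (P t) := by
  choose s hs hG using fun t => (hl t).exists_greenFormula (hΩ t) (hb t) (hne t) (hfr t)
  have hpos : ∀ t, 0 < s t * signedArea (Γ t) (P t) := fun t =>
    (hG t).signedArea_pos (hΩ t) (hb t) (hne t)
  have hcon : ∀ t, s t = s 0 := by
    intro t
    have hA := continuous_signedArea hΓ hP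
    have h0 : ∀ a b, s a = 1 → s b = -1 → False := fun a b ha hb => by
      have h1 := hpos a
      have h2 := hpos b
      rw [ha, one_mul] at h1
      rw [hb, neg_one_mul] at h2
      obtain ⟨r, hr⟩ := mem_range_of_exists_le_of_exists_ge hA ⟨b, by linarith⟩ ⟨a, h1.le⟩
      have h3 := hpos r
      simp only at hr
      rw [hr, mul_zero] at h3
      exact h3.false
    rcases hs t with h1 | h1 <;> rcases hs 0 with h2 | h2
    · rw [h1, h2]
    · exact (h0 t 0 h1 h2).elim
    · exact (h0 0 t h2 h1).elim
    · rw [h1, h2]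
  exact ⟨s 0, hs 0, fun t => ⟨hcon t ▸ hG t, hcon t ▸ hpos t⟩⟩

/-- A `C^{1,β}` flow of a patch solution, extended to all times by freezing it outside `[0, T]`,
satisfies uniform Hölder and arc-chord bounds. -/
theorem IsC1BetaFlow.exists_isHolderFlow {α β T : ℝ} (hβ : 0 < β) (hT : 0 ≤ T)
    {Ω : ℝ → Set R2} {γ : ℝ → ℝ → R2} (hΩ : IsPatchSol α T Ω) (hγ : IsC1BetaFlow α β T Ω γ) :
    ∃ M c σ, IsHolderFlow α β T M c σ (fun t => Ω (clampTime T t))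
      (fun t x => γ x (clampTime T t)) (fun t x => pderiv γ x (clampTime T t)) := by
  obtain ⟨⟨hloop, hdt⟩, M, hM⟩ := hγ
  obtain ⟨Γ, hΓ⟩ : ∃ Γ : ℝ → ℝ → R2, Γ = fun t x => γ x (clampTime T t) := ⟨_, rfl⟩
  obtain ⟨P, hP⟩ : ∃ P : ℝ → ℝ → R2, P = fun t x => pderiv γ x (clampTime T t) := ⟨_, rfl⟩
  have hm := clampTime_mem hT
  have hl : ∀ t, IsC1Loop (Γ t) (P t) := fun t => by
    obtain ⟨h1, h2, h3, h4, -⟩ := hloop _ (hm t)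
    rw [hΓ, hP]
    exact ⟨fun θ => (h2.differentiable one_ne_zero θ).hasDerivAt,
      h2.continuous_deriv le_rfl, h4, h1, h3⟩
  have hPb : ∀ t x, ‖P t x‖ ≤ M := fun t x => by rw [hP]; exact (hM _ (hm t) x x).2.1
  have hPh : ∀ t x y, ‖P t x - P t y‖ ≤ M * |x - y| ^ β := fun t x y => by
    rw [hP]; exact (hM _ (hm t) x y).2.2
  have hΓc : Continuous (uncurry Γ) := by
    refine continuous_uncurry_of_lipschitz (M := M) (fun t x y => ?_) fun x => ?_
    · have := convex_univ.norm_image_sub_le_of_norm_hasDerivWithin_le (f := Γ t) (f' := P t)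
        (C := M) (fun z _ => ((hl t).hasDeriv z).hasDerivWithinAt) (fun z _ => hPb t z)
        (mem_univ y) (mem_univ x)
      simpa using this
    · have h1 : ContinuousOn (fun s => γ x s) (Icc 0 T) := fun t ht =>
        (hdt x t ht).continuousWithinAt
      rw [hΓ]
      exact h1.comp_continuous (continuous_clampTime T) hm
  have hPc : Continuous (uncurry P) :=
    continuous_uncurry_deriv hβ hΓc (fun t => (hl t).hasDeriv) hPh
  obtain ⟨c, hc, hchord⟩ := exists_chord_ge hl hPc 0 T
  obtain ⟨σ, hσ, hG⟩ := exists_common_orientation (Ω := fun t => Ω (clampTime T t)) hΓc hPc hl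
    (fun t => (hΩ.1 _ (hm t)).1) (fun t => (hΩ.1 _ (hm t)).2.1)
    (fun t => (hΩ.1 _ (hm t)).2.2.nonempty)
    (fun t => by rw [hΓ]; exact (hloop _ (hm t)).2.2.2.2.symm)
  have hid : ∀ t, Γ (clampTime T t) = Γ t := fun t => by
    simp only [hΓ, clampTime_of_mem (hm t)]
  rw [← hΓ, ← hP]
  refine ⟨M, c, σ, hΓc, hPc, fun t => ⟨hl t, hc, hPb t, hPh t, fun ξ η hη => ?_⟩,
    fun t ξ => ?_, fun t => (hΩ.1 _ (hm t)).2.1, hσ, fun t => (hG t).1, fun t => (hG t).2,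
    fun t ht x => ?_⟩
  · have := hchord _ (hm t) ξ η hη
    rwa [hid] at this
  · rw [hΓ]; exact (hM _ (hm t) ξ ξ).1
  · have ht' := Ioo_subset_Icc_self ht
    have h1 := (hdt x t ht').hasDerivAt (Icc_mem_nhds ht.1 ht.2)
    rw [hΓ]
    simp only [clampTime_of_mem ht']
    refine h1.congr_of_eventuallyEq ?_
    filter_upwards [Icc_mem_nhds ht.1 ht.2] with s hs
    rw [clampTime_of_mem hs]

namespace IsHolderFlow

variable {α β T M c σ : ℝ} {Ω : ℝ → Set R2} {Γ P : ℝ → ℝ → R2}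

lemma abs_sign (h : IsHolderFlow α β T M c σ Ω Γ P) : |σ| = 1 := by
  rcases h.sign with h | h <;> simp [h]

lemma continuous_strain (h : IsHolderFlow α β T M c σ Ω Γ P) (hα : 0 < α) (hβ : 2 * α < β) :
    Continuous (uncurry fun t ξ => σ • strain α 0 (Γ t) (P t) ξ) :=
  (continuous_strain_family hα hβ h.cont h.cont_deriv h.loop).fun_const_smul σ

lemma deriv_sub_deriv (h : IsHolderFlow α β T M c σ Ω Γ P) (hα : 0 < α) (hα' : α < 1 / 2)
    (hβ : 2 * α < β) {s t : ℝ} (hs : s ∈ Ioo 0 T) (ht : t ∈ Ioo 0 T) (x : ℝ) :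
    P s x - P t x = ∫ τ in t..s, σ • strain α 0 (Γ τ) (P τ) x := by
  have hWc := h.continuous_strain hα hβ
  obtain ⟨W, hW⟩ : ∃ W : ℝ → ℝ → R2, ∀ τ ξ, W τ ξ = σ • strain α 0 (Γ τ) (P τ) ξ :=
    ⟨_, fun _ _ => rfl⟩
  simp only [← hW] at hWc ⊢
  have hsub : uIcc t s ⊆ Ioo 0 T := OrdConnected.uIcc_subset inferInstance ht hs
  have key : ∀ y, Γ s y - Γ s x - (Γ t y - Γ t x) = ∫ ξ in x..y, ∫ τ in t..s, W τ ξ := by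
    intro y
    rw [← intervalIntegral_swap_of_continuous hWc]
    refine (intervalIntegral.integral_eq_sub_of_hasDerivAt (f := fun τ => Γ τ y - Γ τ x)
      (fun τ hτ => ?_) (Continuous.intervalIntegrable ?_ _ _)).symm
    · have h1 := (h.hasDeriv τ (hsub hτ) y).fun_sub (h.hasDeriv τ (hsub hτ) x)
      rw [(h.loop τ).sqgVelocity_sub hα hα' hβ (h.bounded τ) (h.green τ) x y,
        ← intervalIntegral.integral_smul] at h1
      simpa only [hW] using h1
    · exact intervalIntegral.continuous_parametric_intervalIntegral_of_continuous' hWc x y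
  have h1 : HasDerivAt (fun y => Γ s y - Γ s x - (Γ t y - Γ t x)) (P s x - P t x) x :=
    (((h.loop s).hasDeriv x).sub_const _).fun_sub (((h.loop t).hasDeriv x).sub_const _)
  have h2 : Continuous fun ξ => ∫ τ in t..s, W τ ξ := by
    have : Continuous (uncurry fun ξ τ => W τ ξ) := hWc.comp continuous_swap
    exact intervalIntegral.continuous_parametric_intervalIntegral_of_continuous' this t s
  rw [funext key] at h1
  exact h1.unique (intervalIntegral.integral_hasDerivAt_right (h2.intervalIntegrable _ _)
    (h2.stronglyMeasurableAtFilter _ _) h2.continuousAt)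

/-- The evolution of the tangent vector. -/
lemma hasDerivAt_deriv (h : IsHolderFlow α β T M c σ Ω Γ P) (hα : 0 < α) (hα' : α < 1 / 2)
    (hβ : 2 * α < β) {t : ℝ} (ht : t ∈ Ioo 0 T) (x : ℝ) :
    HasDerivAt (fun s => P s x) (σ • strain α 0 (Γ t) (P t) x) t := by
  have hWc := (h.continuous_strain hα hβ).comp (Continuous.prodMk_left x)
  simp only [comp_def, uncurry_apply_pair] at hWc
  have h1 := (intervalIntegral.integral_hasDerivAt_right (hWc.intervalIntegrable t t)
    (hWc.stronglyMeasurableAtFilter _ _) hWc.continuousAt).const_add (P t x)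
  refine h1.congr_of_eventuallyEq ?_
  filter_upwards [Ioo_mem_nhds ht.1 ht.2] with s hs
  rw [← h.deriv_sub_deriv hα hα' hβ hs ht x]
  abel

lemma norm_velocity_le (h : IsHolderFlow α β T M c σ Ω Γ P) (hα : 0 < α) (hα' : α < 1 / 2)
    (t ξ : ℝ) : ‖sqgVelocity α (Ω t) (Γ t ξ)‖ ≤ velocityBound α M c :=
  (h.loop t).norm_sqgVelocity_le hα hα' (h.bounded t) h.abs_sign.le (h.green t) ξ

end IsHolderFlow

lemma HasDerivAt.norm_of_ne_zero {f : ℝ → R2} {f' : R2} {t : ℝ} (h : HasDerivAt f f' t)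
    (h0 : f t ≠ 0) : HasDerivAt (fun s => ‖f s‖) ⟪‖f t‖⁻¹ • f t, f'⟫ t := by
  have h1 := h.norm_sq.sqrt (by simpa using h0)
  simp only [sqrt_sq (norm_nonneg _)] at h1
  convert h1 using 1
  rw [real_inner_smul_left]
  have := norm_ne_zero_iff.2 h0
  field_simp

section Pointwise

variable {Γ₁ P₁ Γ₂ P₂ : ℝ → ℝ → R2} {v₁ U₁ v₂ U₂ : ℝ → R2} {t ξ : ℝ}

lemma hasDerivAt_unitVec {P : ℝ → ℝ → R2} {U : ℝ → R2}
    (hp : HasDerivAt (fun s => P s ξ) (U ξ) t) (h0 : P t ξ ≠ 0) :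
    HasDerivAt (fun s => unitVec (P s) ξ) (rotPart (P t) U ξ) t := by
  have h1 := ((hp.norm_of_ne_zero h0).inv (norm_ne_zero_iff.2 h0)).smul hp
  refine h1.congr_deriv ?_
  have hn := norm_ne_zero_iff.2 h0
  unfold rotPart orthPart unitVec
  rw [smul_sub, smul_smul, smul_smul, real_inner_comm, sub_eq_add_neg, ← neg_smul]
  congr 2
  field_simp

lemma hasDerivAt_curveDistSq (hv₁ : HasDerivAt (fun s => Γ₁ s ξ) (v₁ ξ) t)
    (hv₂ : HasDerivAt (fun s => Γ₂ s ξ) (v₂ ξ) t) (hp₁ : HasDerivAt (fun s => P₁ s ξ) (U₁ ξ) t)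
    (hp₂ : HasDerivAt (fun s => P₂ s ξ) (U₂ ξ) t) (h₁ : P₁ t ξ ≠ 0) (h₂ : P₂ t ξ ≠ 0) :
    HasDerivAt (fun s => curveDistSq (Γ₁ s) (P₁ s) (Γ₂ s) (P₂ s) ξ)
      (2 * energyRate (Γ₁ t) v₁ (P₁ t) U₁ (Γ₂ t) v₂ (P₂ t) U₂ ξ) t := by
  have e1 := (hv₁.fun_sub hv₂).norm_sq
  have e2 := ((hp₁.norm_of_ne_zero h₁).fun_sub (hp₂.norm_of_ne_zero h₂)).fun_pow 2
  have e3 := ((hasDerivAt_unitVec hp₁ h₁).fun_sub (hasDerivAt_unitVec hp₂ h₂)).norm_sq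
  refine ((e1.fun_add e2).fun_add e3).congr_deriv ?_
  unfold energyRate unitVec
  push_cast
  ring

end Pointwise

namespace IsHolderFlow

variable {α β T M c σ₁ σ₂ : ℝ} {Ω₁ Ω₂ : ℝ → Set R2} {Γ₁ P₁ Γ₂ P₂ : ℝ → ℝ → R2}

/-- The rate of change of half the energy between two flows. -/
def pairRate (α σ₁ σ₂ : ℝ) (Ω₁ Ω₂ : ℝ → Set R2) (Γ₁ P₁ Γ₂ P₂ : ℝ → ℝ → R2) (t ξ : ℝ) : ℝ :=
  energyRate (Γ₁ t) (fun ξ => sqgVelocity α (Ω₁ t) (Γ₁ t ξ)) (P₁ t)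
    (fun ξ => σ₁ • strain α 0 (Γ₁ t) (P₁ t) ξ) (Γ₂ t) (fun ξ => sqgVelocity α (Ω₂ t) (Γ₂ t ξ))
    (P₂ t) (fun ξ => σ₂ • strain α 0 (Γ₂ t) (P₂ t) ξ) ξ

lemma continuous_velocity {σ : ℝ} {Ω : ℝ → Set R2} {Γ P : ℝ → ℝ → R2}
    (h : IsHolderFlow α β T M c σ Ω Γ P) (hα : 0 < α) (hα' : α < 1 / 2) (hβ : 2 * α < β) (t : ℝ) :
    Continuous fun ξ => sqgVelocity α (Ω t) (Γ t ξ) := by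
  have h1 : ∀ ξ, sqgVelocity α (Ω t) (Γ t ξ) =
      sqgVelocity α (Ω t) (Γ t 0) + σ • ∫ ζ in (0)..ξ, strain α 0 (Γ t) (P t) ζ := fun ξ => by
    rw [← (h.loop t).sqgVelocity_sub hα hα' hβ (h.bounded t) (h.green t)]
    abel
  rw [funext h1]
  exact continuous_const.add ((intervalIntegral.continuous_primitive
    (fun a b => ((h.loop t).continuous_strain_zero hα hβ).intervalIntegrable a b)
    0).fun_const_smul σ)

lemma norm_strain_le {σ : ℝ} {Ω : ℝ → Set R2} {Γ P : ℝ → ℝ → R2}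
    (h : IsHolderFlow α β T M c σ Ω Γ P) (hα : 0 < α) (hβ : 2 * α < β) (t ξ : ℝ) :
    ‖σ • strain α 0 (Γ t) (P t) ξ‖ ≤ strainBound α β M c := by
  rw [norm_smul, norm_eq_abs, h.abs_sign, one_mul]
  exact (h.loop t).norm_strain_le hα hβ ξ

lemma curveDistSq_le (h₁ : IsHolderFlow α β T M c σ₁ Ω₁ Γ₁ P₁)
    (h₂ : IsHolderFlow α β T M c σ₂ Ω₂ Γ₂ P₂) (t ξ : ℝ) :
    curveDistSq (Γ₁ t) (P₁ t) (Γ₂ t) (P₂ t) ξ ≤ 8 * M ^ 2 + 4 := by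
  have a1 := (norm_sub_le _ _).trans (add_le_add (h₁.norm_le t ξ) (h₂.norm_le t ξ))
  have a2 := (abs_norm_sub_norm_le _ _).trans ((norm_sub_le _ _).trans
    (add_le_add ((h₁.loop t).bound ξ) ((h₂.loop t).bound ξ)))
  have a3 := (norm_sub_le _ _).trans
    (add_le_add ((h₁.loop t).norm_unitVec ξ).le ((h₂.loop t).norm_unitVec ξ).le)
  have b1 := pow_le_pow_left₀ (norm_nonneg _) a1 2
  have b2 := pow_le_pow_left₀ (abs_nonneg _) a2 2
  have b3 := pow_le_pow_left₀ (norm_nonneg _) a3 2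
  rw [sq_abs] at b2
  unfold curveDistSq
  nlinarith

/-- The uniform bound on the energy rate. -/
def rateBound (α β M c : ℝ) : ℝ :=
  (2 * velocityBound α M c + 2 * strainBound α β M c + 4 / c * strainBound α β M c) *
    (1 + (8 * M ^ 2 + 4))

lemma abs_pairRate_le (h₁ : IsHolderFlow α β T M c σ₁ Ω₁ Γ₁ P₁)
    (h₂ : IsHolderFlow α β T M c σ₂ Ω₂ Γ₂ P₂) (hα : 0 < α) (hα' : α < 1 / 2) (hβ : 2 * α < β)
    (t ξ : ℝ) : |pairRate α σ₁ σ₂ Ω₁ Ω₂ Γ₁ P₁ Γ₂ P₂ t ξ| ≤ rateBound α β M c := by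
  have hV := (norm_nonneg _).trans (h₁.norm_velocity_le hα hα' t ξ)
  have hK := (norm_nonneg _).trans (h₁.norm_strain_le hα hβ t ξ)
  have hc := (h₁.loop t).c_pos
  have hD := h₁.curveDistSq_le h₂ t ξ
  have h := (h₁.loop t).abs_energyRate_le (h₂.loop t) (by linarith)
    (v₁ := fun ξ => sqgVelocity α (Ω₁ t) (Γ₁ t ξ)) (v₂ := fun ξ => sqgVelocity α (Ω₂ t) (Γ₂ t ξ))
    (U₁ := fun ξ => σ₁ • strain α 0 (Γ₁ t) (P₁ t) ξ)
    (U₂ := fun ξ => σ₂ • strain α 0 (Γ₂ t) (P₂ t) ξ)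
    (h₁.norm_velocity_le hα hα' t ξ) (h₂.norm_velocity_le hα hα' t ξ)
    (h₁.norm_strain_le hα hβ t ξ) (h₂.norm_strain_le hα hβ t ξ)
  refine h.trans (mul_le_mul_of_nonneg_left (by linarith) ?_)
  generalize velocityBound α M c = V at hV ⊢
  generalize strainBound α β M c = K at hK ⊢
  positivity

lemma continuous_pairRate (h₁ : IsHolderFlow α β T M c σ₁ Ω₁ Γ₁ P₁)
    (h₂ : IsHolderFlow α β T M c σ₂ Ω₂ Γ₂ P₂) (hα : 0 < α) (hα' : α < 1 / 2) (hβ : 2 * α < β)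
    (t : ℝ) : Continuous (pairRate α σ₁ σ₂ Ω₁ Ω₂ Γ₁ P₁ Γ₂ P₂ t) :=
  (h₁.loop t).continuous_energyRate (h₂.loop t).toIsC1Loop
    (h₁.continuous_velocity hα hα' hβ t) (h₂.continuous_velocity hα hα' hβ t)
    (((h₁.loop t).continuous_strain_zero hα hβ).fun_const_smul σ₁)
    (((h₂.loop t).continuous_strain_zero hα hβ).fun_const_smul σ₂)

lemma hasDerivAt_curveEnergy (h₁ : IsHolderFlow α β T M c σ₁ Ω₁ Γ₁ P₁)
    (h₂ : IsHolderFlow α β T M c σ₂ Ω₂ Γ₂ P₂) (hα : 0 < α) (hα' : α < 1 / 2) (hβ : 2 * α < β)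
    {t : ℝ} (ht : t ∈ Ioo 0 T) :
    HasDerivAt (fun s => curveEnergy (Γ₁ s) (P₁ s) (Γ₂ s) (P₂ s))
      (2 * ∫ ξ in (0)..(2 * π), pairRate α σ₁ σ₂ Ω₁ Ω₂ Γ₁ P₁ Γ₂ P₂ t ξ) t := by
  have hcont : ∀ s, Continuous (curveDistSq (Γ₁ s) (P₁ s) (Γ₂ s) (P₂ s)) := fun s =>
    (h₁.loop s).continuous_curveDistSq (h₂.loop s).toIsC1Loop
  rw [← intervalIntegral.integral_const_mul]
  refine (intervalIntegral.hasDerivAt_integral_of_dominated_loc_of_deriv_le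
    (F := fun s ξ => curveDistSq (Γ₁ s) (P₁ s) (Γ₂ s) (P₂ s) ξ)
    (F' := fun s ξ => 2 * pairRate α σ₁ σ₂ Ω₁ Ω₂ Γ₁ P₁ Γ₂ P₂ s ξ)
    (bound := fun _ => 2 * rateBound α β M c) (Ioo_mem_nhds ht.1 ht.2)
    (Eventually.of_forall fun s => (hcont s).aestronglyMeasurable)
    ((hcont t).intervalIntegrable _ _)
    ((h₁.continuous_pairRate h₂ hα hα' hβ t).const_mul 2).aestronglyMeasurable
    (Eventually.of_forall fun ξ _ s _ => ?_) (by simp)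
    (Eventually.of_forall fun ξ _ s hs => ?_)).2
  · rw [norm_mul, norm_eq_abs, norm_eq_abs, abs_two]
    exact mul_le_mul_of_nonneg_left (h₁.abs_pairRate_le h₂ hα hα' hβ s ξ) zero_le_two
  · exact hasDerivAt_curveDistSq (h₁.hasDeriv s hs ξ) (h₂.hasDeriv s hs ξ)
      (h₁.hasDerivAt_deriv hα hα' hβ hs ξ) (h₂.hasDerivAt_deriv hα hα' hβ hs ξ)
      ((h₁.loop s).ne_zero ξ) ((h₂.loop s).ne_zero ξ)

lemma continuous_curveEnergy (h₁ : IsHolderFlow α β T M c σ₁ Ω₁ Γ₁ P₁)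
    (h₂ : IsHolderFlow α β T M c σ₂ Ω₂ Γ₂ P₂) :
    Continuous fun t => curveEnergy (Γ₁ t) (P₁ t) (Γ₂ t) (P₂ t) := by
  have hu : ∀ {σ : ℝ} {Ω : ℝ → Set R2} {Γ P : ℝ → ℝ → R2}, IsHolderFlow α β T M c σ Ω Γ P →
      Continuous fun q : ℝ × ℝ => unitVec (P q.1) q.2 := fun h =>
    (h.cont_deriv.norm.inv₀ fun q => norm_ne_zero_iff.2 ((h.loop q.1).ne_zero q.2)).smul
      h.cont_deriv
  have : Continuous (uncurry fun t ξ => curveDistSq (Γ₁ t) (P₁ t) (Γ₂ t) (P₂ t) ξ) :=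
    (((h₁.cont.sub h₂.cont).norm.pow 2).add
      ((h₁.cont_deriv.norm.sub h₂.cont_deriv.norm).pow 2)).add (((hu h₁).sub (hu h₂)).norm.pow 2)
  exact intervalIntegral.continuous_parametric_intervalIntegral_of_continuous' this _ _

end IsHolderFlow

lemma IsC1Loop.signedArea_eq_of_curveEnergy_eq_zero {γ₁ p₁ γ₂ p₂ : ℝ → R2}
    (h₁ : IsC1Loop γ₁ p₁) (h₂ : IsC1Loop γ₂ p₂) (h : curveEnergy γ₁ p₁ γ₂ p₂ = 0) :
    signedArea γ₁ p₁ = signedArea γ₂ p₂ := by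
  have hc := h₁.continuous_curveDistSq h₂
  have hz : ∀ ξ ∈ Icc 0 (2 * π), curveDistSq γ₁ p₁ γ₂ p₂ ξ = 0 := by
    intro ξ hξ
    by_contra hne
    have hpos := intervalIntegral.integral_pos two_pi_pos hc.continuousOn
      (fun x _ => curveDistSq_nonneg γ₁ p₁ γ₂ p₂ x)
      ⟨ξ, hξ, (curveDistSq_nonneg γ₁ p₁ γ₂ p₂ ξ).lt_of_ne (Ne.symm hne)⟩
    exact hpos.ne' h
  unfold signedArea
  congr 1
  refine intervalIntegral.integral_congr fun ξ hξ => ?_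
  rw [uIcc_of_le two_pi_pos.le] at hξ
  have h0 := hz ξ hξ
  unfold curveDistSq at h0
  have e1 : ‖γ₁ ξ - γ₂ ξ‖ ^ 2 = 0 := by
    nlinarith [sq_nonneg ‖γ₁ ξ - γ₂ ξ‖, sq_nonneg (‖p₁ ξ‖ - ‖p₂ ξ‖),
      sq_nonneg ‖unitVec p₁ ξ - unitVec p₂ ξ‖]
  have e2 : (‖p₁ ξ‖ - ‖p₂ ξ‖) ^ 2 = 0 := by
    nlinarith [sq_nonneg ‖γ₁ ξ - γ₂ ξ‖, sq_nonneg (‖p₁ ξ‖ - ‖p₂ ξ‖),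
      sq_nonneg ‖unitVec p₁ ξ - unitVec p₂ ξ‖]
  have e3 : ‖unitVec p₁ ξ - unitVec p₂ ξ‖ ^ 2 = 0 := by
    nlinarith [sq_nonneg ‖γ₁ ξ - γ₂ ξ‖, sq_nonneg (‖p₁ ξ‖ - ‖p₂ ξ‖),
      sq_nonneg ‖unitVec p₁ ξ - unitVec p₂ ξ‖]
  have f1 : γ₁ ξ = γ₂ ξ := sub_eq_zero.1 (norm_eq_zero.1 (pow_eq_zero_iff two_ne_zero |>.1 e1))
  have f2 : ‖p₁ ξ‖ = ‖p₂ ξ‖ := sub_eq_zero.1 (pow_eq_zero_iff two_ne_zero |>.1 e2)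
  have f3 : unitVec p₁ ξ = unitVec p₂ ξ :=
    sub_eq_zero.1 (norm_eq_zero.1 (pow_eq_zero_iff two_ne_zero |>.1 e3))
  have f4 : p₁ ξ = p₂ ξ := by rw [← h₁.norm_smul_unitVec ξ, ← h₂.norm_smul_unitVec ξ, f2, f3]
  simp only [f1, f4]

namespace IsHolderFlow

variable {α β T M c σ₁ σ₂ : ℝ} {Ω₁ Ω₂ : ℝ → Set R2} {Γ₁ P₁ Γ₂ P₂ : ℝ → ℝ → R2}

lemma exists_integral_pairRate_le (h₁ : IsHolderFlow α β T M c σ₁ Ω₁ Γ₁ P₁)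
    (h₂ : IsHolderFlow α β T M c σ₂ Ω₂ Γ₂ P₂) (hα : 0 < α) (hα' : α < 1 / 2) (hβ : 2 * α < β) :
    ∃ C ≥ 0, ∀ t ∈ Icc 0 T, ∫ ξ in (0)..(2 * π), pairRate α σ₁ σ₂ Ω₁ Ω₂ Γ₁ P₁ Γ₂ P₂ t ξ ≤
      C * curveEnergy (Γ₁ t) (P₁ t) (Γ₂ t) (P₂ t) := by
  by_cases hσ : σ₁ = σ₂
  · subst hσ
    obtain ⟨C, hC, h⟩ :=
      IsHolderLoop.exists_integral_energyRate_le α β M c hα hα' hβ (h₁.loop 0).c_pos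
    exact ⟨C, hC, fun t _ => (le_abs_self _).trans (h _ _ _ _ (h₁.loop t) (h₂.loop t) _ _ _
      (h₁.bounded t) (h₂.bounded t) h₁.abs_sign.le (h₁.green t) (h₂.green t))⟩
  · have hpos : ∀ t, 0 < curveEnergy (Γ₁ t) (P₁ t) (Γ₂ t) (P₂ t) := fun t => by
      refine (curveEnergy_nonneg _ _ _ _).lt_of_ne fun h0 => ?_
      have e := (h₁.loop t).signedArea_eq_of_curveEnergy_eq_zero (h₂.loop t).toIsC1Loop h0.symm
      have a1 := h₁.area_pos t
      have a2 := h₂.area_pos t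
      rw [e] at a1
      rcases h₁.sign with s1 | s1 <;> rcases h₂.sign with s2 | s2 <;> rw [s1, s2] at hσ <;>
        first
        | exact hσ rfl
        | (rw [s1] at a1; rw [s2] at a2; linarith)
    obtain ⟨m, hm, hmin⟩ := isCompact_Icc.exists_forall_le' (s := Icc 0 T)
      (h₁.continuous_curveEnergy h₂).continuousOn fun t _ => hpos t
    obtain ⟨B, hB⟩ : ∃ B, B = rateBound α β M c * |2 * π - 0| := ⟨_, rfl⟩
    have hbd : ∀ t, ‖∫ ξ in (0)..(2 * π), pairRate α σ₁ σ₂ Ω₁ Ω₂ Γ₁ P₁ Γ₂ P₂ t ξ‖ ≤ B :=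
      fun t => hB ▸ intervalIntegral.norm_integral_le_of_norm_le_const fun ξ _ =>
        h₁.abs_pairRate_le h₂ hα hα' hβ t ξ
    have hB0 : 0 ≤ B := (norm_nonneg _).trans (hbd 0)
    refine ⟨B / m, by positivity, fun t ht => ((le_abs_self _).trans (hbd t)).trans ?_⟩
    rw [div_mul_eq_mul_div, le_div_iff₀ hm]
    exact mul_le_mul_of_nonneg_left (hmin t ht) hB0

/-- The energy of two flows satisfies Grönwall's integral inequality. -/
theorem exists_curveEnergy_le (h₁ : IsHolderFlow α β T M c σ₁ Ω₁ Γ₁ P₁)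
    (h₂ : IsHolderFlow α β T M c σ₂ Ω₂ Γ₂ P₂) (hα : 0 < α) (hα' : α < 1 / 2) (hβ : 2 * α < β) :
    ∃ C > 0, ∀ t ∈ Icc 0 T, curveEnergy (Γ₁ t) (P₁ t) (Γ₂ t) (P₂ t) ≤
      curveEnergy (Γ₁ 0) (P₁ 0) (Γ₂ 0) (P₂ 0) +
        C * ∫ τ in (0)..t, curveEnergy (Γ₁ τ) (P₁ τ) (Γ₂ τ) (P₂ τ) := by
  obtain ⟨C, hC, hrate⟩ := h₁.exists_integral_pairRate_le h₂ hα hα' hβ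
  have hE := h₁.continuous_curveEnergy h₂
  have hd := fun t ht => h₁.hasDerivAt_curveEnergy h₂ hα hα' hβ (t := t) ht
  have hE0 : ∀ t, 0 ≤ curveEnergy (Γ₁ t) (P₁ t) (Γ₂ t) (P₂ t) := fun t =>
    curveEnergy_nonneg _ _ _ _
  obtain ⟨E, hEdef⟩ : ∃ E : ℝ → ℝ, ∀ t, E t = curveEnergy (Γ₁ t) (P₁ t) (Γ₂ t) (P₂ t) :=
    ⟨_, fun _ => rfl⟩
  simp only [← hEdef] at hE hd hE0 hrate ⊢
  have hI : ∀ t, HasDerivAt (fun s => ∫ τ in (0)..s, E τ) (E t) t := fun t =>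
    intervalIntegral.integral_hasDerivAt_right (hE.intervalIntegrable _ _)
      (hE.stronglyMeasurableAtFilter _ _) hE.continuousAt
  have hanti : AntitoneOn (fun t => E t - (2 * C + 1) * ∫ τ in (0)..t, E τ) (Icc 0 T) := by
    refine antitoneOn_of_hasDerivWithinAt_nonpos (convex_Icc 0 T)
      (hE.sub (continuous_const.mul (continuous_iff_continuousAt.2 fun t =>
        (hI t).continuousAt))).continuousOn
      (f' := fun t => 2 * (∫ ξ in (0)..(2 * π), pairRate α σ₁ σ₂ Ω₁ Ω₂ Γ₁ P₁ Γ₂ P₂ t ξ) -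
        (2 * C + 1) * E t) (fun t ht => ?_) fun t ht => ?_
    · rw [interior_Icc] at ht
      exact ((hd t ht).fun_sub ((hI t).const_mul _)).hasDerivWithinAt
    · have := hrate t (interior_subset ht)
      have := hE0 t
      linarith
  refine ⟨2 * C + 1, by linarith, fun t ht => ?_⟩
  have := hanti ⟨le_rfl, ht.1.trans ht.2⟩ ht ht.1
  simp only [intervalIntegral.integral_same, mul_zero, sub_zero] at this
  linarith

end IsHolderFlow

lemma patchDelta_eq_curveEnergy {γ₁ γ₂ : ℝ → ℝ → R2} {t : ℝ}
    (h₁ : IsC1Loop (fun x => γ₁ x t) fun x => pderiv γ₁ x t)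
    (h₂ : IsC1Loop (fun x => γ₂ x t) fun x => pderiv γ₂ x t) :
    patchDelta γ₁ γ₂ t = curveEnergy (fun x => γ₁ x t) (fun x => pderiv γ₁ x t)
      (fun x => γ₂ x t) fun x => pderiv γ₂ x t := by
  have c1 : Continuous fun x => ‖γ₁ x t - γ₂ x t‖ ^ 2 := (h₁.cont.sub h₂.cont).norm.pow 2
  have c2 : Continuous fun x => (‖pderiv γ₁ x t‖ - ‖pderiv γ₂ x t‖) ^ 2 :=
    (h₁.cont_deriv.norm.sub h₂.cont_deriv.norm).pow 2
  have c3 : Continuous fun x => ‖unitVec (fun x => pderiv γ₁ x t) x -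
      unitVec (fun x => pderiv γ₂ x t) x‖ ^ 2 :=
    (h₁.continuous_unitVec.sub h₂.continuous_unitVec).norm.pow 2
  have c12 : Continuous fun x => ‖γ₁ x t - γ₂ x t‖ ^ 2 +
    (‖pderiv γ₁ x t‖ - ‖pderiv γ₂ x t‖) ^ 2 := c1.add c2
  unfold curveEnergy curveDistSq
  rw [intervalIntegral.integral_add (c12.intervalIntegrable _ _) (c3.intervalIntegrable _ _),
    intervalIntegral.integral_add (c1.intervalIntegrable _ _) (c2.intervalIntegrable _ _)]
  simp only [intervalIntegral.integral_of_le two_pi_pos.le]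
  simp only [patchDelta, L2sq, metricOf, tangentOf, unitVec, norm_eq_abs, sq_abs]

/-- **Theorem 4.1 (stability of flows)**: for `0 < α < 1/2` and `β > 2α`, if `γ₁, γ₂`
are `C^{1,β}` flows of two `C^{1,β}` patch solutions of α-SQG, then
`δ(t) = |γ₁-γ₂|²_{L²} + |g₁-g₂|²_{L²} + |T₁-T₂|²_{L²}` is continuous and satisfies
`δ(t) ≤ δ(0) + C ∫₀ᵗ δ(τ) dτ` on `[0,T]`. -/
theorem stability_of_flows (α β T : ℝ) (hα0 : 0 < α) (hα : α < 1/2)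
    (hβ : 2 * α < β) (hT : 0 ≤ T)
    (Ω₁ Ω₂ : ℝ → Set R2) (γ₁ γ₂ : ℝ → ℝ → R2)
    (hΩ₁ : IsC1BetaPatchSol α T β Ω₁) (hΩ₂ : IsC1BetaPatchSol α T β Ω₂)
    (hγ₁ : IsC1BetaFlow α β T Ω₁ γ₁) (hγ₂ : IsC1BetaFlow α β T Ω₂ γ₂) :
    ContinuousOn (patchDelta γ₁ γ₂) (Icc (0:ℝ) T) ∧
    ∃ C > (0:ℝ), ∀ t ∈ Icc (0:ℝ) T,
      patchDelta γ₁ γ₂ t ≤ patchDelta γ₁ γ₂ 0 + C * ∫ τ in (0:ℝ)..t, patchDelta γ₁ γ₂ τ := by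
  have hβ0 : 0 < β := by linarith
  obtain ⟨M₁, c₁, σ₁, f₁⟩ := hγ₁.exists_isHolderFlow hβ0 hT hΩ₁.1
  obtain ⟨M₂, c₂, σ₂, f₂⟩ := hγ₂.exists_isHolderFlow hβ0 hT hΩ₂.1
  have hc : 0 < min c₁ c₂ := lt_min (f₁.loop 0).c_pos (f₂.loop 0).c_pos
  replace f₁ := f₁.mono (le_max_left M₁ M₂) hc (min_le_left c₁ c₂)
  replace f₂ := f₂.mono (le_max_right M₁ M₂) hc (min_le_right c₁ c₂)
  have heq : ∀ t ∈ Icc 0 T, patchDelta γ₁ γ₂ t =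
      curveEnergy (fun x => γ₁ x (clampTime T t)) (fun x => pderiv γ₁ x (clampTime T t))
        (fun x => γ₂ x (clampTime T t)) (fun x => pderiv γ₂ x (clampTime T t)) := fun t ht => by
    have h := patchDelta_eq_curveEnergy (f₁.loop t).toIsC1Loop (f₂.loop t).toIsC1Loop
    rwa [clampTime_of_mem ht] at h ⊢
  refine ⟨(f₁.continuous_curveEnergy f₂).continuousOn.congr heq, ?_⟩
  obtain ⟨C, hC, h⟩ := f₁.exists_curveEnergy_le f₂ hα0 hα hβ
  refine ⟨C, hC, fun t ht => ?_⟩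
  rw [heq t ht, heq 0 ⟨le_rfl, hT⟩, intervalIntegral.integral_congr fun τ hτ => heq τ ?_]
  · exact h t ht
  · rw [uIcc_of_le ht.1] at hτ
    exact ⟨hτ.1, hτ.2.trans ht.2⟩
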